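/- Uniform non-amenability (uniform Cheeger constant): Let K be a field and Γ a finitely generated subgroup of GL_n(K) that is not virtually solvable. Then there exists h > 0 such that for every finite symmetric generating set Σ of Γ with 1 ∈ Σ and every nonempty finite subset A ⊆ Γ, #(∂A) ≥ h·#A, where ∂A = A \ ⋂_{s∈Σ} sA is the inner boundary of A in the Cayley graph of (Γ,Σ). In other words, the uniform Cheeger constant h_Γ = inf over finite symmetric generating sets Σ of the Cheeger constant h_Γ(Σ) is positive, i.e. Γ is uniformly non-amenable. -/

import Mathlib

open Matrix Pointwise

set_option linter.unusedSectionVars false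
set_option linter.deprecated false

section Part1

/-- Finitely additive probability measures. -/
structure FAM (X : Type*) where
  m : Set X → ℝ
  nonneg : ∀ s, 0 ≤ m s
  univ : m Set.univ = 1
  add : ∀ s t, Disjoint s t → m (s ∪ t) = m s + m t

namespace FAM
variable {X Y : Type*}

lemma empty (M : FAM X) : M.m ∅ = 0 := by
  have := M.add ∅ ∅ (by simp)
  simp at this; exact this

lemma diff (M : FAM X) {s t : Set X} (h : s ⊆ t) : M.m (t \ s) = M.m t - M.m s := by
  have := M.add s (t \ s) Set.disjoint_sdiff_right
  rw [Set.union_diff_cancel h] at this; linarith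

lemma mono (M : FAM X) {s t : Set X} (h : s ⊆ t) : M.m s ≤ M.m t := by
  have := M.diff h; have := M.nonneg (t \ s); linarith

lemma compl (M : FAM X) (s : Set X) : M.m sᶜ = 1 - M.m s := by
  have := M.diff (Set.subset_univ s)
  rw [M.univ, ← Set.compl_eq_univ_diff] at this; exact this

lemma le_one (M : FAM X) (s : Set X) : M.m s ≤ 1 := by
  rw [← M.univ]; exact M.mono (Set.subset_univ s)

lemma union_inter (M : FAM X) (s t : Set X) : M.m (s ∪ t) + M.m (s ∩ t) = M.m s + M.m t := by
  have h1 := M.add s (t \ s) Set.disjoint_sdiff_right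
  rw [Set.union_diff_self] at h1
  have h2 := M.diff (s := s ∩ t) (t := t) Set.inter_subset_right
  have : t \ (s ∩ t) = t \ s := by ext; simp
  rw [this] at h2; linarith

lemma union_le (M : FAM X) (s t : Set X) : M.m (s ∪ t) ≤ M.m s + M.m t := by
  have := M.union_inter s t; have := M.nonneg (s ∩ t); linarith

/-- pushforward -/
def map (f : X → Y) (M : FAM X) : FAM Y where
  m s := M.m (f ⁻¹' s)
  nonneg s := M.nonneg _
  univ := by simpa using M.univ
  add s t h := by
    rw [Set.preimage_union]; exact M.add _ _ (h.preimage f)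

lemma bonferroni {α : Type*} [DecidableEq α] (M : FAM X) (F : Finset α) (A : α → Set X) (η : ℝ)
    (h : ∀ i ∈ F, ∀ l ∈ F, i ≠ l → M.m (A i ∩ A l) ≤ η) (hη : 0 ≤ η) :
    ∑ i ∈ F, M.m (A i) ≤ M.m (⋃ i ∈ F, A i) + F.card ^ 2 * η := by
  induction F using Finset.induction_on with
  | empty => simp [M.empty]
  | insert i F hi ih =>
    have ih' := ih (fun j hj l hl => h j (Finset.mem_insert_of_mem hj) l (Finset.mem_insert_of_mem hl))
    rw [Finset.sum_insert hi, Finset.set_biUnion_insert, Finset.card_insert_of_notMem hi]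
    have h1 := M.union_inter (A i) (⋃ j ∈ F, A j)
    have h2 : ∀ G : Finset α, G ⊆ F → M.m (A i ∩ ⋃ j ∈ G, A j) ≤ G.card * η := by
      intro G
      induction G using Finset.induction_on with
      | empty => simp [M.empty]
      | insert j G hj ih2 =>
        intro hG
        rw [Finset.set_biUnion_insert, Set.inter_union_distrib_left,
          Finset.card_insert_of_notMem hj]
        have := ih2 (fun x hx => hG (Finset.mem_insert_of_mem hx))
        have h3 := M.union_le (A i ∩ A j) (A i ∩ ⋃ j ∈ G, A j)
        have hjF : j ∈ F := hG (Finset.mem_insert_self _ _)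
        have h4 := h i (Finset.mem_insert_self _ _) j (Finset.mem_insert_of_mem hjF)
          (by rintro rfl; exact hi hjF)
        push_cast; linarith
    have h3 := h2 F subset_rfl
    push_cast
    nlinarith [Nat.cast_nonneg (α := ℝ) F.card]

/-- conull filter -/
def ae (M : FAM X) : Filter X where
  sets := {s | M.m sᶜ = 0}
  univ_sets := by simp [M.empty]
  sets_of_superset {s t} hs h := by
    have := M.mono (Set.compl_subset_compl.2 h)
    have h2 := M.nonneg tᶜ
    simp only [Set.mem_setOf_eq] at hs ⊢
    linarith
  inter_sets {s t} hs ht := by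
    simp only [Set.mem_setOf_eq] at hs ht ⊢
    rw [Set.compl_inter]
    have := M.union_le sᶜ tᶜ
    have h2 := M.nonneg (sᶜ ∪ tᶜ)
    linarith

lemma mem_ae {M : FAM X} {s : Set X} : s ∈ M.ae ↔ M.m sᶜ = 0 := Iff.rfl

instance (M : FAM X) : M.ae.NeBot := by
  constructor
  intro h
  have : (∅ : Set X) ∈ M.ae := by rw [h]; trivial
  rw [mem_ae, Set.compl_empty, M.univ] at this
  norm_num at this

lemma le_of_ae (M : FAM X) {s t : Set X} (h : ∀ᶠ z in M.ae, z ∈ s → z ∈ t) : M.m s ≤ M.m t := by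
  have h' : M.m {z | z ∈ s → z ∈ t}ᶜ = 0 := h
  have : s ⊆ t ∪ {z | z ∈ s → z ∈ t}ᶜ := by
    intro x hx
    by_cases hxt : x ∈ t
    · exact Or.inl hxt
    · right; simp [hx, hxt]
  have := M.mono this
  have := M.union_le t {z | z ∈ s → z ∈ t}ᶜ
  linarith

lemma zero_of_ae (M : FAM X) {s : Set X} (h : ∀ᶠ z in M.ae, z ∉ s) : M.m s = 0 := by
  have := M.le_of_ae (s := s) (t := ∅) (h.mono fun z hz hs => (hz hs).elim)
  rw [M.empty] at this
  exact le_antisymm this (M.nonneg _)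

end FAM

/-- l1 norm w.r.t. an absolute value -/
noncomputable def vnrm {K ι : Type*} [Field K] [Fintype ι] (a : AbsoluteValue K ℝ) (x : ι → K) : ℝ :=
  ∑ i, a (x i)

noncomputable def mnrm {K ι : Type*} [Field K] [Fintype ι] (a : AbsoluteValue K ℝ) (B : Matrix ι ι K) : ℝ :=
  ∑ i, ∑ j, a (B i j)

section nrm
variable {K ι : Type*} [Field K] [Fintype ι] (a : AbsoluteValue K ℝ)

lemma vnrm_nonneg (x : ι → K) : 0 ≤ vnrm a x := Finset.sum_nonneg fun _ _ => a.nonneg _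
lemma mnrm_nonneg (x : Matrix ι ι K) : 0 ≤ mnrm a x :=
  Finset.sum_nonneg fun _ _ => Finset.sum_nonneg fun _ _ => a.nonneg _

lemma vnrm_pos {x : ι → K} (hx : x ≠ 0) : 0 < vnrm a x := by
  obtain ⟨i, hi⟩ := Function.ne_iff.1 hx
  exact Finset.sum_pos' (fun _ _ => a.nonneg _) ⟨i, Finset.mem_univ _, a.pos hi⟩

lemma vnrm_add (x y : ι → K) : vnrm a (x + y) ≤ vnrm a x + vnrm a y := by
  unfold vnrm; rw [← Finset.sum_add_distrib]
  exact Finset.sum_le_sum fun i _ => a.add_le _ _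

lemma vnrm_smul (c : K) (x : ι → K) : vnrm a (c • x) = a c * vnrm a x := by
  unfold vnrm; rw [Finset.mul_sum]; simp

lemma vnrm_mulVec (B : Matrix ι ι K) (x : ι → K) : vnrm a (B *ᵥ x) ≤ mnrm a B * vnrm a x := by
  unfold vnrm mnrm
  rw [Finset.sum_mul]
  refine Finset.sum_le_sum fun i _ => ?_
  calc a ((B *ᵥ x) i) ≤ ∑ j, a (B i j * x j) := by
        exact a.sum_le _ _
    _ ≤ ∑ j, a (B i j) * ∑ j, a (x j) := by
        refine Finset.sum_le_sum fun j _ => ?_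
        rw [a.map_mul]
        exact mul_le_mul_of_nonneg_left
          (Finset.single_le_sum (f := fun j => a (x j)) (fun _ _ => a.nonneg _) (Finset.mem_univ j)) (a.nonneg _)
    _ = _ := by rw [Finset.sum_mul]

lemma mnrm_add (x y : Matrix ι ι K) : mnrm a (x + y) ≤ mnrm a x + mnrm a y := by
  unfold mnrm; rw [← Finset.sum_add_distrib]
  refine Finset.sum_le_sum fun i _ => ?_
  rw [← Finset.sum_add_distrib]
  exact Finset.sum_le_sum fun j _ => a.add_le _ _

lemma mnrm_smul (c : K) (x : Matrix ι ι K) : mnrm a (c • x) = a c * mnrm a x := by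
  unfold mnrm; simp [Finset.mul_sum]

lemma mnrm_mul (B C : Matrix ι ι K) : mnrm a (B * C) ≤ mnrm a B * mnrm a C := by
  have h (D : Matrix ι ι K) : mnrm a D = ∑ j, vnrm a (D.col j) := by
    unfold mnrm vnrm; rw [Finset.sum_comm]; rfl
  rw [h, h C, Finset.mul_sum]
  refine Finset.sum_le_sum fun j _ => ?_
  exact vnrm_mulVec a B (C.col j)

end nrm

/-- asymptotic evaluation of a field `E` of germs -/
structure Asy {Z : Type*} (l : Filter Z) (E : Type*) {K : Type*} [Field E] [Field K]
    (a : AbsoluteValue K ℝ) (T : Z → ℝ) where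
  seq : E → Z → K
  add : ∀ x y, ∀ᶠ k in l, seq (x + y) k = seq x k + seq y k
  mul : ∀ x y, ∀ᶠ k in l, seq (x * y) k = seq x k * seq y k
  zero : ∀ᶠ k in l, seq 0 k = 0
  one : ∀ᶠ k in l, seq 1 k = 1
  bdd : ∀ x, ∃ C : ℕ, ∀ᶠ k in l, a (seq x k) ≤ T k ^ C

namespace Asy
variable {Z E K ι : Type*} [Field E] [Field K] {l : Filter Z} {a : AbsoluteValue K ℝ} {T : Z → ℝ}
  (Φ : Asy l E a T) [Fintype ι] [DecidableEq ι]

def mp (B : Matrix ι ι E) (k : Z) : Matrix ι ι K := B.map (fun x => Φ.seq x k)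

lemma mp_add (B C : Matrix ι ι E) : ∀ᶠ k in l, Φ.mp (B + C) k = Φ.mp B k + Φ.mp C k := by
  have : ∀ᶠ k in l, ∀ i j, Φ.seq (B i j + C i j) k = Φ.seq (B i j) k + Φ.seq (C i j) k := by
    simp only [Filter.eventually_all]; exact fun i j => Φ.add _ _
  filter_upwards [this] with k hk
  ext i j; simp [mp, hk]

lemma seq_sum {κ : Type*} (s : Finset κ) (f : κ → E) :
    ∀ᶠ k in l, Φ.seq (∑ i ∈ s, f i) k = ∑ i ∈ s, Φ.seq (f i) k := by
  classical
  induction s using Finset.induction_on with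
  | empty => simpa using Φ.zero
  | insert i s hi ih =>
    filter_upwards [ih, Φ.add (f i) (∑ i ∈ s, f i)] with k h1 h2
    rw [Finset.sum_insert hi, Finset.sum_insert hi, h2, h1]

lemma mp_mul (B C : Matrix ι ι E) : ∀ᶠ k in l, Φ.mp (B * C) k = Φ.mp B k * Φ.mp C k := by
  have h1 : ∀ᶠ k in l, ∀ i j, Φ.seq (∑ p, B i p * C p j) k = ∑ p, Φ.seq (B i p * C p j) k := by
    simp only [Filter.eventually_all]; exact fun i j => Φ.seq_sum _ _
  have h2 : ∀ᶠ k in l, ∀ i p j, Φ.seq (B i p * C p j) k = Φ.seq (B i p) k * Φ.seq (C p j) k := by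
    simp only [Filter.eventually_all]; exact fun i p j => Φ.mul _ _
  filter_upwards [h1, h2] with k hk hk2
  ext i j; simp [mp, Matrix.mul_apply, hk, hk2]

lemma mp_one : ∀ᶠ k in l, Φ.mp (1 : Matrix ι ι E) k = 1 := by
  filter_upwards [Φ.one, Φ.zero] with k h1 h2
  ext i j
  by_cases h : i = j
  · subst h; simp [mp, h1]
  · simp [mp, h, h2]

lemma mp_zero : ∀ᶠ k in l, Φ.mp (0 : Matrix ι ι E) k = 0 := by
  filter_upwards [Φ.zero] with k h2
  ext i j
  simp [mp, h2]

lemma mp_smul (c : E) (B : Matrix ι ι E) : ∀ᶠ k in l, Φ.mp (c • B) k = Φ.seq c k • Φ.mp B k := by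
  have : ∀ᶠ k in l, ∀ i j, Φ.seq (c * B i j) k = Φ.seq c k * Φ.seq (B i j) k := by
    simp only [Filter.eventually_all]; exact fun i j => Φ.mul _ _
  filter_upwards [this] with k hk
  ext i j; simp [mp, hk]

lemma seq_ne_zero {x : E} (hx : x ≠ 0) : ∀ᶠ k in l, Φ.seq x k ≠ 0 := by
  filter_upwards [Φ.mul x x⁻¹, Φ.one] with k h1 h2 h3
  rw [mul_inv_cancel₀ hx, h2, h3, zero_mul] at h1
  exact one_ne_zero h1

lemma mp_ne_zero {B : Matrix ι ι E} (hB : B ≠ 0) : ∀ᶠ k in l, Φ.mp B k ≠ 0 := by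
  obtain ⟨i, j, h⟩ : ∃ i j, B i j ≠ 0 := by
    by_contra! h; exact hB (by ext i j; exact h i j)
  filter_upwards [Φ.seq_ne_zero h] with k hk h0
  exact hk (congrFun (congrFun h0 i) j)

lemma mp_bdd (hT : ∀ R : ℝ, ∀ᶠ k in l, R ≤ T k) (B : Matrix ι ι E) :
    ∃ C : ℕ, ∀ᶠ k in l, mnrm a (Φ.mp B k) ≤ T k ^ C := by
  choose C hC using fun i j => Φ.bdd (B i j)
  let D := ∑ i, ∑ j, C i j
  have hD : ∀ i j, C i j ≤ D := fun i j =>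
    (Finset.single_le_sum (f := fun j => C i j) (fun _ _ => Nat.zero_le _) (Finset.mem_univ j)).trans
    (Finset.single_le_sum (f := fun i => ∑ j, C i j) (fun _ _ => Nat.zero_le _) (Finset.mem_univ i))
  refine ⟨D + 1, ?_⟩
  have h1 : ∀ᶠ k in l, ∀ i j, a (Φ.seq (B i j) k) ≤ T k ^ C i j := by
    simp only [Filter.eventually_all]; exact hC
  filter_upwards [h1, hT 1, hT ((Fintype.card ι : ℝ) * Fintype.card ι)] with k h1 h2 h3
  calc mnrm a (Φ.mp B k) ≤ ∑ i : ι, ∑ j : ι, T k ^ D :=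
        Finset.sum_le_sum fun i _ => Finset.sum_le_sum fun j _ =>
          (h1 i j).trans (pow_le_pow_right₀ h2 (hD i j))
    _ = ((Fintype.card ι : ℝ) * Fintype.card ι) * T k ^ D := by simp [mul_assoc]
    _ ≤ T k * T k ^ D := mul_le_mul_of_nonneg_right h3 (by positivity)
    _ = _ := by ring

end Asy

end Part1

section Part2

lemma exists_comp_of_ker_le {E V V' V'' : Type*} [Field E] [AddCommGroup V] [Module E V]
    [AddCommGroup V'] [Module E V'] [AddCommGroup V''] [Module E V'']
    (f : V →ₗ[E] V') (g : V →ₗ[E] V'') (h : LinearMap.ker f ≤ LinearMap.ker g) :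
    ∃ k : V' →ₗ[E] V'', g = k ∘ₗ f := by
  obtain ⟨k, hk⟩ := LinearMap.exists_extend
    (((LinearMap.ker f).liftQ g h) ∘ₗ f.quotKerEquivRange.symm.toLinearMap)
  refine ⟨k, ?_⟩
  ext v
  have := LinearMap.congr_fun hk ⟨f v, LinearMap.mem_range_self f v⟩
  simp only [LinearMap.comp_apply, Submodule.subtype_apply] at this ⊢
  rw [this]
  have h2 : f.quotKerEquivRange.symm ⟨f v, LinearMap.mem_range_self f v⟩ =
      Submodule.Quotient.mk v := by
    rw [LinearEquiv.symm_apply_eq]; rfl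
  rw [LinearEquiv.coe_coe, h2]; simp

section
variable {E ι : Type*} [Field E] [Fintype ι] [DecidableEq ι]

lemma exists_matrix_ker (W : Submodule E (ι → E)) :
    ∃ B : Matrix ι ι E, LinearMap.ker (toLin' B) = W := by
  obtain ⟨W', h⟩ := W.exists_isCompl
  refine ⟨LinearMap.toMatrix' (W'.subtype ∘ₗ W'.projectionOnto W h.symm), ?_⟩
  rw [toLin'_toMatrix', LinearMap.ker_comp_of_ker_eq_bot _ W'.ker_subtype]
  simp

lemma matrix_factor (B B' : Matrix ι ι E) (h : LinearMap.ker (toLin' B) ≤ LinearMap.ker (toLin' B')) :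
    ∃ Y, B' = Y * B := by
  obtain ⟨k, hk⟩ := exists_comp_of_ker_le _ _ h
  refine ⟨LinearMap.toMatrix' k, ?_⟩
  apply toLin'.injective
  rw [toLin'_mul, toLin'_toMatrix', hk]

lemma matrix_factor2 (B B' B'' : Matrix ι ι E)
    (h : LinearMap.ker (toLin' B) ⊓ LinearMap.ker (toLin' B') ≤ LinearMap.ker (toLin' B'')) :
    ∃ Y Y', B'' = Y * B + Y' * B' := by
  obtain ⟨k, hk⟩ := exists_comp_of_ker_le ((toLin' B).prod (toLin' B')) (toLin' B'')
    (by rw [LinearMap.ker_prod]; exact h)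
  refine ⟨LinearMap.toMatrix' (k ∘ₗ LinearMap.inl _ _ _), LinearMap.toMatrix' (k ∘ₗ LinearMap.inr _ _ _), ?_⟩
  apply toLin'.injective
  rw [map_add, toLin'_mul, toLin'_toMatrix', toLin'_mul, toLin'_toMatrix', hk]
  apply LinearMap.ext; intro v
  simp only [LinearMap.comp_apply, LinearMap.add_apply, LinearMap.prod_apply, Pi.prod]
  rw [← map_add]; simp
end

section Core
variable {Z E K ι : Type*} [Field E] [Field K] [Fintype ι] [DecidableEq ι] {M : FAM Z}
  {a : AbsoluteValue K ℝ} {T : Z → ℝ} (Φ : Asy M.ae E a T) (x : Z → ι → K)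

def Asy.Nb (j : ℕ) (B : Matrix ι ι E) : Set Z :=
  {z | T z ^ j * vnrm a (Φ.mp B z *ᵥ x z) ≤ vnrm a (x z)}

noncomputable def Asy.mu (B : Matrix ι ι E) : ℝ := ⨅ j, M.m (Φ.Nb x j B)

lemma Asy.mu_nonneg (B : Matrix ι ι E) : 0 ≤ Φ.mu x B := le_ciInf fun _ => M.nonneg _

lemma Asy.mu_le (B : Matrix ι ι E) (j : ℕ) : Φ.mu x B ≤ M.m (Φ.Nb x j B) :=
  ciInf_le ⟨0, by rintro _ ⟨j, rfl⟩; exact M.nonneg _⟩ j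


lemma Asy.Nb_anti (hT : ∀ R : ℝ, ∀ᶠ k in M.ae, R ≤ T k) (B : Matrix ι ι E) {i j : ℕ} (h : i ≤ j) :
    ∀ᶠ z in M.ae, z ∈ Φ.Nb x j B → z ∈ Φ.Nb x i B := by
  filter_upwards [hT 1] with z hz h1
  simp only [Asy.Nb, Set.mem_setOf_eq] at h1 ⊢
  refine le_trans ?_ h1
  exact mul_le_mul_of_nonneg_right (pow_le_pow_right₀ hz h) (vnrm_nonneg _ _)

lemma Asy.mu_lt (hT : ∀ R : ℝ, ∀ᶠ k in M.ae, R ≤ T k) {B : Matrix ι ι E} {c : ℝ} (h : Φ.mu x B < c) :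
    ∃ j0, ∀ j ≥ j0, M.m (Φ.Nb x j B) < c := by
  obtain ⟨j0, hj⟩ := exists_lt_of_ciInf_lt h
  exact ⟨j0, fun j h => (M.le_of_ae (Φ.Nb_anti x hT B h)).trans_lt hj⟩

lemma Asy.comb (hT : ∀ R : ℝ, ∀ᶠ k in M.ae, R ≤ T k) (B B' Y Y' : Matrix ι ι E) (j : ℕ) : ∃ j0, ∀ j' ≥ j0,
    ∀ᶠ z in M.ae, z ∈ Φ.Nb x j' B → z ∈ Φ.Nb x j' B' → z ∈ Φ.Nb x j (Y * B + Y' * B') := by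
  obtain ⟨C, hC⟩ := Φ.mp_bdd hT Y
  obtain ⟨C', hC'⟩ := Φ.mp_bdd hT Y'
  refine ⟨j + C + C' + 1, fun j' hj' => ?_⟩
  filter_upwards [hC, hC', hT 2, Φ.mp_mul Y B, Φ.mp_mul Y' B', Φ.mp_add (Y * B) (Y' * B'),
    Φ.Nb_anti x hT B hj', Φ.Nb_anti x hT B' hj'] with z h1 h2 h3 h4 h5 h6 h7 h8 h9 h10
  have h7 := h7 h9
  have h8 := h8 h10
  simp only [Asy.Nb, Set.mem_setOf_eq] at h7 h8 ⊢
  rw [h6, h4, h5, add_mulVec, ← mulVec_mulVec, ← mulVec_mulVec]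
  have e1 := vnrm_add a (Φ.mp Y z *ᵥ (Φ.mp B z *ᵥ x z)) (Φ.mp Y' z *ᵥ (Φ.mp B' z *ᵥ x z))
  have e2 := vnrm_mulVec a (Φ.mp Y z) (Φ.mp B z *ᵥ x z)
  have e3 := vnrm_mulVec a (Φ.mp Y' z) (Φ.mp B' z *ᵥ x z)
  set u := vnrm a (Φ.mp B z *ᵥ x z)
  set u' := vnrm a (Φ.mp B' z *ᵥ x z)
  have hu : 0 ≤ u := vnrm_nonneg _ _
  have hu' : 0 ≤ u' := vnrm_nonneg _ _
  have hT1 : 1 ≤ T z := by linarith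
  have hT0 : 0 ≤ T z := by linarith
  have f1 : mnrm a (Φ.mp Y z) * u ≤ T z ^ (C + C') * u :=
    mul_le_mul_of_nonneg_right (h1.trans (pow_le_pow_right₀ hT1 (by lia))) hu
  have f2 : mnrm a (Φ.mp Y' z) * u' ≤ T z ^ (C + C') * u' :=
    mul_le_mul_of_nonneg_right (h2.trans (pow_le_pow_right₀ hT1 (by lia))) hu'
  have h0 := vnrm_nonneg a (x z)
  have key : 2 * (T z ^ j * (T z ^ (C + C') * u + T z ^ (C + C') * u')) ≤ 2 * vnrm a (x z) := by
    calc 2 * (T z ^ j * (T z ^ (C + C') * u + T z ^ (C + C') * u'))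
        ≤ T z * (T z ^ j * (T z ^ (C + C') * u + T z ^ (C + C') * u')) :=
          mul_le_mul_of_nonneg_right h3 (by positivity)
      _ = T z ^ (j + C + C' + 1) * u + T z ^ (j + C + C' + 1) * u' := by ring
      _ ≤ _ := by linarith
  calc _ ≤ T z ^ j * (T z ^ (C + C') * u + T z ^ (C + C') * u') :=
        mul_le_mul_of_nonneg_left (by linarith) (by positivity)
    _ ≤ _ := by linarith

lemma Asy.mu_mono (hT : ∀ R : ℝ, ∀ᶠ k in M.ae, R ≤ T k) {B B' : Matrix ι ι E} (h : LinearMap.ker (toLin' B) ≤ LinearMap.ker (toLin' B')) :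
    Φ.mu x B ≤ Φ.mu x B' := by
  obtain ⟨Y, rfl⟩ := matrix_factor _ _ h
  refine le_ciInf fun j => ?_
  obtain ⟨j0, h⟩ := Φ.comb x hT B B Y 0 j
  refine (Φ.mu_le x B j0).trans (M.le_of_ae ?_)
  filter_upwards [h j0 le_rfl] with z hz h1
  simpa using hz h1 h1

lemma Asy.mu_inj (hT : ∀ R : ℝ, ∀ᶠ k in M.ae, R ≤ T k) (hx : ∀ᶠ z in M.ae, x z ≠ 0) {B : Matrix ι ι E}
    (h : LinearMap.ker (toLin' B) = ⊥) : Φ.mu x B = 0 := by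
  refine le_antisymm ?_ (Φ.mu_nonneg x B)
  obtain ⟨Y, hY⟩ := matrix_factor B 1 (by rw [h]; exact bot_le)
  obtain ⟨j0, h⟩ := Φ.comb x hT B B Y 0 1
  refine (Φ.mu_le x B j0).trans (le_of_eq (M.zero_of_ae ?_))
  filter_upwards [h j0 le_rfl, hx, hT 2, Φ.mp_one (ι := ι)] with z hz h1 h2 h3 h4
  have := hz h4 h4
  rw [zero_mul, add_zero, ← hY] at this
  simp only [Asy.Nb, Set.mem_setOf_eq, h3, one_mulVec, pow_one] at this
  have := vnrm_pos a h1
  nlinarith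

theorem Asy.core (hT : ∀ R : ℝ, ∀ᶠ k in M.ae, R ≤ T k) (hx : ∀ᶠ z in M.ae, x z ≠ 0) (SS RR : Set (Matrix ι ι E))
    (hcomm : ∀ s ∈ SS, ∀ r ∈ RR, s * r = r * s)
    (hinv : ∀ s ∈ SS, ∃ s' ∈ SS, s * s' = 1)
    (hS : ∀ s ∈ SS, ∀ B j, M.m {z | T z ^ j * vnrm a (Φ.mp B z *ᵥ (Φ.mp s z *ᵥ x z)) ≤
      vnrm a (Φ.mp s z *ᵥ x z)} = M.m (Φ.Nb x j B))
    (P H : Matrix ι ι E) (hP : P ≠ 0) (hH : H ≠ 0) (hPR : ∀ r ∈ RR, P * r = r * P)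
    (hHR : ∀ r ∈ RR, H * r = r * H) (hPH : ∀ j, 1 ≤ M.m (Φ.Nb x j P) + M.m (Φ.Nb x j H)) :
    ∃ F : Set (Submodule E (ι → E)), F.Finite ∧ F.Nonempty ∧ ∀ W ∈ F, W ≠ ⊥ ∧ W ≠ ⊤ ∧
      (∀ r ∈ RR, W ≤ W.comap (toLin' r)) ∧ ∀ s ∈ SS, W.comap (toLin' s) ∈ F := by
  classical
  choose b hb using exists_matrix_ker (E := E) (ι := ι)
  let ν : Submodule E (ι → E) → ℝ := fun W => Φ.mu x (b W)
  have νmono : ∀ {W W'}, W ≤ W' → ν W ≤ ν W' := fun h =>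
    Φ.mu_mono x hT (by rw [hb, hb]; exact h)
  have νker : ∀ B, ν (LinearMap.ker (toLin' B)) = Φ.mu x B := fun B =>
    le_antisymm (Φ.mu_mono x hT (by rw [hb])) (Φ.mu_mono x hT (by rw [hb]))
  have νbot : ν ⊥ = 0 := Φ.mu_inj x hT hx (hb _)
  -- invariance
  have hle : ∀ s ∈ SS, ∀ W, ν (W.comap (toLin' s)) ≤ ν W := by
    intro s hs W
    obtain ⟨s', hs', h1⟩ := hinv s hs
    have hk : W.comap (toLin' s) = LinearMap.ker (toLin' (b W * s)) := by
      rw [toLin'_mul, LinearMap.ker_comp, hb]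
    rw [hk, νker]
    refine le_ciInf fun j => ?_
    obtain ⟨C, hC⟩ := Φ.mp_bdd hT s'
    refine (Φ.mu_le x _ (j + C)).trans ?_
    rw [← hS s hs (b W) j]
    refine M.le_of_ae ?_
    have h1' : s' * s = 1 := mul_eq_one_comm.1 h1
    filter_upwards [hC, hT 1, Φ.mp_mul (b W) s, Φ.mp_mul s' s, Φ.mp_one (ι := ι)] with z e1 e2 e3 e4 e5 e6
    simp only [Asy.Nb, Set.mem_setOf_eq, e3] at e6 ⊢
    rw [← mulVec_mulVec] at e6
    have e7 := vnrm_mulVec a (Φ.mp s' z) (Φ.mp s z *ᵥ x z)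
    rw [mulVec_mulVec, ← e4, h1', e5, one_mulVec] at e7
    have hu := vnrm_nonneg a (Φ.mp s z *ᵥ x z)
    have e8 := e6.trans (e7.trans (mul_le_mul_of_nonneg_right e1 hu))
    have : 0 < T z ^ C := by positivity
    refine le_of_mul_le_mul_left ?_ this
    calc _ = _ := ?_
      _ ≤ _ := e8
    ring
  have hge : ∀ s ∈ SS, ∀ W, ν (W.comap (toLin' s)) = ν W := by
    intro s hs W
    refine le_antisymm (hle s hs W) ?_
    obtain ⟨s', hs', h1⟩ := hinv s hs
    have := hle s' hs' (W.comap (toLin' s))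
    rwa [← Submodule.comap_comp, ← toLin'_mul, h1, toLin'_one, Submodule.comap_id] at this
  let St : Submodule E (ι → E) → Prop := fun W => ∀ r ∈ RR, W ≤ W.comap (toLin' r)
  have hStker : ∀ P : Matrix ι ι E, (∀ r ∈ RR, P * r = r * P) → St (LinearMap.ker (toLin' P)) := by
    intro P hP r hr v hv
    rw [LinearMap.mem_ker] at hv
    rw [Submodule.mem_comap, LinearMap.mem_ker, ← LinearMap.comp_apply, ← toLin'_mul, hP r hr,
      toLin'_mul, LinearMap.comp_apply, hv, map_zero]
  have htop : ∀ P : Matrix ι ι E, P ≠ 0 → LinearMap.ker (toLin' P) ≠ ⊤ := by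
    intro P hP h
    exact hP (toLin'.injective (by rw [map_zero]; exact LinearMap.ker_eq_top.1 h))
  obtain ⟨W0, hW0, hW0t, hW0ν⟩ : ∃ W, St W ∧ W ≠ ⊤ ∧ 0 < ν W := by
    by_contra! hcon
    have h1 := hcon _ (hStker P hPR) (htop P hP)
    have h2 := hcon _ (hStker H hHR) (htop H hH)
    rw [νker] at h1 h2
    obtain ⟨j1, h1⟩ := Φ.mu_lt x hT (h1.trans_lt (by norm_num : (0:ℝ) < 1/2))
    obtain ⟨j2, h2⟩ := Φ.mu_lt x hT (h2.trans_lt (by norm_num : (0:ℝ) < 1/2))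
    have := hPH (j1 + j2)
    have := h1 (j1 + j2) (by lia)
    have := h2 (j1 + j2) (by lia)
    linarith
  have hex : ∃ n, ∃ W, St W ∧ Module.finrank E W = n ∧ 0 < ν W := ⟨_, W0, hW0, rfl, hW0ν⟩
  let n := Nat.find hex
  obtain ⟨W1, hW1, hn1, hν1⟩ := Nat.find_spec hex
  have hmin : ∀ W, St W → Module.finrank E W < n → ν W = 0 := by
    intro W hW hlt
    by_contra hne
    exact Nat.find_min hex hlt ⟨W, hW, rfl, lt_of_le_of_ne (Φ.mu_nonneg x _) (Ne.symm hne)⟩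
  have hnlt : n < Module.finrank E (ι → E) :=
    (Nat.find_min' hex ⟨W0, hW0, rfl, hW0ν⟩).trans_lt (Submodule.finrank_lt hW0t)
  let F : Set (Submodule E (ι → E)) := {W | St W ∧ Module.finrank E W = n ∧ ν W = ν W1}
  refine ⟨F, ?_, ⟨W1, hW1, hn1, rfl⟩, ?_⟩
  · by_contra hinf
    obtain ⟨N, hN⟩ := exists_nat_gt (2 / ν W1)
    obtain ⟨G, hGF, hGc⟩ := Set.Infinite.exists_subset_card_eq (s := F) hinf N
    have hNpos : (0 : ℝ) < N := lt_of_le_of_lt (by positivity) hN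
    have hpair : ∀ᶠ j in Filter.atTop, ∀ W ∈ G, ∀ W' ∈ G, W ≠ W' →
        M.m (Φ.Nb x j (b W) ∩ Φ.Nb x j (b W')) ≤ 1 / N ^ 2 := by
      simp only [Filter.eventually_all_finset]
      intro W hW W' hW'
      by_cases hne : W = W'
      · simp [hne]
      have h1 := hGF hW
      have h2 := hGF hW'
      have hst : St (W ⊓ W') := by
        intro r hr v hv
        exact ⟨h1.1 r hr hv.1, h2.1 r hr hv.2⟩
      have hlt : Module.finrank E ↥(W ⊓ W') < n := by
        rw [← h1.2.1]
        refine Submodule.finrank_lt_finrank_of_lt (lt_of_le_of_ne inf_le_left ?_)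
        intro heq
        rw [inf_eq_left] at heq
        exact hne (Submodule.eq_of_le_of_finrank_eq heq (h1.2.1.trans h2.2.1.symm))
      have h0 := hmin _ hst hlt
      obtain ⟨j0, hj0⟩ := Φ.mu_lt x hT (h0.le.trans_lt (by positivity : (0:ℝ) < 1 / N ^ 2))
      obtain ⟨Y, Y', hY⟩ := matrix_factor2 (b W) (b W') (b (W ⊓ W')) (by rw [hb, hb, hb])
      obtain ⟨j1, hj1⟩ := Φ.comb x hT (b W) (b W') Y Y' j0
      filter_upwards [Filter.eventually_ge_atTop j1] with j hj _
      refine (M.le_of_ae ?_).trans (hj0 j0 le_rfl).le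
      filter_upwards [hj1 j hj] with z hz hz2
      rw [hY]; exact hz hz2.1 hz2.2
    obtain ⟨j, hj⟩ := hpair.exists
    have hB := M.bonferroni G (fun W => Φ.Nb x j (b W)) (1 / N ^ 2) hj (by positivity)
    rw [hGc, mul_one_div_cancel (by positivity)] at hB
    have h3 : ∑ W ∈ G, ν W1 ≤ ∑ W ∈ G, M.m (Φ.Nb x j (b W)) := by
      refine Finset.sum_le_sum fun W hW => ?_
      rw [← (hGF hW).2.2]; exact Φ.mu_le x _ j
    rw [Finset.sum_const, hGc, nsmul_eq_mul] at h3
    have h4 := M.le_one (⋃ W ∈ G, Φ.Nb x j (b W))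
    rw [div_lt_iff₀ hν1] at hN
    linarith
  · rintro W ⟨h1, h2, h3⟩
    refine ⟨?_, ?_, h1, ?_⟩
    · rintro rfl; rw [νbot] at h3; rw [← h3] at hν1; exact lt_irrefl _ hν1
    · rintro rfl; rw [finrank_top] at h2; lia
    · intro s hs
      refine ⟨?_, ?_, ?_⟩
      · intro r hr v hv
        have := h1 r hr hv
        simp only [Submodule.mem_comap] at this ⊢
        rwa [← LinearMap.comp_apply, ← toLin'_mul, hcomm s hs r hr, toLin'_mul, LinearMap.comp_apply]
      · obtain ⟨s', hs', e⟩ := hinv s hs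
        rw [← h2]
        let eq := Matrix.toLin'OfInv (M := s) (M' := s') e (mul_eq_one_comm.1 e)
        have : W.comap (toLin' s) = W.map (eq.toLinearMap) := by
          ext v; simp only [Submodule.mem_comap, Submodule.mem_map]
          constructor
          · intro h; exact ⟨_, h, by
              show toLin' s' (toLin' s v) = v
              rw [← LinearMap.comp_apply, ← toLin'_mul, mul_eq_one_comm.1 e]; simp⟩
          · rintro ⟨w, hw, rfl⟩
            show toLin' s (toLin' s' w) ∈ W
            rw [← LinearMap.comp_apply, ← toLin'_mul, e]; simpa using hw
        rw [this]
        exact LinearEquiv.finrank_map_eq eq W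
      · rw [hge s hs, h3]
end Core

end Part2

section Part3

section Gap
open Polynomial
variable {Z E K ι : Type*} [Field E] [Field K] [Fintype ι] [DecidableEq ι] {l : Filter Z}
  {a : AbsoluteValue K ℝ} {T : Z → ℝ} (Φ : Asy l E a T)

lemma Asy.growth (hT : ∀ R : ℝ, ∀ᶠ k in l, R ≤ T k) (ρ : Z → ℝ) (hρ : ∀ᶠ z in l, 0 < ρ z) (c : ℕ)
    (hc : ∀ᶠ z in l, (ρ z)⁻¹ ≤ T z ^ c) (X : Matrix ι ι E) (s : Multiset E)
    (hs : ∀ α ∈ s, ∀ᶠ z in l, a (Φ.seq α z) ≤ ρ z) :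
    ∀ π : Matrix ι ι E, aeval X ((s.map fun α => Polynomial.X - C α).prod) * π = 0 →
    ∃ C : ℕ, ∀ ℓ : ℕ, ∀ᶠ z in l, mnrm a (Φ.mp (X ^ ℓ * π) z) ≤ T z ^ C * ρ z ^ ℓ := by
  induction s using Multiset.induction_on with
  | empty =>
    intro π h
    simp only [Multiset.map_zero, Multiset.prod_zero, map_one, one_mul] at h
    subst h
    refine ⟨0, fun ℓ => ?_⟩
    filter_upwards [Φ.mp_zero (ι := ι), hρ] with z hz h
    rw [mul_zero, hz]
    simp only [mnrm, Matrix.zero_apply, map_zero, Finset.sum_const_zero, pow_zero, one_mul]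
    positivity
  | cons α s ih =>
    intro π h
    have hα := hs α (Multiset.mem_cons_self _ _)
    obtain ⟨C1, hC1⟩ := ih (fun β hβ => hs β (Multiset.mem_cons_of_mem hβ))
      ((X - algebraMap E _ α) * π) (by
        rw [Multiset.map_cons, Multiset.prod_cons, mul_comm (Polynomial.X - C α), map_mul] at h
        rw [← mul_assoc]; simpa using h)
    obtain ⟨C0, hC0⟩ := Φ.mp_bdd hT π
    have key : ∀ ℓ : ℕ, ∀ᶠ z in l, mnrm a (Φ.mp (X ^ ℓ * π) z) ≤
        ρ z ^ ℓ * (T z ^ C0 + ℓ * T z ^ (C1 + c)) := by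
      intro ℓ
      induction ℓ with
      | zero => filter_upwards [hC0] with z hz; simpa using hz
      | succ ℓ ihℓ =>
        have e : X ^ (ℓ + 1) * π = X ^ ℓ * ((X - algebraMap E _ α) * π) + α • (X ^ ℓ * π) := by
          rw [Algebra.algebraMap_eq_smul_one]
          simp only [sub_mul, mul_sub, smul_mul_assoc, one_mul, mul_smul_comm, pow_succ, mul_assoc]
          abel
        filter_upwards [ihℓ, hC1 ℓ, hα, hρ, hc, hT 1,
          Φ.mp_add (X ^ ℓ * ((X - algebraMap E _ α) * π)) (α • (X ^ ℓ * π)),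
          Φ.mp_smul α (X ^ ℓ * π)] with z h1 h2 h3 h4 h5 h6 h7 h8
        rw [e, h7, h8]
        refine (mnrm_add _ _ _).trans ?_
        rw [mnrm_smul]
        have e1 : a (Φ.seq α z) * mnrm a (Φ.mp (X ^ ℓ * π) z) ≤
            ρ z * (ρ z ^ ℓ * (T z ^ C0 + ℓ * T z ^ (C1 + c))) :=
          mul_le_mul h3 h1 (mnrm_nonneg _ _) h4.le
        have e2 : T z ^ C1 * ρ z ^ ℓ ≤ T z ^ (C1 + c) * ρ z ^ (ℓ + 1) := by
          have : T z ^ C1 * ρ z ^ ℓ = T z ^ C1 * ((ρ z)⁻¹ * ρ z ^ (ℓ + 1)) := by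
            rw [pow_succ]; field_simp
          rw [this, pow_add (T z), mul_assoc (T z ^ C1)]
          gcongr
        push_cast
        calc _ ≤ T z ^ (C1 + c) * ρ z ^ (ℓ + 1) +
              ρ z * (ρ z ^ ℓ * (T z ^ C0 + ℓ * T z ^ (C1 + c))) := by linarith
          _ = _ := by ring
    refine ⟨C0 + C1 + c + 1, fun ℓ => ?_⟩
    filter_upwards [key ℓ, hT 1, hT (1 + ℓ), hρ] with z h1 h2 h3 h4
    refine h1.trans ?_
    rw [mul_comm]
    refine mul_le_mul_of_nonneg_right ?_ (by positivity)
    have e1 : T z ^ C0 ≤ T z ^ (C0 + C1 + c) := pow_le_pow_right₀ h2 (by lia)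
    have e2 : T z ^ (C1 + c) ≤ T z ^ (C0 + C1 + c) := pow_le_pow_right₀ h2 (by lia)
    calc _ ≤ T z ^ (C0 + C1 + c) + ℓ * T z ^ (C0 + C1 + c) := by gcongr
      _ = (1 + ℓ) * T z ^ (C0 + C1 + c) := by ring
      _ ≤ T z * T z ^ (C0 + C1 + c) := by gcongr
      _ = _ := by ring

lemma Asy.gap (hT : ∀ R : ℝ, ∀ᶠ k in l, R ≤ T k) [l.NeBot] (g g' : Matrix ι ι E) (hg : g * g' = 1) (I J : Multiset E)
    (hIJ : aeval g ((I.map fun α => X - C α).prod) * aeval g ((J.map fun α => X - C α).prod) = 0)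
    (j : ℕ) (hI : ∀ α ∈ I, ∀ᶠ z in l, T z ^ (j + 1) ≤ a (Φ.seq α z))
    (hJ : ∀ α ∈ J, ∀ᶠ z in l, a (Φ.seq α z) ≤ T z ^ j)
    (hI' : ∃ α ∈ I, α ∈ spectrum E g) (hJ' : ∃ α ∈ J, α ∈ spectrum E g) :
    ∃ P H : E[X], aeval g P ≠ 0 ∧ aeval g H ≠ 0 ∧ ∀ i : ℕ, ∃ ℓ : ℕ, ∀ᶠ z in l, ∀ x : ι → K,
      T z ^ i * vnrm a (Φ.mp (aeval g P) z *ᵥ x) ≤ vnrm a x ∨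
      T z ^ i * vnrm a (Φ.mp (aeval g H) z *ᵥ (Φ.mp (g ^ ℓ) z *ᵥ x)) ≤
        vnrm a (Φ.mp (g ^ ℓ) z *ᵥ x) := by
  have hdisj : ∀ α ∈ I, α ∉ J := by
    intro α h1 h2
    obtain ⟨z, e1, e2, e3⟩ := ((hI α h1).and ((hJ α h2).and (hT 2))).exists
    have : T z ^ (j + 1) ≤ T z ^ j := e1.trans e2
    have h0 : 0 < T z ^ j := by positivity
    rw [pow_succ] at this
    nlinarith
  have hg' : g' * g = 1 := mul_eq_one_comm.1 hg
  set p := (I.map fun α => X - C α).prod with hp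
  set q := (J.map fun α => X - C α).prod with hq
  have hcop : IsCoprime p q := by
    rw [hp, hq]
    have aux : ∀ (I : Multiset E) (r : E[X]), (∀ α ∈ I, IsCoprime (X - C α) r) →
        IsCoprime (I.map fun α => X - C α).prod r := by
      intro I r
      induction I using Multiset.induction_on with
      | empty => intro _; simpa using isCoprime_one_left
      | cons b I ih =>
        intro h
        rw [Multiset.map_cons, Multiset.prod_cons]
        exact (h b (Multiset.mem_cons_self _ _)).mul_left
          (ih fun α hα => h α (Multiset.mem_cons_of_mem hα))
    refine aux I _ fun α hα => (aux J _ fun β hβ => ?_).symm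
    refine isCoprime_X_sub_C_of_isUnit_sub ?_
    rw [isUnit_iff_ne_zero, sub_ne_zero]
    rintro rfl; exact hdisj _ hα hβ
  obtain ⟨u, v, huv⟩ := hcop
  have hsum : aeval g (v * q) + aeval g (u * p) = 1 := by
    rw [← map_add, add_comm, huv, map_one]
  have hroot : ∀ (S : Multiset E) (α : E), eval α ((S.map fun α => X - C α).prod) = 0 → α ∈ S := by
    intro S α h
    rw [eval_multiset_prod, Multiset.prod_eq_zero_iff] at h
    simp only [Multiset.map_map, Multiset.mem_map, Function.comp, eval_sub, eval_X, eval_C] at h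
    obtain ⟨b, hb, h⟩ := h
    rw [sub_eq_zero] at h; rwa [h]
  have hspec : ∀ (S : Multiset E) (α : E), α ∈ spectrum E g →
      aeval g ((S.map fun α => X - C α).prod) = 0 → α ∈ S := by
    intro S α hα h0
    have h := spectrum.subset_polynomial_aeval g ((S.map fun α => X - C α).prod)
      (Set.mem_image_of_mem _ hα)
    rw [h0] at h
    have : Nontrivial (Matrix ι ι E) := by
      by_contra hn
      rw [not_nontrivial_iff_subsingleton] at hn
      rw [spectrum.of_subsingleton] at hα; exact hα
    rw [spectrum.zero_eq] at h
    exact hroot S α h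
  have hqH : aeval g q * aeval g (u * p) = 0 := by
    rw [← map_mul, show q * (u * p) = u * (p * q) by ring, map_mul, map_mul, hIJ, mul_zero]
  have hpP : aeval g p * aeval g (v * q) = 0 := by
    rw [← map_mul, show p * (v * q) = v * (p * q) by ring, map_mul, map_mul, hIJ, mul_zero]
  refine ⟨v * q, u * p, ?_, ?_, ?_⟩
  · intro h0
    rw [h0, zero_add] at hsum
    rw [hsum, mul_one] at hqH
    obtain ⟨α, h1, h2⟩ := hI'
    exact hdisj α h1 (hspec J α h2 hqH)
  · intro h0
    rw [h0, add_zero] at hsum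
    rw [hsum, mul_one] at hpP
    obtain ⟨α, h1, h2⟩ := hJ'
    exact hdisj α (hspec I α h2 hpP) h1
  obtain ⟨C1, hC1⟩ := Φ.growth hT (fun z => T z ^ j) ((hT 1).mono fun z hz => by positivity) 0
    ((hT 1).mono fun z hz => by rw [pow_zero]; exact inv_le_one_of_one_le₀ (one_le_pow₀ hz)) g J hJ _ hqH
  have hI0 : ∀ α ∈ I, α ≠ 0 := by
    rintro α hα rfl
    obtain ⟨z, e1, e2, e3⟩ := ((hI 0 hα).and (Φ.zero.and (hT 2))).exists
    rw [e2, map_zero] at e1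
    have h0 : 0 < T z ^ (j + 1) := by positivity
    linarith
  have hinvp : ∀ S : Multiset E, (∀ α ∈ S, α ≠ 0) → ∃ Y : Matrix ι ι E,
      aeval g' (((S.map fun α => α⁻¹).map fun α => X - C α).prod) =
      Y * aeval g ((S.map fun α => X - C α).prod) := by
    intro S
    induction S using Multiset.induction_on with
    | empty => intro _; exact ⟨1, by simp⟩
    | cons α S ih =>
      intro h
      obtain ⟨Y, hY⟩ := ih fun b hb => h b (Multiset.mem_cons_of_mem hb)
      have hα : α ≠ 0 := h α (Multiset.mem_cons_self _ _)
      simp only [Multiset.map_cons, Multiset.prod_cons]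
      refine ⟨Y * (-(α⁻¹ • g')), ?_⟩
      have e2 : aeval g' (X - C α⁻¹) = -(α⁻¹ • g') * aeval g (X - C α) := by
        simp only [map_sub, aeval_X, aeval_C, Algebra.algebraMap_eq_smul_one, mul_sub, neg_mul,
          smul_mul_assoc, hg', mul_smul_comm, mul_one, smul_smul, mul_neg, smul_neg]
        rw [mul_inv_cancel₀ hα]; simp only [one_smul]; abel
      have hcomm : g' * (aeval g ((S.map fun α => X - C α).prod)) =
          (aeval g ((S.map fun α => X - C α).prod)) * g' := by
        set A := aeval g ((S.map fun α => X - C α).prod) with hA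
        have h1 : A * g = g * A := by
          have e1 : aeval g ((S.map fun α => X - C α).prod * X) = A * g := by
            rw [map_mul, aeval_X]
          have e2 : aeval g (X * (S.map fun α => X - C α).prod) = g * A := by
            rw [map_mul, aeval_X]
          rw [← e1, ← e2, mul_comm]
        calc g' * A = g' * (A * (g * g')) := by rw [hg, mul_one]
          _ = g' * ((A * g) * g') := by rw [mul_assoc]
          _ = (g' * g) * (A * g') := by rw [h1]; simp only [mul_assoc]
          _ = _ := by rw [hg', one_mul]
      rw [mul_comm (X - C α⁻¹), mul_comm (X - C α), map_mul, map_mul, hY, e2]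
      simp only [mul_assoc, neg_mul, mul_neg, smul_mul_assoc, mul_smul_comm]
      rw [← mul_assoc g', hcomm, mul_assoc]
  obtain ⟨Y, hY⟩ := hinvp I hI0
  obtain ⟨C2, hC2⟩ := Φ.growth hT (fun z => (T z ^ (j + 1))⁻¹)
    ((hT 1).mono fun z hz => by positivity) (j + 1)
    (Filter.Eventually.of_forall fun z => by rw [inv_inv]) g' (I.map fun α => α⁻¹)
    (by
      intro β hβ
      obtain ⟨α, hα, rfl⟩ := Multiset.mem_map.1 hβ
      filter_upwards [hI α hα, Φ.mul α α⁻¹, Φ.one, hT 1] with z h1 h2 h3 h4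
      rw [mul_inv_cancel₀ (hI0 α hα), h3] at h2
      have h5 := congrArg a h2
      rw [map_one, map_mul] at h5
      have h6 : 0 < T z ^ (j + 1) := by positivity
      have h7 : a (Φ.seq α⁻¹ z) = (a (Φ.seq α z))⁻¹ := eq_inv_of_mul_eq_one_right h5.symm
      rw [h7]
      exact inv_anti₀ h6 h1) _ (by rw [hY, mul_assoc, hpP, mul_zero])
  intro i
  let ℓ := 2 * i + C1 + C2
  refine ⟨ℓ, ?_⟩
  have hgg : g' ^ ℓ * g ^ ℓ = 1 := by
    rw [← (show Commute g' g by rw [Commute, SemiconjBy, hg, hg']).mul_pow, hg', one_pow]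
  have e1 : (g' ^ ℓ * aeval g (v * q)) * g ^ ℓ = aeval g (v * q) := by
    have : aeval g (v * q) * g ^ ℓ = g ^ ℓ * aeval g (v * q) := by
      have e1 : aeval g ((v * q) * X ^ ℓ) = aeval g (v * q) * g ^ ℓ := by
        rw [map_mul _ (v * q), map_pow, aeval_X]
      have e2 : aeval g (X ^ ℓ * (v * q)) = g ^ ℓ * aeval g (v * q) := by
        rw [map_mul _ (X ^ ℓ), map_pow, aeval_X]
      rw [← e1, ← e2, mul_comm]
    rw [mul_assoc, this, ← mul_assoc, hgg, one_mul]
  have e2 : aeval g (u * p) * g ^ ℓ = g ^ ℓ * aeval g (u * p) := by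
    have e1 : aeval g ((u * p) * X ^ ℓ) = aeval g (u * p) * g ^ ℓ := by
      rw [map_mul _ (u * p), map_pow, aeval_X]
    have e2 : aeval g (X ^ ℓ * (u * p)) = g ^ ℓ * aeval g (u * p) := by
      rw [map_mul _ (X ^ ℓ), map_pow, aeval_X]
    rw [← e1, ← e2, mul_comm]
  filter_upwards [hC1 ℓ, hC2 ℓ, Φ.mp_mul (g' ^ ℓ * aeval g (v * q)) (g ^ ℓ),
    Φ.mp_mul (aeval g (u * p)) (g ^ ℓ), hT 1] with z h1 h2 h3 h4 h5 x
  rw [e1] at h3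
  rw [e2] at h4
  by_cases hx : T z ^ i * vnrm a (Φ.mp (aeval g (v * q)) z *ᵥ x) ≤ vnrm a x
  · exact Or.inl hx
  right
  push Not at hx
  rw [mulVec_mulVec, ← h4]
  set y := Φ.mp (g ^ ℓ) z *ᵥ x with hy
  have f1 := (vnrm_mulVec a (Φ.mp (g ^ ℓ * aeval g (u * p)) z) x).trans
    (mul_le_mul_of_nonneg_right h1 (vnrm_nonneg _ _))
  have f2 : vnrm a (Φ.mp (aeval g (v * q)) z *ᵥ x) ≤
      T z ^ C2 * (T z ^ (j + 1))⁻¹ ^ ℓ * vnrm a y := by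
    rw [h3, ← mulVec_mulVec, ← hy]
    exact (vnrm_mulVec a _ y).trans (mul_le_mul_of_nonneg_right h2 (vnrm_nonneg _ _))
  set U := vnrm a (Φ.mp (g ^ ℓ * aeval g (u * p)) z *ᵥ x)
  set V := vnrm a (Φ.mp (aeval g (v * q)) z *ᵥ x)
  have t0 : 0 < T z := by linarith
  calc T z ^ i * U ≤ T z ^ i * (T z ^ C1 * (T z ^ j) ^ ℓ * (T z ^ i * V)) := by
        gcongr; exact f1.trans (by gcongr)
    _ ≤ T z ^ i * (T z ^ C1 * (T z ^ j) ^ ℓ * (T z ^ i *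
          (T z ^ C2 * (T z ^ (j + 1))⁻¹ ^ ℓ * vnrm a y))) := by gcongr
    _ = vnrm a y * (T z ^ (2 * i + C1 + C2) * ((T z ^ j) ^ ℓ * (T z ^ (j + 1))⁻¹ ^ ℓ)) := by ring
    _ = vnrm a y := by
        have : T z ^ (2 * i + C1 + C2) * ((T z ^ j) ^ ℓ * (T z ^ (j + 1))⁻¹ ^ ℓ) = 1 := by
          rw [inv_pow, pow_succ, mul_pow]
          show T z ^ ℓ * _ = 1
          field_simp
        rw [this, mul_one]
end Gap

theorem Asy.core2 {Z E K ι : Type*} [Field E] [Field K] [Fintype ι] [DecidableEq ι] {M : FAM Z}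
    {a : AbsoluteValue K ℝ} {T : Z → ℝ} (Φ : Asy M.ae E a T) (x : Z → ι → K)
    (hT : ∀ R : ℝ, ∀ᶠ k in M.ae, R ≤ T k)
    (hx : ∀ᶠ z in M.ae, x z ≠ 0) (SS RR : Set (Matrix ι ι E))
    (hcomm : ∀ s ∈ SS, ∀ r ∈ RR, s * r = r * s)
    (hinv : ∀ s ∈ SS, ∃ s' ∈ SS, s * s' = 1) (hone : 1 ∈ SS)
    (hmul : ∀ s ∈ SS, ∀ s' ∈ SS, s * s' ∈ SS)
    (hS : ∀ s ∈ SS, ∀ B j, M.m {z | T z ^ j * vnrm a (Φ.mp B z *ᵥ (Φ.mp s z *ᵥ x z)) ≤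
      vnrm a (Φ.mp s z *ᵥ x z)} = M.m (Φ.Nb x j B))
    (g : Matrix ι ι E) (hg : g ∈ SS) (I J : Multiset E)
    (hIJ : Polynomial.aeval g ((I.map fun α => Polynomial.X - Polynomial.C α).prod) *
      Polynomial.aeval g ((J.map fun α => Polynomial.X - Polynomial.C α).prod) = 0)
    (j : ℕ) (hI : ∀ α ∈ I, ∀ᶠ z in M.ae, T z ^ (j + 1) ≤ a (Φ.seq α z))
    (hJ : ∀ α ∈ J, ∀ᶠ z in M.ae, a (Φ.seq α z) ≤ T z ^ j)
    (hI' : ∃ α ∈ I, α ∈ spectrum E g) (hJ' : ∃ α ∈ J, α ∈ spectrum E g) :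
    ∃ F : Set (Submodule E (ι → E)), F.Finite ∧ F.Nonempty ∧ ∀ W ∈ F, W ≠ ⊥ ∧ W ≠ ⊤ ∧
      (∀ r ∈ RR, W ≤ W.comap (toLin' r)) ∧ ∀ s ∈ SS, W.comap (toLin' s) ∈ F := by
  obtain ⟨g', hg', hgg'⟩ := hinv g hg
  obtain ⟨P, H, hP, hH, hPH⟩ := Φ.gap hT g g' hgg' I J hIJ j hI hJ hI' hJ'
  have hcg : ∀ p : Polynomial E, ∀ r ∈ RR, Polynomial.aeval g p * r = r * Polynomial.aeval g p := by
    intro p r hr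
    have hgr : g * r = r * g := hcomm g hg r hr
    induction p using Polynomial.induction_on' with
    | add p q h1 h2 => rw [map_add, add_mul, mul_add, h1, h2]
    | monomial n c =>
      rw [Polynomial.aeval_monomial, mul_assoc,
        ((show Commute g r from hgr).pow_left n).eq, ← mul_assoc, ← mul_assoc,
        Algebra.commutes c r]
  refine Φ.core x hT hx SS RR hcomm hinv hS _ _ hP hH (hcg P) (hcg H) fun i => ?_
  obtain ⟨ℓ, hℓ⟩ := hPH i
  have hpow : ∀ ℓ : ℕ, g ^ ℓ ∈ SS := by
    intro ℓ
    induction ℓ with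
    | zero => simpa using hone
    | succ ℓ ih => rw [pow_succ]; exact hmul _ ih _ hg
  rw [← hS _ (hpow ℓ) (Polynomial.aeval g H) i, ← M.univ]
  refine le_trans (M.le_of_ae ?_) (M.union_le _ _)
  filter_upwards [hℓ] with z hz _
  rcases hz (x z) with h | h
  · left; simpa [Asy.Nb] using h
  · right; simpa using h

end Part3

section Part4

section GermField
open Filter
universe u

variable {K : Type u} [Field K] (𝒰 : Ultrafilter ℕ) (T : ℕ → ℝ)

/-- germs of polynomial growth -/
noncomputable def OT (a : AbsoluteValue K ℝ) (hT : ∀ R : ℝ, ∀ᶠ k in (𝒰 : Filter ℕ), R ≤ T k) :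
    ValuationSubring (Germ (𝒰 : Filter ℕ) K) where
  carrier := {x | ∃ f : ℕ → K, Germ.coeRingHom (𝒰 : Filter ℕ) f = x ∧
    ∃ C : ℕ, ∀ᶠ k in (𝒰 : Filter ℕ), a (f k) ≤ T k ^ C}
  mul_mem' := by
    rintro _ _ ⟨f, rfl, C, hC⟩ ⟨g, rfl, D, hD⟩
    refine ⟨f * g, map_mul _ _ _, C + D, ?_⟩
    filter_upwards [hC, hD, hT 1] with k h1 h2 h3
    rw [Pi.mul_apply, a.map_mul, pow_add]
    exact mul_le_mul h1 h2 (a.nonneg _) (by positivity)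
  one_mem' := ⟨1, map_one _, 0, by simp⟩
  add_mem' := by
    rintro _ _ ⟨f, rfl, C, hC⟩ ⟨g, rfl, D, hD⟩
    refine ⟨f + g, map_add _ _ _, C + D + 1, ?_⟩
    filter_upwards [hC, hD, hT 2] with k h1 h2 h3
    have h4 : T k ^ C ≤ T k ^ (C + D) := pow_le_pow_right₀ (by linarith) (by lia)
    have h5 : T k ^ D ≤ T k ^ (C + D) := pow_le_pow_right₀ (by linarith) (by lia)
    have h6 : 0 ≤ T k ^ (C + D) := by positivity
    refine (a.add_le _ _).trans ?_
    rw [pow_succ]; nlinarith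
  zero_mem' := ⟨0, map_zero _, 0, by simp⟩
  neg_mem' := by
    rintro _ ⟨f, rfl, C, hC⟩
    exact ⟨-f, map_neg _ _, C, by simpa using hC⟩
  mem_or_inv_mem' := by
    intro x
    induction x using Germ.inductionOn with
    | _ f =>
      rcases 𝒰.em (fun k => a (f k) ≤ 1) with h | h
      · exact Or.inl ⟨f, rfl, 0, by simpa using h⟩
      · refine Or.inr ⟨f⁻¹, rfl, 0, ?_⟩
        filter_upwards [h] with k hk
        rw [pow_zero, Pi.inv_apply, map_inv₀]
        exact inv_le_one_of_one_le₀ (le_of_lt (not_le.1 hk))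

/-- germs of integral elements with polynomial growth -/
noncomputable def R0 {V : Type*} [Fintype V] (a : V → AbsoluteValue K ℝ) (O : Subring K)
    (hT : ∀ R : ℝ, ∀ᶠ k in (𝒰 : Filter ℕ), R ≤ T k) :
    Subring (Germ (𝒰 : Filter ℕ) K) where
  carrier := {x | ∃ f : ℕ → K, Germ.coeRingHom (𝒰 : Filter ℕ) f = x ∧
    (∀ᶠ k in (𝒰 : Filter ℕ), f k ∈ O) ∧
    ∃ C : ℕ, ∀ᶠ k in (𝒰 : Filter ℕ), ∀ u, a u (f k) ≤ T k ^ C}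
  mul_mem' := by
    rintro _ _ ⟨f, rfl, hf, C, hC⟩ ⟨g, rfl, hg, D, hD⟩
    refine ⟨f * g, map_mul _ _ _, by filter_upwards [hf, hg] with k h1 h2 using O.mul_mem h1 h2,
      C + D, ?_⟩
    filter_upwards [hC, hD, hT 1] with k h1 h2 h3 u
    rw [Pi.mul_apply, map_mul, pow_add]
    exact mul_le_mul (h1 u) (h2 u) ((a u).nonneg _) (by positivity)
  one_mem' := ⟨1, map_one _, by simp [O.one_mem], 0, by simp⟩
  add_mem' := by
    rintro _ _ ⟨f, rfl, hf, C, hC⟩ ⟨g, rfl, hg, D, hD⟩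
    refine ⟨f + g, map_add _ _ _, by filter_upwards [hf, hg] with k h1 h2 using O.add_mem h1 h2,
      C + D + 1, ?_⟩
    filter_upwards [hC, hD, hT 2] with k h1 h2 h3 u
    have h4 : T k ^ C ≤ T k ^ (C + D) := pow_le_pow_right₀ (by linarith) (by lia)
    have h5 : T k ^ D ≤ T k ^ (C + D) := pow_le_pow_right₀ (by linarith) (by lia)
    have h6 : 0 ≤ T k ^ (C + D) := by positivity
    refine ((a u).add_le _ _).trans ?_
    have := h1 u; have := h2 u
    rw [pow_succ]; nlinarith
  zero_mem' := ⟨0, map_zero _, by simp [O.zero_mem], 0, by simp⟩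
  neg_mem' := by
    rintro _ ⟨f, rfl, hf, C, hC⟩
    exact ⟨-f, map_neg _ _, by simpa using hf, C, by simpa using hC⟩

lemma R0_le {V : Type*} [Fintype V] (a : V → AbsoluteValue K ℝ) (v : V) (O : Subring K)
    (hT : ∀ R : ℝ, ∀ᶠ k in (𝒰 : Filter ℕ), R ≤ T k) {x} (hx : x ∈ R0 𝒰 T a O hT) :
    x ∈ OT 𝒰 T (a v) hT := by
  obtain ⟨f, rfl, hf, C, hC⟩ := hx
  exact ⟨f, rfl, C, hC.mono fun k hk => hk v⟩

lemma R0_inv {V : Type*} [Fintype V] (a : V → AbsoluteValue K ℝ) (v : V) (O : Subring K)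
    (hprod : ∀ x ∈ O, x ≠ 0 → 1 ≤ ∏ u, a u x)
    (hT : ∀ R : ℝ, ∀ᶠ k in (𝒰 : Filter ℕ), R ≤ T k) {x} (hx : x ∈ R0 𝒰 T a O hT) :
    x⁻¹ ∈ OT 𝒰 T (a v) hT := by
  classical
  obtain ⟨f, rfl, hf, C, hC⟩ := hx
  refine ⟨f⁻¹, rfl, C * (Finset.univ.erase v).card, ?_⟩
  filter_upwards [hf, hC, hT 1] with k h1 h2 h3
  by_cases h0 : f k = 0
  · simp only [Pi.inv_apply, h0, _root_.inv_zero, map_zero]; positivity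
  have h4 := hprod _ h1 h0
  rw [← Finset.mul_prod_erase _ _ (Finset.mem_univ v)] at h4
  rw [Pi.inv_apply, map_inv₀]
  have hpos := (a v).pos h0
  have h5 : ∏ u ∈ Finset.univ.erase v, a u (f k) ≤ T k ^ (C * (Finset.univ.erase v).card) := by
    rw [pow_mul]
    calc _ ≤ ∏ u ∈ Finset.univ.erase v, T k ^ C :=
          Finset.prod_le_prod (fun u _ => (a u).nonneg _) (fun u _ => h2 u)
      _ = _ := by simp
  refine le_trans ?_ h5
  rw [inv_le_iff_one_le_mul₀ hpos]; linarith

theorem exists_germ_field {V : Type*} [Fintype V] (a : V → AbsoluteValue K ℝ) (v : V)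
    (O : Subring K) (hprod : ∀ x ∈ O, x ≠ 0 → 1 ≤ ∏ u, a u x)
    (hT : ∀ R : ℝ, ∀ᶠ k in (𝒰 : Filter ℕ), R ≤ T k) :
    ∃ (E : Type u) (_ : Field E) (Φ : Asy (𝒰 : Filter ℕ) E (a v) T),
      (∀ f : ℕ → K, (∀ᶠ k in (𝒰 : Filter ℕ), f k ∈ O) →
        (∃ C : ℕ, ∀ᶠ k in (𝒰 : Filter ℕ), ∀ u, a u (f k) ≤ T k ^ C) →
        ∃ e, ∀ᶠ k in (𝒰 : Filter ℕ), Φ.seq e k = f k) ∧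
      (∀ (ι : Type) [Fintype ι] [DecidableEq ι] (B : Matrix ι ι E) (f : ℕ → K),
        (∀ᶠ k in (𝒰 : Filter ℕ), (f k • 1 - Φ.mp B k).det = 0) →
        ∃ e, (∀ᶠ k in (𝒰 : Filter ℕ), Φ.seq e k = f k) ∧ (e • 1 - B).det = 0) := by
  let L := Germ (𝒰 : Filter ℕ) K
  let c : (ℕ → K) →+* L := Germ.coeRingHom (𝒰 : Filter ℕ)
  have hc : ∀ f g, c f = c g ↔ ∀ᶠ k in (𝒰 : Filter ℕ), f k = g k := fun f g => Germ.coe_eq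
  have hsurj : Function.Surjective c := fun x => by
    induction x using Germ.inductionOn with
    | _ f => exact ⟨f, rfl⟩
  let E0 : Subfield L := Subfield.closure (R0 𝒰 T a O hT : Set L)
  have hE0 : ∀ x ∈ E0, x ∈ OT 𝒰 T (a v) hT := by
    intro x hx
    obtain ⟨y, hy, z, hz, rfl⟩ := Subfield.mem_closure_iff.1 hx
    rw [Subring.closure_eq] at hy hz
    rw [div_eq_mul_inv]
    exact mul_mem (R0_le 𝒰 T a v O hT hy) (R0_inv 𝒰 T a v O hprod hT hz)
  let E := algebraicClosure E0 L
  have hE : ∀ x ∈ E, x ∈ OT 𝒰 T (a v) hT := by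
    intro x hx
    have h1 : IsIntegral E0 x := mem_algebraicClosure_iff'.1 hx
    have h2 : IsIntegral (OT 𝒰 T (a v) hT) x := by
      obtain ⟨p, hp, hpx⟩ := h1
      let φ : E0 →+* OT 𝒰 T (a v) hT := E0.subtype.codRestrict _ (fun x => hE0 x x.2)
      refine ⟨p.map φ, hp.map φ, ?_⟩
      rw [Polynomial.eval₂_map]
      exact hpx
    obtain ⟨y, hy⟩ := IsIntegrallyClosed.isIntegral_iff.1 h2
    rw [← hy]; exact y.2
  choose r hr using hsurj
  have hr' : ∀ f, ∀ᶠ k in (𝒰 : Filter ℕ), r (c f) k = f k := fun f => (hc _ _).1 (hr (c f))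
  refine ⟨E, inferInstance, ⟨fun e => r e, ?_, ?_, ?_, ?_, ?_⟩, ?_, ?_⟩
  · intro x y
    have : c (r ((x + y : E) : L)) = c (r x + r y) := by rw [map_add, hr, hr, hr]; rfl
    exact (hc _ _).1 this
  · intro x y
    have : c (r ((x * y : E) : L)) = c (r x * r y) := by rw [map_mul, hr, hr, hr]; rfl
    exact (hc _ _).1 this
  · have : c (r ((0 : E) : L)) = c 0 := by rw [map_zero, hr]; rfl
    exact (hc _ _).1 this
  · have : c (r ((1 : E) : L)) = c 1 := by rw [map_one, hr]; rfl
    exact (hc _ _).1 this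
  · intro x
    obtain ⟨f, hf, C, hC⟩ := hE x x.2
    refine ⟨C, ?_⟩
    have := hr' f
    filter_upwards [this, hC] with k h1 h2
    rw [show (x : L) = c f from hf.symm, h1]; exact h2
  · rintro f hf hC
    have h0 : c f ∈ R0 𝒰 T a O hT := ⟨f, rfl, hf, hC⟩
    have h1 : c f ∈ E0 := Subfield.subset_closure h0
    have h2 : c f ∈ E := mem_algebraicClosure_iff'.2 (isIntegral_algebraMap (x := (⟨c f, h1⟩ : E0)))
    exact ⟨⟨c f, h2⟩, hr' f⟩
  · intro ι _ _ B f hdet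
    let B' : Matrix ι ι (ℕ → K) := B.map (fun e => r e)
    have e1 : c ((f • (1 : Matrix ι ι (ℕ → K)) - B').det) = 0 := by
      rw [← map_zero c, hc]
      filter_upwards [hdet] with k hk
      rw [Pi.zero_apply, ← hk]
      have := RingHom.map_det (Pi.evalRingHom (fun _ : ℕ => K) k) (f • (1 : Matrix ι ι (ℕ → K)) - B')
      rw [Pi.evalRingHom_apply] at this
      rw [this]
      congr 1
      ext i j
      by_cases h : i = j
      · subst h; simp [B', Asy.mp]
      · simp [B', Asy.mp, h]
    rw [RingHom.map_det] at e1
    have e2 : c.mapMatrix (f • (1 : Matrix ι ι (ℕ → K)) - B') =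
        (c f) • (1 : Matrix ι ι L) - B.map (algebraMap E L) := by
      ext i j
      have : c (r (B i j)) = B i j := hr _
      by_cases h : i = j
      · subst h; simp [B', this]
      · simp [B', h, this]
    rw [e2] at e1
    have e3 : (B.map (algebraMap E L)).charpoly.eval (c f) = 0 := by
      rw [Matrix.eval_charpoly, ← e1]; congr 2
      ext i j; simp [Matrix.scalar_apply, Matrix.diagonal_apply, Matrix.one_apply]
    rw [Matrix.charpoly_map, Polynomial.eval_map] at e3
    have e4 : IsIntegral E (c f) := ⟨_, B.charpoly_monic, e3⟩
    have e5 : IsIntegral E0 (c f) := isIntegral_trans (A := E) _ e4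
    have e6 : c f ∈ E := mem_algebraicClosure_iff'.2 e5
    refine ⟨⟨c f, e6⟩, hr' f, ?_⟩
    have e7 : algebraMap E L (B.charpoly.eval ⟨c f, e6⟩) = 0 := by
      rw [← Polynomial.eval₂_at_apply]; exact e3
    have e8 := (map_eq_zero _).1 e7
    rw [Matrix.eval_charpoly] at e8
    rw [← e8]; congr 2
    ext i j; simp [Matrix.scalar_apply, Matrix.diagonal_apply, Matrix.one_apply]
end GermField

section limFAM
open Filter

lemma exists_ulim (𝒰 : Ultrafilter ℕ) (f : ℕ → ℝ) (h : ∀ k, f k ∈ Set.Icc (0:ℝ) 1) :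
    ∃ y ∈ Set.Icc (0:ℝ) 1, Tendsto f 𝒰 (nhds y) := by
  have := isCompact_Icc (a := (0:ℝ)) (b := 1) |>.ultrafilter_le_nhds (𝒰.map f) (by
    rw [le_principal_iff]; exact Filter.mem_map.2 (Filter.univ_mem' h))
  exact this

theorem exists_limFAM {X : Type*} (𝒰 : Ultrafilter ℕ) (m : ℕ → FAM X) :
    ∃ M : FAM (ℕ × X), ∀ A, Tendsto (fun k => (m k).m {x | (k, x) ∈ A}) 𝒰 (nhds (M.m A)) := by
  choose y hy hlim using fun A : Set (ℕ × X) => exists_ulim 𝒰 (fun k => (m k).m {x | (k, x) ∈ A})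
    (fun k => ⟨(m k).nonneg _, (m k).le_one _⟩)
  refine ⟨⟨y, fun s => (hy s).1, ?_, ?_⟩, hlim⟩
  · refine tendsto_nhds_unique (hlim Set.univ) ?_
    have : (fun k => (m k).m {x | (k, x) ∈ (Set.univ : Set (ℕ × X))}) = fun _ => 1 := by
      funext k; simpa using (m k).univ
    rw [this]; exact tendsto_const_nhds
  · intro s t hst
    refine tendsto_nhds_unique (hlim (s ∪ t)) ?_
    have : (fun k => (m k).m {x | (k, x) ∈ s ∪ t}) =
        fun k => (m k).m {x | (k, x) ∈ s} + (m k).m {x | (k, x) ∈ t} := by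
      funext k
      rw [← (m k).add]
      · rfl
      · rw [Set.disjoint_left] at hst ⊢
        exact fun x h1 h2 => hst h1 h2
    rw [this]; exact (hlim s).add (hlim t)

lemma limFAM_fst {X : Type*} {𝒰 : Ultrafilter ℕ} {m : ℕ → FAM X} {M : FAM (ℕ × X)}
    (hM : ∀ A, Tendsto (fun k => (m k).m {x | (k, x) ∈ A}) 𝒰 (nhds (M.m A))) :
    Tendsto Prod.fst M.ae (𝒰 : Filter ℕ) := by
  intro U hU
  rw [Filter.mem_map, FAM.mem_ae]
  refine tendsto_nhds_unique (hM _) ?_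
  refine tendsto_const_nhds.congr' ?_
  filter_upwards [hU] with k hk
  symm
  convert (m k).empty
  ext x; simp [hk]
end limFAM

def Asy.pull {Z Z' E K : Type*} [Field E] [Field K] {l : Filter Z} {l' : Filter Z'}
    {a : AbsoluteValue K ℝ} {T : Z → ℝ} (Φ : Asy l E a T) (p : Z' → Z)
    (hp : Filter.Tendsto p l' l) : Asy l' E a (T ∘ p) where
  seq e z := Φ.seq e (p z)
  add x y := hp.eventually (Φ.add x y)
  mul x y := hp.eventually (Φ.mul x y)
  zero := hp.eventually Φ.zero
  one := hp.eventually Φ.one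
  bdd x := by
    obtain ⟨C, hC⟩ := Φ.bdd x
    exact ⟨C, hp.eventually hC⟩

end Part4

section Part5

section LA
variable {K : Type*} [Field K] {d : ℕ}

/-- scale invariant set -/
def SInv (K : Type*) [Field K] {V : Type*} [SMul K V] (Y : Set V) : Prop :=
  ∀ c : K, c ≠ 0 → ∀ x ∈ Y, c • x ∈ Y

/-- approximate invariance of a finitely additive measure -/
def AI (m : FAM (Matrix (Fin d) (Fin d) K)) (g : Matrix (Fin d) (Fin d) K) (ε : ℝ) : Prop :=
  ∀ Y : Set (Matrix (Fin d) (Fin d) K), SInv K Y → |m.m {x | g * x ∈ Y} - m.m Y| ≤ ε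

lemma AI.mul {m : FAM (Matrix (Fin d) (Fin d) K)} {g h : Matrix (Fin d) (Fin d) K} {ε δ : ℝ}
    (h1 : AI m g ε) (h2 : AI m h δ) : AI m (g * h) (ε + δ) := by
  intro Y hY
  have e1 := h1 Y hY
  have e2 := h2 {x | g * x ∈ Y} (by
    intro c hc x hx
    simp only [Set.mem_setOf_eq, mul_smul_comm] at hx ⊢
    exact hY c hc _ hx)
  simp only [Set.mem_setOf_eq] at e2
  simp only [mul_assoc]
  have := abs_add_le (m.m {x | g * (h * x) ∈ Y} - m.m {x | g * x ∈ Y}) (m.m {x | g * x ∈ Y} - m.m Y)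
  rw [sub_add_sub_cancel] at this
  linarith

lemma AI.pow {m : FAM (Matrix (Fin d) (Fin d) K)} {S : Set (GL (Fin d) K)} {ε : ℝ}
    (h : ∀ s ∈ S, AI m (s : Matrix (Fin d) (Fin d) K) ε) (n : ℕ) :
    ∀ s ∈ S ^ n, AI m (s : Matrix (Fin d) (Fin d) K) (n * ε) := by
  induction n with
  | zero =>
    intro s hs
    rw [pow_zero, Set.mem_one] at hs
    subst hs
    intro Y hY; simp
  | succ n ih =>
    intro s hs
    rw [pow_succ] at hs
    obtain ⟨x, hx, y, hy, rfl⟩ := Set.mem_mul.1 hs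
    have := (ih x hx).mul (h y hy)
    push_cast
    rw [show ((n : ℝ) + 1) * ε = n * ε + ε by ring]
    exact this

lemma mem_closure_pow {G : Type*} [Group G] {S : Set G} (hsym : ∀ s ∈ S, s⁻¹ ∈ S) {x : G}
    (hx : x ∈ Subgroup.closure S) : ∃ n : ℕ, x ∈ S ^ n := by
  have hS : S⁻¹ = S := by
    ext s; rw [Set.mem_inv]
    exact ⟨fun h => by simpa using hsym _ h, fun h => hsym _ h⟩
  induction hx using Subgroup.closure_induction with
  | mem x hx => exact ⟨1, by simpa using hx⟩
  | one => exact ⟨0, by simp⟩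
  | mul x y _ _ hx hy =>
    obtain ⟨n, hn⟩ := hx
    obtain ⟨k, hk⟩ := hy
    exact ⟨n + k, by rw [pow_add]; exact Set.mul_mem_mul hn hk⟩
  | inv x _ hx =>
    obtain ⟨n, hn⟩ := hx
    refine ⟨n, ?_⟩
    rw [← hS, inv_pow, Set.inv_mem_inv]; exact hn

lemma inv_mem_pow {G : Type*} [Group G] {S : Set G} (hsym : ∀ s ∈ S, s⁻¹ ∈ S) {x : G} {n : ℕ}
    (hx : x ∈ S ^ n) : x⁻¹ ∈ S ^ n := by
  have hS : S⁻¹ = S := by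
    ext s; rw [Set.mem_inv]
    exact ⟨fun h => by simpa using hsym _ h, fun h => hsym _ h⟩
  rw [← hS, inv_pow, Set.inv_mem_inv]; exact hx

/-- the coercion to matrices as a map -/
def toM (g : GL (Fin d) K) : Matrix (Fin d) (Fin d) K := (g : Matrix (Fin d) (Fin d) K)

lemma span_pow_top (hd : 1 ≤ d) (S : Set (GL (Fin d) K)) (h1 : 1 ∈ S) (hsym : ∀ s ∈ S, s⁻¹ ∈ S)
    (hspan : Submodule.span K (toM '' (Subgroup.closure S : Set (GL (Fin d) K))) = ⊤) :
    Submodule.span K (toM '' (S ^ (d * d))) = ⊤ := by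
  let U : Submodule K (Matrix (Fin d) (Fin d) K) := Submodule.span K (toM '' S)
  have hU : ∀ n, U ^ n = Submodule.span K (toM '' (S ^ n)) := by
    intro n
    rw [Submodule.span_pow]
    congr 1
    exact (Set.image_pow (Units.coeHom _) S n).symm
  rw [← hU]
  have hmono1 : ∀ n, U ^ n ≤ U ^ (n + 1) := by
    intro n
    rw [hU, hU]
    exact Submodule.span_mono (Set.image_mono (Set.pow_subset_pow_right h1 (Nat.le_succ n)))
  have hmono : Monotone (fun n => U ^ n) := monotone_nat_of_le_succ hmono1
  have hfin : Module.finrank K (Matrix (Fin d) (Fin d) K) = d * d := by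
    rw [Module.finrank_matrix]; simp
  by_cases hst : ∃ j ≤ d * d, U ^ j = U ^ (j + 1)
  · obtain ⟨j, hj, hjj⟩ := hst
    have : ∀ i, U ^ (j + i) = U ^ j := by
      intro i
      induction i with
      | zero => rfl
      | succ i ih => rw [← add_assoc, pow_succ, ih, ← pow_succ, ← hjj]
    have hall : ∀ i, U ^ i ≤ U ^ j := fun i => by
      rw [← this i]; exact hmono (Nat.le_add_left _ _)
    refine top_le_iff.1 (le_trans ?_ (hmono hj))
    rw [← hspan, Submodule.span_le]
    rintro _ ⟨x, hx, rfl⟩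
    obtain ⟨n, hn⟩ := mem_closure_pow hsym hx
    apply hall n
    rw [hU]
    exact Submodule.subset_span ⟨x, hn, rfl⟩
  · push Not at hst
    exfalso
    have : ∀ j ≤ d * d + 1, j ≤ Module.finrank K ↥(U ^ j) := by
      intro j
      induction j with
      | zero => intro _; exact Nat.zero_le _
      | succ j ih =>
        intro hj
        have h1 := ih (by lia)
        have h2 := Submodule.finrank_lt_finrank_of_lt (lt_of_le_of_ne (hmono1 j) (hst j (by lia)))
        lia
    have h3 := this (d * d + 1) le_rfl
    have h4 := Submodule.finrank_le (U ^ (d * d + 1))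
    lia

lemma exists_basis_mem {s : Set (Matrix (Fin d) (Fin d) K)} (hs : Submodule.span K s = ⊤) :
    ∃ b : Module.Basis (Fin d × Fin d) K (Matrix (Fin d) (Fin d) K), ∀ i, b i ∈ s := by
  obtain ⟨t, hts, hspan, hli⟩ := exists_linearIndependent K s
  let b0 := Module.Basis.mk hli (by rw [Subtype.range_coe, hspan, hs])
  have : Fintype t := FiniteDimensional.fintypeBasisIndex b0
  have hc : Fintype.card t = Fintype.card (Fin d × Fin d) := by
    rw [← Module.finrank_eq_card_basis b0, Module.finrank_matrix]; simp
  let e := Fintype.equivOfCardEq hc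
  refine ⟨b0.reindex e, fun i => ?_⟩
  rw [Module.Basis.reindex_apply, Module.Basis.mk_apply]
  exact hts (e.symm i).2

/-- Gram matrix of the trace form -/
def tgram (b : Fin d × Fin d → Matrix (Fin d) (Fin d) K) : Matrix (Fin d × Fin d) (Fin d × Fin d) K :=
  Matrix.of fun i j => trace (b i * b j)

lemma tgram_det (b : Module.Basis (Fin d × Fin d) K (Matrix (Fin d) (Fin d) K)) : (tgram b).det ≠ 0 := by
  intro h0
  obtain ⟨c, hc, h⟩ := Matrix.exists_mulVec_eq_zero_iff.2 h0
  apply hc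
  have hx : ∑ j, c j • b j = 0 := by
    rw [Matrix.ext_iff_trace_mul_left]
    intro y
    rw [mul_zero, trace_zero]
    have hb : ∀ i, trace (b i * ∑ j, c j • b j) = 0 := by
      intro i
      have := congrFun h i
      simp only [mulVec, dotProduct, tgram, Matrix.of_apply, Pi.zero_apply] at this
      rw [← this, Finset.mul_sum, trace_sum]
      refine Finset.sum_congr rfl fun j _ => ?_
      rw [mul_smul_comm, trace_smul, smul_eq_mul, mul_comm]
    rw [← b.sum_repr y, Finset.sum_mul, trace_sum]
    refine Finset.sum_eq_zero fun i _ => ?_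
    rw [smul_mul_assoc, trace_smul, hb, smul_zero]
  funext i
  exact (Fintype.linearIndependent_iff.1 b.linearIndependent c hx i)

lemma tgram_toMatrix (b : Module.Basis (Fin d × Fin d) K (Matrix (Fin d) (Fin d) K))
    (f : Matrix (Fin d) (Fin d) K →ₗ[K] Matrix (Fin d) (Fin d) K) :
    LinearMap.toMatrix b b f = (tgram b)⁻¹ * Matrix.of fun l j => trace (b l * f (b j)) := by
  have h : tgram b * LinearMap.toMatrix b b f = Matrix.of fun l j => trace (b l * f (b j)) := by
    ext l j
    rw [Matrix.mul_apply, Matrix.of_apply]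
    conv_rhs => rw [← b.sum_repr (f (b j)), Finset.mul_sum, trace_sum]
    refine Finset.sum_congr rfl fun i _ => ?_
    rw [mul_smul_comm, trace_smul, smul_eq_mul, mul_comm, LinearMap.toMatrix_apply]; rfl
  rw [← h, ← mul_assoc, Matrix.nonsing_inv_mul _ (isUnit_iff_ne_zero.2 (tgram_det b)), one_mul]

lemma eig_exists [IsAlgClosed K] (w : Matrix (Fin d) (Fin d) K) :
    ∃ r : Fin d → K, w.charpoly = ∏ i, (Polynomial.X - Polynomial.C (r i)) ∧
      w.trace = ∑ i, r i ∧ w.det = ∏ i, r i := by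
  have hcard : w.charpoly.roots.card = d := by
    rw [← (IsAlgClosed.splits w.charpoly).natDegree_eq_card_roots, Matrix.charpoly_natDegree_eq_dim,
      Fintype.card_fin]
  obtain ⟨L, hL⟩ : ∃ L : List K, (L : Multiset K) = w.charpoly.roots := ⟨_, Multiset.coe_toList _⟩
  have hlen : L.length = d := by rw [← hcard, ← hL]; rfl
  subst hlen
  have hof : (L : Multiset K) = Finset.univ.val.map L.get := by
    rw [Fin.univ_val_map, List.ofFn_get]
  refine ⟨L.get, ?_, ?_, ?_⟩
  · have := (IsAlgClosed.splits w.charpoly).eq_prod_roots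
    rw [(charpoly_monic w).leadingCoeff, Polynomial.C_1, one_mul, ← hL, hof, Multiset.map_map] at this
    exact this
  · rw [Matrix.trace_eq_sum_roots_charpoly, ← hL, hof]; rfl
  · rw [Matrix.det_eq_prod_roots_charpoly, ← hL, hof]; rfl

lemma eig_left_det (b : Module.Basis (Fin d × Fin d) K (Matrix (Fin d) (Fin d) K))
    (w : Matrix (Fin d) (Fin d) K) (r : K) (h : w.charpoly.IsRoot r) :
    (r • 1 - LinearMap.toMatrix b b (LinearMap.mulLeft K w)).det = 0 := by
  rw [Polynomial.IsRoot, Matrix.eval_charpoly] at h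
  obtain ⟨u, hu, hu0⟩ := Matrix.exists_mulVec_eq_zero_iff.2 h
  let x : Matrix (Fin d) (Fin d) K := Matrix.of fun i _ => u i
  have hx : x ≠ 0 := by
    intro h0
    apply hu
    funext i
    exact congrFun (congrFun h0 i) i
  have hwx : r • x - w * x = 0 := by
    ext i j
    have := congrFun hu0 i
    rw [sub_mulVec] at this
    simp only [Pi.sub_apply, Matrix.scalar_apply, Matrix.mulVec_diagonal, Pi.zero_apply] at this
    simp only [Matrix.sub_apply, Matrix.smul_apply, Matrix.mul_apply, x, Matrix.of_apply,
      Matrix.zero_apply, smul_eq_mul]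
    exact this
  refine Matrix.exists_mulVec_eq_zero_iff.1 ⟨b.repr x, ?_, ?_⟩
  · intro h0
    exact hx (b.repr.map_eq_zero_iff.1 (Finsupp.coe_eq_zero.1 h0))
  · rw [sub_mulVec, smul_mulVec, one_mulVec, LinearMap.toMatrix_mulVec_repr,
      LinearMap.mulLeft_apply]
    have := congrArg (fun y => (b.repr y : Fin d × Fin d → K)) hwx
    simpa using this

lemma isRoot_pow (w : Matrix (Fin d) (Fin d) K) (r : K) (h : w.charpoly.IsRoot r) (n : ℕ) :
    (w ^ n).charpoly.IsRoot (r ^ n) := by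
  rw [← Matrix.mem_spectrum_iff_isRoot_charpoly] at h ⊢
  have := spectrum.pow_mem_pow w n h
  exact this

end LA

end Part5

section Part6

section Mp
variable {Z E K ι : Type*} [Field E] [Field K] {l : Filter Z} {a : AbsoluteValue K ℝ} {T : Z → ℝ}
  (Φ : Asy l E a T) [Fintype ι] [DecidableEq ι]

lemma Asy.mp_inj [l.NeBot] {B C : Matrix ι ι E} (h : ∀ᶠ k in l, Φ.mp B k = Φ.mp C k) : B = C := by
  by_contra hne
  have h1 := Φ.mp_ne_zero (sub_ne_zero.2 hne)
  have h2 := Φ.mp_add (B - C) C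
  obtain ⟨k, h, h1, h2⟩ := (h.and (h1.and h2)).exists
  rw [sub_add_cancel, h] at h2
  exact h1 (by simpa using h2)

lemma Asy.mp_of_entries (f : Z → Matrix ι ι K)
    (h : ∀ i j, ∃ e, ∀ᶠ k in l, Φ.seq e k = f k i j) : ∃ B : Matrix ι ι E, ∀ᶠ k in l, Φ.mp B k = f k := by
  choose e he using h
  refine ⟨Matrix.of e, ?_⟩
  have : ∀ᶠ k in l, ∀ i j, Φ.seq (e i j) k = f k i j := by
    simp only [Filter.eventually_all]; exact he
  filter_upwards [this] with k hk
  ext i j; exact hk i j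

lemma Asy.mp_inv [l.NeBot] (f : Z → Matrix ι ι K) (B : Matrix ι ι E) (hB : ∀ᶠ k in l, Φ.mp B k = f k)
    (hf : ∀ k, (f k).det ≠ 0) : ∃ B' : Matrix ι ι E, ∀ᶠ k in l, Φ.mp B' k = (f k)⁻¹ := by
  have hdet : B.det ≠ 0 := by
    intro h0
    obtain ⟨u, hu, h⟩ := Matrix.exists_mulVec_eq_zero_iff.2 h0
    let C : Matrix ι ι E := Matrix.of fun i _ => u i
    have hC : C ≠ 0 := by
      intro h0; apply hu; funext i; exact congrFun (congrFun h0 i) i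
    have hBC : B * C = 0 := by
      ext i j; exact congrFun h i
    obtain ⟨k, h1, h2, h3, h4⟩ := (hB.and ((Φ.mp_ne_zero hC).and ((Φ.mp_mul B C).and
      (Φ.mp_zero (ι := ι))))).exists
    rw [hBC, h4, h1] at h3
    apply h2
    have := congrArg (fun X => (f k)⁻¹ * X) h3
    simpa [← mul_assoc, Matrix.nonsing_inv_mul _ (isUnit_iff_ne_zero.2 (hf k))] using this.symm
  refine ⟨B⁻¹, ?_⟩
  filter_upwards [hB, Φ.mp_mul B⁻¹ B, Φ.mp_one (ι := ι)] with k h1 h2 h3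
  rw [Matrix.nonsing_inv_mul _ (isUnit_iff_ne_zero.2 hdet), h3, h1] at h2
  exact (Matrix.inv_eq_left_inv h2.symm).symm

lemma Asy.mp_aeval (g : Matrix ι ι E) {κ : Type*} (s : Finset κ) (α : κ → E) :
    ∀ᶠ k in l, Φ.mp (Polynomial.aeval g (∏ i ∈ s, (Polynomial.X - Polynomial.C (α i)))) k =
      Polynomial.aeval (Φ.mp g k) (∏ i ∈ s, (Polynomial.X - Polynomial.C (Φ.seq (α i) k))) := by
  classical
  induction s using Finset.induction_on with
  | empty => simpa using Φ.mp_one (ι := ι)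
  | insert i s hi ih =>
    have h5 : g = (g - algebraMap E _ (α i)) + (α i) • (1 : Matrix ι ι E) := by
      rw [Algebra.algebraMap_eq_smul_one, sub_add_cancel]
    filter_upwards [ih, Φ.mp_mul (Polynomial.aeval g (Polynomial.X - Polynomial.C (α i)))
      (Polynomial.aeval g (∏ i ∈ s, (Polynomial.X - Polynomial.C (α i)))),
      Φ.mp_add (g - algebraMap E _ (α i)) ((α i) • (1 : Matrix ι ι E)), Φ.mp_smul (α i) (1 : Matrix ι ι E),
      Φ.mp_one (ι := ι)] with k h1 h2 h3 h4 h6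
    rw [Finset.prod_insert hi, Finset.prod_insert hi, map_mul, h2, h1, map_mul]
    congr 1
    rw [← h5, h4, h6] at h3
    rw [map_sub, map_sub, Polynomial.aeval_X, Polynomial.aeval_X, Polynomial.aeval_C, Polynomial.aeval_C,
      h3, Algebra.algebraMap_eq_smul_one (Φ.seq (α i) k), add_sub_cancel_right]

end Mp

/-- left regular representation in coordinates -/
noncomputable def lrep {K : Type*} [Field K] {d : ℕ}
    (b : Module.Basis (Fin d × Fin d) K (Matrix (Fin d) (Fin d) K)) :
    Matrix (Fin d) (Fin d) K →ₐ[K] Matrix (Fin d × Fin d) (Fin d × Fin d) K :=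
  (LinearMap.toMatrixAlgEquiv b).toAlgHom.comp (Algebra.lmul K _)

lemma lrep_apply {K : Type*} [Field K] {d : ℕ}
    (b : Module.Basis (Fin d × Fin d) K (Matrix (Fin d) (Fin d) K)) (x : Matrix (Fin d) (Fin d) K) :
    lrep b x = LinearMap.toMatrix b b (LinearMap.mulLeft K x) := rfl

lemma lrep_mulVec {K : Type*} [Field K] {d : ℕ}
    (b : Module.Basis (Fin d × Fin d) K (Matrix (Fin d) (Fin d) K)) (x y : Matrix (Fin d) (Fin d) K) :
    lrep b x *ᵥ b.equivFun y = b.equivFun (x * y) := by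
  have := LinearMap.toMatrix_mulVec_repr b b (LinearMap.mulLeft K x) y
  exact this

lemma rrep_mulVec {K : Type*} [Field K] {d : ℕ}
    (b : Module.Basis (Fin d × Fin d) K (Matrix (Fin d) (Fin d) K)) (x y : Matrix (Fin d) (Fin d) K) :
    LinearMap.toMatrix b b (LinearMap.mulRight K x) *ᵥ b.equivFun y = b.equivFun (y * x) := by
  have := LinearMap.toMatrix_mulVec_repr b b (LinearMap.mulRight K x) y
  exact this

lemma lrep_comm {K : Type*} [Field K] {d : ℕ}
    (b : Module.Basis (Fin d × Fin d) K (Matrix (Fin d) (Fin d) K)) (x y : Matrix (Fin d) (Fin d) K) :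
    lrep b x * LinearMap.toMatrix b b (LinearMap.mulRight K y) =
      LinearMap.toMatrix b b (LinearMap.mulRight K y) * lrep b x := by
  rw [lrep_apply, ← LinearMap.toMatrix_comp, ← LinearMap.toMatrix_comp]
  congr 1
  ext z : 1
  simp [mul_assoc]

end Part6

section Part7

universe u
set_option maxHeartbeats 1000000 in
theorem seqA {K : Type u} [Field K] {d : ℕ} {V : Type*} [Fintype V]
    (a : V → AbsoluteValue K ℝ) (v : V) (O : Subring K)
    (hprod : ∀ x ∈ O, x ≠ 0 → 1 ≤ ∏ u, a u x)
    (𝒰 : Ultrafilter ℕ) (S : ℕ → Set (GL (Fin d) K)) (h1 : ∀ k, 1 ∈ S k)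
    (hsym : ∀ k, ∀ s ∈ S k, s⁻¹ ∈ S k) (m : ℕ → FAM (Matrix (Fin d) (Fin d) K))
    (hm : ∀ k, (m k).m {0} = 0) (ε : ℕ → ℝ) (hε : Filter.Tendsto ε 𝒰 (nhds 0))
    (hAI : ∀ k, ∀ s ∈ S k, AI (m k) (toM s) (ε k)) (T : ℕ → ℝ)
    (hT : ∀ R : ℝ, ∀ᶠ k in (𝒰 : Filter ℕ), R ≤ T k) (N : ℕ) (hN : 3 * (d * d) + 1 ≤ N)
    (htrO : ∀ k, ∀ s ∈ S k ^ N, (toM s).trace ∈ O) (C0 : ℕ)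
    (htrB : ∀ᶠ k in (𝒰 : Filter ℕ), ∀ s ∈ S k ^ N, ∀ u, a u ((toM s).trace) ≤ T k ^ C0)
    (b : ℕ → Module.Basis (Fin d × Fin d) K (Matrix (Fin d) (Fin d) K))
    (hb : ∀ k i, b k i ∈ toM '' (S k ^ (d * d)))
    (w : ℕ → GL (Fin d) K) (hw : ∀ k, w k ∈ S k ^ N)
    (r : ℕ → Fin d → K) (hr : ∀ k, (toM (w k)).charpoly = ∏ i, (Polynomial.X - Polynomial.C (r k i)))
    (j : ℕ) (I : Finset (Fin d)) (hI0 : I.Nonempty) (hI1 : Iᶜ.Nonempty)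
    (hI : ∀ᶠ k in (𝒰 : Filter ℕ), ∀ i ∈ I, T k ^ (j + 1) ≤ a v (r k i))
    (hJ : ∀ᶠ k in (𝒰 : Filter ℕ), ∀ i ∈ Iᶜ, a v (r k i) ≤ T k ^ j) :
    ∃ k, ∃ F : Set (Submodule K (Matrix (Fin d) (Fin d) K)), F.Finite ∧ F.Nonempty ∧
      ∀ W ∈ F, W ≠ ⊥ ∧ W ≠ ⊤ ∧ (∀ x ∈ W, ∀ y, x * y ∈ W) ∧
        ∀ s ∈ S k, W.comap (LinearMap.mulLeft K (toM s)) ∈ F := by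
  classical
  obtain ⟨E, _, Φ, hrep, hspec⟩ := exists_germ_field 𝒰 T a v O hprod hT
  have htr : ∀ γ : ℕ → GL (Fin d) K, (∀ k, γ k ∈ S k ^ N) →
      ∃ e, ∀ᶠ k in (𝒰 : Filter ℕ), Φ.seq e k = (toM (γ k)).trace := fun γ hγ =>
    hrep _ (Filter.Eventually.of_forall fun k => htrO k _ (hγ k))
      ⟨C0, htrB.mono fun k hk u => hk _ (hγ k) u⟩
  choose β hβ hβb using hb
  have hup : ∀ {p : ℕ} (k), p ≤ N → S k ^ p ⊆ S k ^ N := fun k hp => Set.pow_subset_pow_right (h1 k) hp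
  -- gram matrix
  obtain ⟨G, hG⟩ : ∃ G : Matrix (Fin d × Fin d) (Fin d × Fin d) E,
      ∀ᶠ k in (𝒰 : Filter ℕ), Φ.mp G k = (tgram (b k))⁻¹ := by
    obtain ⟨G, hG⟩ := Φ.mp_of_entries (fun k => tgram (b k)) (fun i j => by
      obtain ⟨e, he⟩ := htr (fun k => β k i * β k j) (fun k => hup k (p := d * d + d * d) (by lia)
        (by rw [pow_add]; exact Set.mul_mem_mul (hβ k i) (hβ k j)))
      refine ⟨e, he.mono fun k hk => ?_⟩
      rw [hk, tgram, Matrix.of_apply, ← hβb, ← hβb]; rfl)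
    exact Φ.mp_inv _ G hG (fun k => tgram_det (b k))
  have hlin : ∀ f : ∀ k, Matrix (Fin d) (Fin d) K →ₗ[K] Matrix (Fin d) (Fin d) K,
      (∀ l j, ∃ γ : ℕ → GL (Fin d) K, (∀ k, γ k ∈ S k ^ N) ∧ ∀ k, b k l * f k (b k j) = toM (γ k)) →
      ∃ B : Matrix (Fin d × Fin d) (Fin d × Fin d) E,
      ∀ᶠ k in (𝒰 : Filter ℕ), Φ.mp B k = LinearMap.toMatrix (b k) (b k) (f k) := by
    intro f hf
    obtain ⟨B, hB⟩ := Φ.mp_of_entries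
      (fun k => Matrix.of fun l j => trace (b k l * f k (b k j))) (fun l j => by
        obtain ⟨γ, hγ, hγ2⟩ := hf l j
        obtain ⟨e, he⟩ := htr γ hγ
        refine ⟨e, he.mono fun k hk => ?_⟩
        rw [hk, Matrix.of_apply, hγ2])
    refine ⟨G * B, ?_⟩
    filter_upwards [hG, hB, Φ.mp_mul G B] with k e1 e2 e3
    rw [e3, e1, e2, tgram_toMatrix]
  have hL1 : ∀ s : ℕ → GL (Fin d) K, (∀ k, s k ∈ S k) →
      ∃ B : Matrix (Fin d × Fin d) (Fin d × Fin d) E,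
      ∀ᶠ k in (𝒰 : Filter ℕ), Φ.mp B k = lrep (b k) (toM (s k)) := by
    intro s hs
    refine hlin (fun k => LinearMap.mulLeft K (toM (s k))) fun l j => ⟨fun k => β k l * (s k * β k j), fun k => ?_, fun k => ?_⟩
    · refine hup k (p := d * d + (1 + d * d)) (by lia) ?_
      rw [pow_add, pow_add, pow_one]
      exact Set.mul_mem_mul (hβ k l) (Set.mul_mem_mul (hs k) (hβ k j))
    · rw [← hβb, ← hβb]; rfl
  have hR : ∀ p, ∃ B : Matrix (Fin d × Fin d) (Fin d × Fin d) E,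
      ∀ᶠ k in (𝒰 : Filter ℕ), Φ.mp B k = LinearMap.toMatrix (b k) (b k) (LinearMap.mulRight K (b k p)) := by
    intro p
    refine hlin (fun k => LinearMap.mulRight K (b k p)) fun l j => ⟨fun k => β k l * (β k j * β k p), fun k => ?_, fun k => ?_⟩
    · refine hup k (p := d * d + (d * d + d * d)) (by lia) ?_
      rw [pow_add, pow_add]
      exact Set.mul_mem_mul (hβ k l) (Set.mul_mem_mul (hβ k j) (hβ k p))
    · rw [LinearMap.mulRight_apply, ← hβb, ← hβb, ← hβb]; rfl
  have hL : ∀ n, ∀ γ : ℕ → GL (Fin d) K, (∀ k, γ k ∈ S k ^ n) →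
      ∃ B : Matrix (Fin d × Fin d) (Fin d × Fin d) E,
      ∀ᶠ k in (𝒰 : Filter ℕ), Φ.mp B k = lrep (b k) (toM (γ k)) := by
    intro n
    induction n with
    | zero =>
      intro γ hγ
      refine ⟨1, ?_⟩
      filter_upwards [Φ.mp_one (ι := Fin d × Fin d)] with k hk
      have : γ k = 1 := by simpa using hγ k
      rw [hk, this, toM, Units.val_one, map_one]
    | succ n ih =>
      intro γ hγ
      have : ∀ k, ∃ x y, x ∈ S k ^ n ∧ y ∈ S k ∧ x * y = γ k := fun k => by
        have := hγ k
        rw [pow_succ] at this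
        obtain ⟨x, hx, y, hy, h⟩ := Set.mem_mul.1 this
        exact ⟨x, y, hx, hy, h⟩
      choose x y hx hy hxy using this
      obtain ⟨B, hB⟩ := ih x hx
      obtain ⟨C, hC⟩ := hL1 y hy
      refine ⟨B * C, ?_⟩
      filter_upwards [hB, hC, Φ.mp_mul B C] with k e1 e2 e3
      rw [e3, e1, e2, ← map_mul, ← hxy]; rfl
  let SS : Set (Matrix (Fin d × Fin d) (Fin d × Fin d) E) := {B | ∃ n, ∃ γ : ℕ → GL (Fin d) K,
    (∀ k, γ k ∈ S k ^ n) ∧ ∀ᶠ k in (𝒰 : Filter ℕ), Φ.mp B k = lrep (b k) (toM (γ k))}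
  let RR : Set (Matrix (Fin d × Fin d) (Fin d × Fin d) E) := {B | ∃ p,
    ∀ᶠ k in (𝒰 : Filter ℕ), Φ.mp B k = LinearMap.toMatrix (b k) (b k) (LinearMap.mulRight K (b k p))}
  have hcomm : ∀ s ∈ SS, ∀ r ∈ RR, s * r = r * s := by
    rintro s ⟨n, γ, hγ, h2⟩ r ⟨p, hp⟩
    apply Φ.mp_inj
    filter_upwards [h2, hp, Φ.mp_mul s r, Φ.mp_mul r s] with k e1 e2 e3 e4
    rw [e3, e4, e1, e2, lrep_comm]
  have hone : (1 : Matrix (Fin d × Fin d) (Fin d × Fin d) E) ∈ SS := by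
    refine ⟨0, fun _ => 1, fun k => by simp, ?_⟩
    filter_upwards [Φ.mp_one (ι := Fin d × Fin d)] with k hk
    rw [hk, toM, Units.val_one, map_one]
  have hmul : ∀ s ∈ SS, ∀ s' ∈ SS, s * s' ∈ SS := by
    rintro s ⟨n, γ, hγ, h2⟩ s' ⟨n', γ', hγ', h2'⟩
    refine ⟨n + n', fun k => γ k * γ' k, fun k => by rw [pow_add]; exact Set.mul_mem_mul (hγ k) (hγ' k), ?_⟩
    filter_upwards [h2, h2', Φ.mp_mul s s'] with k e1 e2 e3
    rw [e3, e1, e2, ← map_mul]; rfl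
  have hinv : ∀ s ∈ SS, ∃ s' ∈ SS, s * s' = 1 := by
    rintro s ⟨n, γ, hγ, h2⟩
    have hγ' : ∀ k, (γ k)⁻¹ ∈ S k ^ n := fun k => inv_mem_pow (hsym k) (hγ k)
    obtain ⟨B, hB⟩ := hL n _ hγ'
    refine ⟨B, ⟨n, _, hγ', hB⟩, ?_⟩
    apply Φ.mp_inj
    filter_upwards [h2, hB, Φ.mp_mul s B, Φ.mp_one (ι := Fin d × Fin d)] with k e1 e2 e3 e4
    rw [e3, e1, e2, e4, ← map_mul, toM, toM, ← Units.val_mul, mul_inv_cancel, Units.val_one, map_one]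
  -- limit measure
  obtain ⟨M, hM⟩ := exists_limFAM 𝒰 (fun k => FAM.map (b k).equivFun (m k))
  have hfst := limFAM_fst hM
  let Ψ : Asy M.ae E (a v) (T ∘ Prod.fst) := Φ.pull Prod.fst hfst
  have hΨ : ∀ (B : Matrix (Fin d × Fin d) (Fin d × Fin d) E) z, Ψ.mp B z = Φ.mp B z.1 := fun B z => rfl
  have hT' : ∀ R : ℝ, ∀ᶠ z in M.ae, R ≤ (T ∘ Prod.fst) z := fun R => hfst.eventually (hT R)
  have hx : ∀ᶠ z in M.ae, (Prod.snd : ℕ × (Fin d × Fin d → K) → _) z ≠ 0 := by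
    change {z : ℕ × (Fin d × Fin d → K) | z.2 ≠ 0} ∈ M.ae
    rw [FAM.mem_ae]
    refine tendsto_nhds_unique (hM _) ?_
    refine tendsto_const_nhds.congr fun k => ?_
    symm
    change (m k).m _ = 0
    convert hm k using 2
    ext y
    simp
  have hS : ∀ s ∈ SS, ∀ B i, M.m {z | (T ∘ Prod.fst) z ^ i * vnrm (a v) (Ψ.mp B z *ᵥ (Ψ.mp s z *ᵥ z.2)) ≤
      vnrm (a v) (Ψ.mp s z *ᵥ z.2)} = M.m (Ψ.Nb Prod.snd i B) := by
    rintro s ⟨n, γ, hγ, h2⟩ B i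
    have l1 := hM {z | (T ∘ Prod.fst) z ^ i * vnrm (a v) (Ψ.mp B z *ᵥ (Ψ.mp s z *ᵥ z.2)) ≤
      vnrm (a v) (Ψ.mp s z *ᵥ z.2)}
    have l2 := hM (Ψ.Nb Prod.snd i B)
    have l3 := l1.sub l2
    refine sub_eq_zero.1 (tendsto_nhds_unique l3 ?_)
    have l4 : Filter.Tendsto (fun k => n * ε k) 𝒰 (nhds 0) := by simpa using hε.const_mul (n : ℝ)
    refine squeeze_zero_norm' ?_ l4
    filter_upwards [h2] with k hk
    rw [Real.norm_eq_abs]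
    have := AI.pow (hAI k) n _ (hγ k) {y | T k ^ i * vnrm (a v) (Φ.mp B k *ᵥ (b k).equivFun y) ≤
      vnrm (a v) ((b k).equivFun y)} (by
        intro c hc y hy
        simp only [Set.mem_setOf_eq, map_smul, mulVec_smul, vnrm_smul] at hy ⊢
        have := mul_le_mul_of_nonneg_left hy ((a v).nonneg c)
        linarith)
    refine le_trans (le_of_eq ?_) this
    congr 1
    congr 1
    change (m k).m _ = (m k).m _
    congr 1
    ext y
    simp only [Set.mem_setOf_eq, Set.mem_preimage, hΨ, Function.comp, hk, lrep_mulVec]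
    rfl
  -- eigenvalues
  obtain ⟨g, hg⟩ := hL N w hw
  have hroot : ∀ k i, (toM (w k)).charpoly.IsRoot (r k i) := by
    intro k i
    rw [hr, Polynomial.IsRoot, Polynomial.eval_prod]
    exact Finset.prod_eq_zero (Finset.mem_univ i) (by simp)
  have : ∀ i, ∃ e, (∀ᶠ k in (𝒰 : Filter ℕ), Φ.seq e k = r k i) ∧ (e • 1 - g).det = 0 := by
    intro i
    refine hspec _ g (fun k => r k i) ?_
    filter_upwards [hg] with k hk
    rw [hk, lrep_apply]
    exact eig_left_det (b k) _ _ (hroot k i)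
  choose α hα hαg using this
  have hαs : ∀ i, α i ∈ spectrum E g := by
    intro i
    rw [spectrum.mem_iff, Algebra.algebraMap_eq_smul_one, Matrix.isUnit_iff_isUnit_det, hαg i]
    simp
  have hαall : ∀ᶠ k in (𝒰 : Filter ℕ), ∀ i, Φ.seq (α i) k = r k i := by
    simpa only [Filter.eventually_all] using hα
  have hCH : Polynomial.aeval g (∏ i, (Polynomial.X - Polynomial.C (α i))) = 0 := by
    apply Φ.mp_inj
    filter_upwards [Φ.mp_aeval g Finset.univ α, hαall, hg, Φ.mp_zero (ι := Fin d × Fin d)] with k e1 e2 e3 e4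
    rw [e1, e4, e3]
    simp only [e2]
    rw [← hr, Polynomial.aeval_algHom_apply, Matrix.aeval_self_charpoly, map_zero]
  obtain ⟨F, hFfin, hFne, hF⟩ := Ψ.core2 Prod.snd hT' hx SS RR hcomm hinv hone hmul hS g ⟨N, w, hw, hg⟩
    (I.val.map α) (Iᶜ.val.map α) (by
      rw [← map_mul, Multiset.map_map, Multiset.map_map, ← hCH]
      congr 1
      rw [← Finset.prod_mul_prod_compl I]
      rfl) j (by
      intro e he
      obtain ⟨i, hi, rfl⟩ := Multiset.mem_map.1 he
      refine hfst.eventually (p := fun k => T k ^ (j + 1) ≤ (a v) (Φ.seq (α i) k)) ?_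
      filter_upwards [hI, hαall] with k e1 e2
      rw [e2]; exact e1 i hi) (by
      intro e he
      obtain ⟨i, hi, rfl⟩ := Multiset.mem_map.1 he
      refine hfst.eventually (p := fun k => (a v) (Φ.seq (α i) k) ≤ T k ^ j) ?_
      filter_upwards [hJ, hαall] with k e1 e2
      rw [e2]; exact e1 i hi) (by
      obtain ⟨i, hi⟩ := hI0
      exact ⟨α i, Multiset.mem_map_of_mem _ hi, hαs i⟩) (by
      obtain ⟨i, hi⟩ := hI1
      exact ⟨α i, Multiset.mem_map_of_mem _ hi, hαs i⟩)
  -- transfer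
  choose D hD using fun W : Submodule E (Fin d × Fin d → E) => exists_matrix_ker W
  have t1 : ∀ᶠ k in (𝒰 : Filter ℕ), ∀ W ∈ F, Φ.mp (D W) k ≠ 0 := by
    rw [Filter.eventually_all_finite hFfin]
    intro W hW
    apply Φ.mp_ne_zero
    intro h0
    apply (hF W hW).2.1
    rw [← hD W, h0]; simp
  have t2 : ∀ᶠ k in (𝒰 : Filter ℕ), ∀ W ∈ F, ∃ u, u ≠ 0 ∧ Φ.mp (D W) k *ᵥ u = 0 := by
    rw [Filter.eventually_all_finite hFfin]
    intro W hW
    obtain ⟨u, huW, hu⟩ := Submodule.exists_mem_ne_zero_of_ne_bot (hF W hW).1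
    rw [← hD W, LinearMap.mem_ker, toLin'_apply] at huW
    let C : Matrix (Fin d × Fin d) (Fin d × Fin d) E := Matrix.of fun i _ => u i
    have hC : C ≠ 0 := by
      intro h0; apply hu; funext i; exact congrFun (congrFun h0 i) i
    have hBC : D W * C = 0 := by
      ext i j; exact congrFun huW i
    filter_upwards [Φ.mp_ne_zero hC, Φ.mp_mul (D W) C, Φ.mp_zero (ι := Fin d × Fin d)] with k e1 e2 e3
    rw [hBC, e3] at e2
    by_contra hcon
    push Not at hcon
    apply e1
    ext i j
    by_contra hij
    refine hcon (fun i => Φ.mp C k i j) (fun h0 => hij (congrFun h0 i)) ?_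
    funext i'
    exact (congrFun (congrFun e2 i') j).symm
  have t3 : ∀ᶠ k in (𝒰 : Filter ℕ), ∀ W ∈ F, ∀ p, ∀ u, Φ.mp (D W) k *ᵥ u = 0 →
      Φ.mp (D W) k *ᵥ (LinearMap.toMatrix (b k) (b k) (LinearMap.mulRight K (b k p)) *ᵥ u) = 0 := by
    rw [Filter.eventually_all_finite hFfin]
    intro W hW
    rw [Filter.eventually_all]
    intro p
    obtain ⟨B, hB⟩ := hR p
    have hle := (hF W hW).2.2.1 B ⟨p, hB⟩
    obtain ⟨Y, hY⟩ := matrix_factor (D W) (D W * B) (by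
      intro u hu
      rw [hD W] at hu
      have := hle hu
      rw [Submodule.mem_comap, ← hD W, LinearMap.mem_ker, toLin'_apply, toLin'_apply] at this
      rw [LinearMap.mem_ker, toLin'_apply, ← mulVec_mulVec, this])
    filter_upwards [hB, Φ.mp_mul (D W) B, Φ.mp_mul Y (D W)] with k e1 e2 e3 u hu
    rw [← e1, mulVec_mulVec, ← e2, hY, e3, ← mulVec_mulVec, hu, mulVec_zero]
  have t4 : ∀ᶠ k in (𝒰 : Filter ℕ), ∀ W ∈ F, ∀ s ∈ S k, ∃ W' ∈ F, ∀ u,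
      Φ.mp (D W) k *ᵥ (lrep (b k) (toM s) *ᵥ u) = 0 ↔ Φ.mp (D W') k *ᵥ u = 0 := by
    rw [Filter.eventually_all_finite hFfin]
    intro W hW
    by_contra hcon
    rw [← Ultrafilter.eventually_not] at hcon
    have : ∀ k, ∃ s ∈ S k, (¬ (∀ s ∈ S k, ∃ W' ∈ F, ∀ u,
      Φ.mp (D W) k *ᵥ (lrep (b k) (toM s) *ᵥ u) = 0 ↔ Φ.mp (D W') k *ᵥ u = 0)) →
      ¬ ∃ W' ∈ F, ∀ u,
      Φ.mp (D W) k *ᵥ (lrep (b k) (toM s) *ᵥ u) = 0 ↔ Φ.mp (D W') k *ᵥ u = 0 := by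
      intro k
      by_cases h : (∀ s ∈ S k, ∃ W' ∈ F, ∀ u,
        Φ.mp (D W) k *ᵥ (lrep (b k) (toM s) *ᵥ u) = 0 ↔ Φ.mp (D W') k *ᵥ u = 0)
      · exact ⟨1, h1 k, fun h' => absurd h h'⟩
      · have h' := h
        rw [not_forall] at h
        obtain ⟨s, hs⟩ := h
        rw [_root_.not_imp] at hs
        exact ⟨s, hs.1, fun _ => hs.2⟩
    choose s hs hs2 using this
    have hcon2 := hcon.mono fun k hk => hs2 k hk
    obtain ⟨B, hB⟩ := hL1 s hs
    have hmem := (hF W hW).2.2.2 B ⟨1, s, fun k => by simpa using hs k, hB⟩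
    set W' := W.comap (toLin' B) with hW'
    have hker : ∀ u, u ∈ LinearMap.ker (toLin' (D W')) ↔ u ∈ LinearMap.ker (toLin' (D W * B)) := by
      intro u
      rw [hD W', hW', Submodule.mem_comap, LinearMap.mem_ker, toLin'_apply, toLin'_apply,
        ← mulVec_mulVec, ← toLin'_apply (D W), ← LinearMap.mem_ker, hD W]
    obtain ⟨Y, hY⟩ := matrix_factor (D W') (D W * B) (fun u hu => (hker u).1 hu)
    obtain ⟨Y', hY'⟩ := matrix_factor (D W * B) (D W') (fun u hu => (hker u).2 hu)
    obtain ⟨k, e0, e1, e2, e3, e4⟩ := (hcon2.and (hB.and ((Φ.mp_mul (D W) B).and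
      ((Φ.mp_mul Y (D W')).and (Φ.mp_mul Y' (D W * B)))))).exists
    refine e0 ⟨W', hmem, fun u => ?_⟩
    rw [← e1, mulVec_mulVec, ← e2]
    constructor
    · intro h
      rw [hY', e4, ← mulVec_mulVec, h, mulVec_zero]
    · intro h
      rw [hY, e3, ← mulVec_mulVec, h, mulVec_zero]
  obtain ⟨k, t1, t2, t3, t4⟩ := (t1.and (t2.and (t3.and t4))).exists
  let P : Submodule E (Fin d × Fin d → E) → Submodule K (Matrix (Fin d) (Fin d) K) := fun W =>
    (LinearMap.ker (toLin' (Φ.mp (D W) k))).comap (b k).equivFun.toLinearMap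
  have hP : ∀ W x, x ∈ P W ↔ Φ.mp (D W) k *ᵥ (b k).equivFun x = 0 := by
    intro W x
    rw [Submodule.mem_comap, LinearMap.mem_ker, toLin'_apply]; rfl
  refine ⟨k, P '' F, hFfin.image _, hFne.image _, ?_⟩
  rintro _ ⟨W, hW, rfl⟩
  refine ⟨?_, ?_, ?_, ?_⟩
  · obtain ⟨u, hu, h⟩ := t2 W hW
    rw [Submodule.ne_bot_iff]
    refine ⟨(b k).equivFun.symm u, ?_, fun h0 => hu ((b k).equivFun.symm.map_eq_zero_iff.1 h0)⟩
    rw [hP, LinearEquiv.apply_symm_apply]; exact h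
  · intro htop
    apply t1 W hW
    apply toLin'.injective
    apply LinearMap.ext
    intro u
    have : (b k).equivFun.symm u ∈ P W := by rw [htop]; trivial
    rw [hP, LinearEquiv.apply_symm_apply] at this
    rw [toLin'_apply, this]; simp
  · intro x hx y
    rw [← (b k).sum_repr y, Finset.mul_sum]
    refine Submodule.sum_mem _ fun p _ => ?_
    rw [mul_smul_comm]
    refine Submodule.smul_mem _ _ ?_
    rw [hP] at hx ⊢
    rw [← rrep_mulVec]
    exact t3 W hW p _ hx
  · intro s hs
    obtain ⟨W', hW', h⟩ := t4 W hW s hs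
    refine ⟨W', hW', ?_⟩
    ext x
    rw [hP, Submodule.mem_comap, hP, LinearMap.mulLeft_apply, ← lrep_mulVec]
    exact (h _).symm

end Part7

section Part8

universe u

/-- strong irreducibility of the regular module -/
def SI {K : Type*} [Field K] {d : ℕ} (Γ : Subgroup (GL (Fin d) K)) : Prop :=
  ∀ F : Set (Submodule K (Matrix (Fin d) (Fin d) K)), F.Finite →
    (∀ W ∈ F, ∀ γ ∈ Γ, W.comap (LinearMap.mulLeft K (toM γ)) ∈ F) →
      ∀ W ∈ F, ∀ y, ∀ x ∈ W, y * x ∈ W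

lemma finite_pow {G : Type*} [Monoid G] {S : Set G} (h : S.Finite) (n : ℕ) : (S ^ n).Finite := by
  induction n with
  | zero => simp
  | succ n ih => rw [pow_succ]; exact ih.mul h

lemma gap_pigeon {d : ℕ} (y : Fin d → ℝ) (T : ℝ) (hT : 1 < T) (i0 : Fin d) (hi0 : y i0 = T ^ d)
    (hy : ∀ i, 0 ≤ y i) (hp : ∏ i, y i = 1) :
    ∃ (j : Fin d) (I : Finset (Fin d)), I.Nonempty ∧ Iᶜ.Nonempty ∧
      (∀ i ∈ I, T ^ ((j : ℕ) + 1) ≤ y i) ∧ ∀ i ∈ Iᶜ, y i ≤ T ^ (j : ℕ) := by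
  classical
  have : ∃ j : Fin d, ∀ i, ¬ (T ^ (j : ℕ) < y i ∧ y i < T ^ ((j : ℕ) + 1)) := by
    by_contra hcon
    push Not at hcon
    choose f hf1 hf2 using hcon
    have hmono : ∀ j k : Fin d, j < k → f j ≠ f k := by
      intro j k hjk h
      have e1 := hf2 j
      have e2 := hf1 k
      rw [h] at e1
      have : T ^ ((j : ℕ) + 1) ≤ T ^ (k : ℕ) := pow_le_pow_right₀ hT.le hjk
      linarith
    have hinj : Function.Injective f := by
      intro j k h
      rcases lt_trichotomy j k with h1 | h1 | h1
      · exact absurd h (hmono _ _ h1)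
      · exact h1
      · exact absurd h.symm (hmono _ _ h1)
    obtain ⟨j, hj⟩ := (Finite.injective_iff_surjective.1 hinj) i0
    have e1 := hf2 j
    rw [hj, hi0] at e1
    have : T ^ ((j : ℕ) + 1) ≤ T ^ d := pow_le_pow_right₀ hT.le j.2
    linarith
  obtain ⟨j, hj⟩ := this
  refine ⟨j, Finset.univ.filter fun i => T ^ ((j : ℕ) + 1) ≤ y i, ⟨i0, ?_⟩, ?_, ?_, ?_⟩
  · simp only [Finset.mem_filter, Finset.mem_univ, true_and]
    rw [hi0]; exact pow_le_pow_right₀ hT.le j.2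
  · by_contra hne
    rw [Finset.not_nonempty_iff_eq_empty, Finset.compl_eq_empty_iff] at hne
    have h1 : ∀ i, T ^ ((j : ℕ) + 1) ≤ y i := fun i => by
      have : i ∈ Finset.univ.filter fun i => T ^ ((j : ℕ) + 1) ≤ y i := by rw [hne]; simp
      simpa using this
    have h2 : ∏ i : Fin d, T ^ ((j : ℕ) + 1) ≤ ∏ i, y i :=
      Finset.prod_le_prod (fun i _ => by positivity) (fun i _ => h1 i)
    rw [hp, Finset.prod_const, Finset.card_univ, Fintype.card_fin, ← pow_mul] at h2
    have h3 : 1 < T ^ (((j : ℕ) + 1) * d) := one_lt_pow₀ hT (by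
      have := i0.2
      exact Nat.mul_ne_zero (by lia) (by lia))
    linarith
  · intro i hi; simpa using hi
  · intro i hi
    simp only [Finset.mem_compl, Finset.mem_filter, Finset.mem_univ, true_and, not_le] at hi
    have := hj i
    by_contra h
    exact this ⟨not_le.1 h, hi⟩

lemma ultra_const {α : Type*} [Finite α] (𝒰 : Ultrafilter ℕ) (f : ℕ → α) :
    ∃ c, ∀ᶠ k in (𝒰 : Filter ℕ), f k = c := by
  by_contra hcon
  push Not at hcon
  have : ∀ᶠ k in (𝒰 : Filter ℕ), ∀ c, f k ≠ c := by
    rw [Filter.eventually_all]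
    intro c
    exact hcon c
  obtain ⟨k, hk⟩ := this.exists
  exact hk _ rfl

lemma two_sided {K : Type*} [Field K] {d : ℕ} (W : Submodule K (Matrix (Fin d) (Fin d) K))
    (h0 : W ≠ ⊥) (hl : ∀ y, ∀ x ∈ W, y * x ∈ W) (hr : ∀ x ∈ W, ∀ y, x * y ∈ W) : W = ⊤ := by
  obtain ⟨x, hx, hx0⟩ := Submodule.exists_mem_ne_zero_of_ne_bot h0
  have : ∃ p q, x p q ≠ 0 := by
    by_contra h
    push Not at h
    exact hx0 (by ext i j; exact h i j)
  obtain ⟨p, q, hpq⟩ := this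
  rw [Submodule.eq_top_iff']
  intro y
  rw [Matrix.matrix_eq_sum_single y]
  refine Submodule.sum_mem _ fun i _ => Submodule.sum_mem _ fun j _ => ?_
  have h1 := hr _ (hl (Matrix.single i p (1 : K)) x hx) (Matrix.single q j (1 : K))
  have h2 : Matrix.single i p (1 : K) * x * Matrix.single q j (1 : K) = Matrix.single i j (x p q) := by
    ext i' j'
    rw [Matrix.mul_apply, Finset.sum_eq_single q]
    · rw [Matrix.mul_apply, Finset.sum_eq_single p]
      · simp only [Matrix.single_apply]
        by_cases hi : i = i' <;> by_cases hj : j = j' <;> simp [hi, hj]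
      · intro l _ hl; simp [Matrix.single_apply, hl.symm]
      · simp
    · intro l _ hl; simp [Matrix.single_apply, hl.symm]
    · simp
  rw [h2] at h1
  have h3 := W.smul_mem (y i j * (x p q)⁻¹) h1
  rwa [Matrix.smul_single, smul_eq_mul, mul_assoc, inv_mul_cancel₀ hpq, mul_one] at h3

lemma comap_closure {K : Type*} [Field K] {d : ℕ} {S : Set (GL (Fin d) K)}
    (hsym : ∀ s ∈ S, s⁻¹ ∈ S)
    (F : Set (Submodule K (Matrix (Fin d) (Fin d) K)))
    (hF : ∀ W ∈ F, ∀ s ∈ S, W.comap (LinearMap.mulLeft K (toM s)) ∈ F) :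
    ∀ W ∈ F, ∀ s ∈ Subgroup.closure S, W.comap (LinearMap.mulLeft K (toM s)) ∈ F := by
  intro W hW s hs
  obtain ⟨n, hn⟩ := mem_closure_pow hsym hs
  clear hs
  induction n generalizing W s with
  | zero =>
    have : s = 1 := by simpa using hn
    subst this
    convert hW
    ext x; simp [toM]
  | succ n ih =>
    rw [pow_succ] at hn
    obtain ⟨x, hx, y, hy, rfl⟩ := Set.mem_mul.1 hn
    have := hF _ (ih W hW x hx) y hy
    convert this using 1
    ext z; simp [toM, mul_assoc]

set_option maxHeartbeats 1000000 in
theorem propA {K : Type u} [Field K] [IsAlgClosed K] {d : ℕ} {V : Type*} [Fintype V]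
    (a : V → AbsoluteValue K ℝ) (O : Subring K)
    (hprod : ∀ x ∈ O, x ≠ 0 → 1 ≤ ∏ u, a u x)
    (Γ : Subgroup (GL (Fin d) K)) (hdet : ∀ γ ∈ Γ, (toM γ).det = 1)
    (H1 : Submodule.span K (toM '' (Γ : Set (GL (Fin d) K))) = ⊤) (H2 : SI Γ)
    (htr : ∀ γ ∈ Γ, (toM γ).trace ∈ O) (δ : ℝ) (hδ : 0 < δ) (N : ℕ) (hN : 3 * (d * d) + 1 ≤ N) :
    ∃ ε : ℝ, 0 < ε ∧ ∀ S : Set (GL (Fin d) K), S.Finite → 1 ∈ S → (∀ s ∈ S, s⁻¹ ∈ S) →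
      Subgroup.closure S = Γ →
      (∃ v, ∃ w ∈ S ^ N, ∃ x, (toM w).charpoly.IsRoot x ∧ 1 + δ ≤ a v x) →
      ∀ m : FAM (Matrix (Fin d) (Fin d) K), m.m {0} = 0 → ¬ ∀ s ∈ S, AI m (toM s) ε := by
  classical
  by_contra hcon
  have hcon' : ∀ ε : ℝ, 0 < ε → ∃ S : Set (GL (Fin d) K), S.Finite ∧ 1 ∈ S ∧ (∀ s ∈ S, s⁻¹ ∈ S) ∧
      Subgroup.closure S = Γ ∧
      (∃ v, ∃ w ∈ S ^ N, ∃ x, (toM w).charpoly.IsRoot x ∧ 1 + δ ≤ a v x) ∧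
      ∃ m : FAM (Matrix (Fin d) (Fin d) K), m.m {0} = 0 ∧ ∀ s ∈ S, AI m (toM s) ε := by
    intro ε hε
    by_contra h
    apply hcon
    refine ⟨ε, hε, fun S e1 e2 e3 e4 e5 m hm hs => h ⟨S, e1, e2, e3, e4, e5, m, hm, hs⟩⟩
  choose S0 hfin h1 hsym hcl hbig m hm hAI using fun k : ℕ => hcon' (1 / ((k : ℝ) + 1) ^ 2) (by positivity)
  choose v0 w0 hw0 x0 hx0 hδ0 using hbig
  let S : ℕ → Set (GL (Fin d) K) := fun k => S0 k ^ (k + 1)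
  have hS1 : ∀ k, 1 ∈ S k := fun k => Set.one_mem_pow (h1 k)
  have hSsym : ∀ k, ∀ s ∈ S k, s⁻¹ ∈ S k := fun k s hs => inv_mem_pow (hsym k) hs
  have hSfin : ∀ k, (S k).Finite := fun k => finite_pow (hfin k) _
  have hScl : ∀ k, Subgroup.closure (S k) = Γ := by
    intro k
    apply le_antisymm
    · rw [Subgroup.closure_le]
      intro s hs
      rw [← hcl k]
      have : ∀ n, S0 k ^ n ⊆ (Subgroup.closure (S0 k) : Set (GL (Fin d) K)) := by
        intro n
        induction n with
        | zero => simpa using Subgroup.one_mem _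
        | succ n ih =>
          rw [pow_succ]
          rintro _ ⟨x, hx, y, hy, rfl⟩
          exact Subgroup.mul_mem _ (ih hx) (Subgroup.subset_closure hy)
      exact this _ hs
    · rw [← hcl k]
      apply Subgroup.closure_mono
      have := Set.pow_subset_pow_right (h1 k) (show 1 ≤ k + 1 by lia)
      rwa [pow_one] at this
  have hSΓ : ∀ k n, S k ^ n ⊆ (Γ : Set (GL (Fin d) K)) := by
    intro k n
    induction n with
    | zero => simpa using Subgroup.one_mem _
    | succ n ih =>
      rw [pow_succ]
      rintro _ ⟨x, hx, y, hy, rfl⟩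
      refine Subgroup.mul_mem _ (ih hx) ?_
      rw [← hScl k]; exact Subgroup.subset_closure hy
  let Q : ℕ → Set (V × K) := fun k => {p | ∃ w ∈ S k ^ N, (toM w).charpoly.IsRoot p.2}
  have hQfin : ∀ k, (Q k).Finite := by
    intro k
    have : Q k ⊆ ⋃ w ∈ S k ^ N, (Set.univ : Set V) ×ˢ {x | (toM w).charpoly.IsRoot x} := by
      rintro p ⟨w, hw, hp⟩
      simp only [Set.mem_iUnion]
      exact ⟨w, hw, trivial, hp⟩
    refine Set.Finite.subset ((finite_pow (hSfin k) N).biUnion fun w _ => ?_) this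
    exact Set.finite_univ.prod (Polynomial.finite_setOf_isRoot (charpoly_monic _).ne_zero)
  have hQ0 : ∀ k, (v0 k, x0 k ^ (k + 1)) ∈ Q k := by
    intro k
    refine ⟨w0 k ^ (k + 1), ?_, ?_⟩
    · change w0 k ^ (k + 1) ∈ (S0 k ^ (k + 1)) ^ N
      rw [← pow_mul, mul_comm, pow_mul]
      exact Set.pow_mem_pow (hw0 k)
    · have := isRoot_pow _ _ (hx0 k) (k + 1)
      simpa [toM] using this
  choose p hpQ hpmax using fun k => Set.exists_max_image (Q k) (fun p => a p.1 p.2) (hQfin k) ⟨_, hQ0 k⟩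
  choose w hw hwroot using hpQ
  let t : ℕ → ℝ := fun k => a (p k).1 (p k).2
  have ht : ∀ k, (1 + δ) ^ (k + 1) ≤ t k := by
    intro k
    refine le_trans ?_ (hpmax k _ (hQ0 k))
    simp only [map_pow]
    exact pow_le_pow_left₀ (by linarith) (hδ0 k) _
  have htlim : ∀ R : ℝ, ∀ᶠ k in Filter.atTop, R ≤ t k := by
    intro R
    have := (tendsto_pow_atTop_atTop_of_one_lt (show 1 < 1 + δ by linarith)).comp (Filter.tendsto_add_atTop_nat 1)
    filter_upwards [this.eventually_ge_atTop R] with k hk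
    exact le_trans hk (ht k)
  have ht1 : ∀ k, 1 < t k := fun k => lt_of_lt_of_le (one_lt_pow₀ (by linarith) (by lia)) (ht k)
  choose r hr hrtr hrdet using fun w : Matrix (Fin d) (Fin d) K => eig_exists w
  have hroot : ∀ w x, w.charpoly.IsRoot x ↔ ∃ i, r w i = x := by
    intro w x
    rw [hr, Polynomial.IsRoot, Polynomial.eval_prod, Finset.prod_eq_zero_iff]
    simp only [Finset.mem_univ, true_and, Polynomial.eval_sub, Polynomial.eval_X, Polynomial.eval_C, sub_eq_zero]
    exact ⟨fun ⟨i, h⟩ => ⟨i, h.symm⟩, fun ⟨i, h⟩ => ⟨i, h.symm⟩⟩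
  choose i0 hi0 using fun k => (hroot _ _).1 (hwroot k)
  have hd : d ≠ 0 := by have := (i0 0).2; lia
  let T : ℕ → ℝ := fun k => t k ^ ((d : ℝ)⁻¹)
  have hTd : ∀ k, T k ^ d = t k := fun k => Real.rpow_inv_natCast_pow (ht1 k |>.le |> le_trans zero_le_one) hd
  have hT0 : ∀ k, 0 ≤ T k := fun k => Real.rpow_nonneg (ht1 k |>.le |> le_trans zero_le_one) _
  have hT1 : ∀ k, 1 < T k := by
    intro k
    by_contra h
    have := pow_le_one₀ (n := d) (hT0 k) (not_lt.1 h)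
    rw [hTd] at this
    linarith [ht1 k]
  have hTlim : ∀ R : ℝ, ∀ᶠ k in Filter.atTop, R ≤ T k := by
    intro R
    filter_upwards [htlim (|R| ^ d)] with k hk
    rw [← hTd] at hk
    exact le_trans (le_abs_self R) (le_of_pow_le_pow_left₀ hd (hT0 k) hk)
  let 𝒰 : Ultrafilter ℕ := Filter.hyperfilter ℕ
  have h𝒰 : (𝒰 : Filter ℕ) ≤ Filter.atTop := Nat.hyperfilter_le_atTop
  choose j I hI0 hI1 hI hJ using fun k => gap_pigeon (fun i => a (p k).1 (r (toM (w k)) i)) (T k) (hT1 k) (i0 k)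
    (by rw [hTd, hi0]) (fun i => (a _).nonneg _) (by
      rw [← map_prod, ← hrdet, hdet _ (hSΓ k N (hw k)), map_one])
  obtain ⟨⟨v, j1, I1⟩, hc⟩ := ultra_const 𝒰 (fun k => ((p k).1, j k, I k))
  have hc1 : ∀ᶠ k in (𝒰 : Filter ℕ), (p k).1 = v ∧ j k = j1 ∧ I k = I1 := by
    filter_upwards [hc] with k hk
    simpa using hk
  have hbas : ∀ k, ∃ b : Module.Basis (Fin d × Fin d) K (Matrix (Fin d) (Fin d) K),
      ∀ i, b i ∈ toM '' (S k ^ (d * d)) := by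
    intro k
    exact exists_basis_mem (span_pow_top (by lia) (S k) (hS1 k) (hSsym k) (by rw [hScl, H1]))
  choose b hb using hbas
  obtain ⟨k1, hk1⟩ := hc1.exists
  obtain ⟨k, F, hFfin, hFne, hF⟩ := seqA a v O hprod 𝒰 S hS1 hSsym m hm (fun k => ((k + 1 : ℕ) : ℝ) * (1 / ((k : ℝ) + 1) ^ 2))
    (by
      refine Filter.Tendsto.mono_left ?_ h𝒰
      refine (tendsto_one_div_add_atTop_nhds_zero_nat (𝕜 := ℝ)).congr fun k => ?_
      push_cast
      field_simp)
    (fun k s hs => AI.pow (hAI k) (k + 1) s hs) T (fun R => h𝒰 (hTlim R)) N hN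
    (fun k s hs => htr s (hSΓ k N hs)) (d + 1) (by
      filter_upwards [h𝒰 (hTlim d)] with k hk s hs u
      rw [hrtr]
      have e1 : ∀ i, a u (r (toM s) i) ≤ T k ^ d := by
        intro i
        rw [hTd]
        exact hpmax k (u, r (toM s) i) ⟨s, hs, (hroot _ _).2 ⟨i, rfl⟩⟩
      calc a u (∑ i, r (toM s) i) ≤ ∑ i, a u (r (toM s) i) := (a u).sum_le _ _
        _ ≤ ∑ i : Fin d, T k ^ d := Finset.sum_le_sum fun i _ => e1 i
        _ = d * T k ^ d := by simp
        _ ≤ T k * T k ^ d := by gcongr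
        _ = T k ^ (d + 1) := by ring)
    b hb w hw (fun k => r (toM (w k))) (fun k => hr _) j1 I1
    (by rw [← hk1.2.2]; exact hI0 k1) (by rw [← hk1.2.2]; exact hI1 k1)
    (by
      filter_upwards [hc1] with k ⟨e1, e2, e3⟩
      subst e1 e2 e3
      exact hI k)
    (by
      filter_upwards [hc1] with k ⟨e1, e2, e3⟩
      subst e1 e2 e3
      exact hJ k)
  obtain ⟨W, hW⟩ := hFne
  obtain ⟨e1, e2, e3, -⟩ := hF W hW
  refine e2 (two_sided W e1 (H2 F hFfin ?_ W hW) e3)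
  rw [← hScl k]
  exact comap_closure (hSsym k) F (fun W hW => (hF W hW).2.2.2)

end Part8

section Part9

universe u

/-- place system reducing `O` to `O'` -/
def StepSys {K : Type*} [Field K] (O O' : Subring K) : Prop :=
  ∀ B : ℝ, ∃ (V : ℕ) (a : Fin V → AbsoluteValue K ℝ), (∀ x ∈ O, x ≠ 0 → 1 ≤ ∏ v, a v x) ∧
    (∀ x ∈ O, (∀ v, a v x ≤ B) → x ∈ O') ∧ (∀ x ∈ O', ∀ v, a v x ≤ 1)

/-- place system with finiteness -/
def BaseSys {K : Type*} [Field K] (O : Subring K) : Prop :=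
  ∃ (V : ℕ) (a : Fin V → AbsoluteValue K ℝ), (∀ x ∈ O, x ≠ 0 → 1 ≤ ∏ v, a v x) ∧
    ∀ B : ℝ, {x | x ∈ O ∧ ∀ v, a v x ≤ B}.Finite

/-- uniform absence of almost invariant measures -/
def UNA {K : Type*} [Field K] {d : ℕ} (Γ : Subgroup (GL (Fin d) K)) : Prop :=
  ∃ ε : ℝ, 0 < ε ∧ ∀ S : Set (GL (Fin d) K), S.Finite → 1 ∈ S → (∀ s ∈ S, s⁻¹ ∈ S) →
      Subgroup.closure S = Γ →
      ∀ m : FAM (Matrix (Fin d) (Fin d) K), m.m {0} = 0 → ¬ ∀ s ∈ S, AI m (toM s) ε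

section Main
variable {K : Type u} [Field K] {d : ℕ}

lemma pow_subset_subgroup {G : Type*} [Group G] {S : Set G} {Γ : Subgroup G} (h : Subgroup.closure S = Γ)
    (n : ℕ) : S ^ n ⊆ (Γ : Set G) := by
  induction n with
  | zero => simp
  | succ n ih =>
    rw [pow_succ]
    rintro _ ⟨x, hx, y, hy, rfl⟩
    refine Subgroup.mul_mem _ (ih hx) ?_
    rw [← h]; exact Subgroup.subset_closure hy

lemma det_mem_subring (O : Subring K) {ι : Type*} [Fintype ι] [DecidableEq ι] (A : Matrix ι ι K)
    (h : ∀ i j, A i j ∈ O) : A.det ∈ O := by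
  rw [Matrix.det_apply]
  refine Subring.sum_mem _ fun σ _ => ?_
  rw [Units.smul_def]
  exact Subring.zsmul_mem _ (Subring.prod_mem _ fun i _ => h _ _) _

lemma adj_mem_subring (O : Subring K) {ι : Type*} [Fintype ι] [DecidableEq ι] (A : Matrix ι ι K)
    (h : ∀ i j, A i j ∈ O) (i j : ι) : A.adjugate i j ∈ O := by
  rw [Matrix.adjugate_apply]
  refine det_mem_subring O _ fun p q => ?_
  rw [Matrix.updateRow_apply]
  split_ifs
  · rw [Pi.single_apply]; split_ifs
    · exact Subring.one_mem _
    · exact Subring.zero_mem _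
  · exact h _ _

lemma mul_mem_subring (O : Subring K) {ι : Type*} [Fintype ι] [DecidableEq ι] (A B : Matrix ι ι K)
    (h : ∀ i j, A i j ∈ O) (h' : ∀ i j, B i j ∈ O) (i j : ι) : (A * B) i j ∈ O := by
  rw [Matrix.mul_apply]
  exact Subring.sum_mem _ fun p _ => Subring.mul_mem _ (h _ _) (h' _ _)

/-- data attached to a generating set: a basis of short words -/
lemma words {S : Set (GL (Fin d) K)} {Γ : Subgroup (GL (Fin d) K)} (hd : 1 ≤ d)
    (h1 : 1 ∈ S) (hsym : ∀ s ∈ S, s⁻¹ ∈ S) (hcl : Subgroup.closure S = Γ)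
    (H1 : Submodule.span K (toM '' (Γ : Set (GL (Fin d) K))) = ⊤) (N : ℕ) (hN : 3 * (d * d) + 1 ≤ N)
    (X : Set K) (hX : ∀ s ∈ S ^ N, (toM s).trace ∈ X) :
    ∃ b : Module.Basis (Fin d × Fin d) K (Matrix (Fin d) (Fin d) K),
      (∀ l, (b l).trace ∈ X) ∧ (∀ i j, tgram b i j ∈ X) ∧
      ∀ s ∈ S, ∃ M : Matrix (Fin d × Fin d) (Fin d × Fin d) K, (∀ i j, M i j ∈ X) ∧
        lrep b (toM s) = (tgram b)⁻¹ * M := by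
  obtain ⟨b, hb⟩ := exists_basis_mem (span_pow_top hd S h1 hsym (by rw [hcl, H1]))
  choose β hβ hβb using hb
  have hup : ∀ {p : ℕ}, p ≤ N → S ^ p ⊆ S ^ N := fun hp => Set.pow_subset_pow_right h1 hp
  refine ⟨b, fun l => ?_, fun i j => ?_, fun s hs => ?_⟩
  · rw [← hβb]
    exact hX _ (hup (by lia) (hβ l))
  · rw [tgram, Matrix.of_apply, ← hβb, ← hβb]
    refine hX (β i * β j) (hup (p := d * d + d * d) (by lia) ?_)
    rw [pow_add]; exact Set.mul_mem_mul (hβ i) (hβ j)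
  · refine ⟨_, fun i j => ?_, by rw [lrep_apply]; exact tgram_toMatrix b _⟩
    rw [Matrix.of_apply, LinearMap.mulLeft_apply, ← hβb, ← hβb]
    refine hX (β i * (s * β j)) (hup (p := d * d + (1 + d * d)) (by lia) ?_)
    rw [pow_add, pow_add, pow_one]
    exact Set.mul_mem_mul (hβ i) (Set.mul_mem_mul hs (hβ j))

lemma trace_le [IsAlgClosed K] (a : AbsoluteValue K ℝ) (w : Matrix (Fin d) (Fin d) K) (R : ℝ)
    (h : ∀ x, w.charpoly.IsRoot x → a x ≤ R) : a w.trace ≤ d * R := by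
  obtain ⟨r, hr, htr, -⟩ := eig_exists w
  rw [htr]
  calc a (∑ i, r i) ≤ ∑ i, a (r i) := a.sum_le _ _
    _ ≤ ∑ i : Fin d, R := Finset.sum_le_sum fun i _ => h _ (by
        rw [hr, Polynomial.IsRoot, Polynomial.eval_prod]
        exact Finset.prod_eq_zero (Finset.mem_univ i) (by simp))
    _ = d * R := by simp

theorem step_main [IsAlgClosed K] (hd : 1 ≤ d) (O O' : Subring K) (hsys : StepSys O O')
    (Γ : Subgroup (GL (Fin d) K)) (hdet : ∀ γ ∈ Γ, (toM γ).det = 1)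
    (H1 : Submodule.span K (toM '' (Γ : Set (GL (Fin d) K))) = ⊤) (H2 : SI Γ)
    (htr : ∀ γ ∈ Γ, (toM γ).trace ∈ O) : UNA Γ ∨ ∀ γ ∈ Γ, (toM γ).trace ∈ O' := by
  have hd' : (1 : ℝ) ≤ d := by exact_mod_cast hd
  obtain ⟨V, a, ha1, ha2, ha3⟩ := hsys (d * 2)
  obtain ⟨ε, hε, h⟩ := propA a O ha1 Γ hdet H1 H2 htr 1 one_pos (3 * (d * d) + 1) le_rfl
  by_cases hall : ∀ S : Set (GL (Fin d) K), S.Finite → 1 ∈ S → (∀ s ∈ S, s⁻¹ ∈ S) →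
      Subgroup.closure S = Γ → (∃ v, ∃ w ∈ S ^ (3 * (d * d) + 1), ∃ x, (toM w).charpoly.IsRoot x ∧ 1 + 1 ≤ a v x)
  · left
    exact ⟨ε, hε, fun S e1 e2 e3 e4 => h S e1 e2 e3 e4 (hall S e1 e2 e3 e4)⟩
  right
  push Not at hall
  obtain ⟨S, -, h1, hsym, hcl, hsmall⟩ := hall
  have hX : ∀ s ∈ S ^ (3 * (d * d) + 1), (toM s).trace ∈ (O' : Set K) := by
    intro s hs
    refine ha2 _ (htr _ (pow_subset_subgroup hcl _ hs)) fun v => trace_le _ _ _ fun x hx => ?_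
    have := hsmall v s hs x hx
    linarith
  obtain ⟨b, hb1, hb2, hb3⟩ := words hd h1 hsym hcl H1 _ le_rfl {y | y ∈ O' ∧ y ∈ O}
    (fun s hs => ⟨hX s hs, htr _ (pow_subset_subgroup hcl _ hs)⟩)
  have hb2' : ∀ i j, tgram b i j ∈ O := fun i j => (hb2 i j).2
  replace hb1 : ∀ l, (b l).trace ∈ O' := fun l => (hb1 l).1
  replace hb2 : ∀ i j, tgram b i j ∈ O' := fun i j => (hb2 i j).1
  set D := (tgram b).det with hD
  have hD0 : D ≠ 0 := tgram_det b
  have hDO : D ∈ O' := det_mem_subring O' _ hb2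
  have hadj : D • (tgram b)⁻¹ = (tgram b).adjugate := by
    rw [Matrix.inv_def, smul_smul, Ring.mul_inverse_cancel _ (isUnit_iff_ne_zero.2 hD0), one_smul]
  have hs1 : ∀ s ∈ S, ∀ i j, (D • lrep b (toM s)) i j ∈ O' := by
    intro s hs
    obtain ⟨M, hM, hM2⟩ := hb3 s hs
    rw [hM2, ← smul_mul_assoc, hadj]
    exact mul_mem_subring O' _ _ (adj_mem_subring O' _ hb2) (fun i j => (hM i j).1)
  have hsn : ∀ n, ∀ s ∈ S ^ n, ∀ i j, (D ^ n • lrep b (toM s)) i j ∈ O' := by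
    intro n
    induction n with
    | zero =>
      intro s hs
      have : s = 1 := by simpa using hs
      subst this
      intro i j
      simp only [pow_zero, one_smul, toM, Units.val_one, map_one, Matrix.one_apply]
      split_ifs
      · exact Subring.one_mem _
      · exact Subring.zero_mem _
    | succ n ih =>
      intro s hs
      rw [pow_succ] at hs
      obtain ⟨x, hx, y, hy, rfl⟩ := Set.mem_mul.1 hs
      have e : D ^ (n + 1) • lrep b (toM (x * y)) = (D ^ n • lrep b (toM x)) * (D • lrep b (toM y)) := by
        rw [smul_mul_smul_comm, ← map_mul, pow_succ]; rfl
      rw [e]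
      exact mul_mem_subring O' _ _ (ih x hx) (hs1 y hy)
  have hone : ∀ i, D * b.equivFun 1 i ∈ O' := by
    have e : tgram b *ᵥ b.equivFun 1 = fun l => (b l).trace := by
      funext l
      rw [Matrix.mulVec, dotProduct]
      conv_rhs => rw [← mul_one (b l), ← b.sum_equivFun 1, Finset.mul_sum, trace_sum]
      refine Finset.sum_congr rfl fun i _ => ?_
      rw [mul_smul_comm, trace_smul, smul_eq_mul, mul_comm, tgram, Matrix.of_apply]
    have e2 : D • b.equivFun 1 = (tgram b).adjugate *ᵥ fun l => (b l).trace := by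
      rw [← e, Matrix.mulVec_mulVec, Matrix.adjugate_mul, smul_mulVec, one_mulVec]
    intro i
    have := congrFun e2 i
    rw [Pi.smul_apply, smul_eq_mul] at this
    rw [this, mulVec, dotProduct]
    exact Subring.sum_mem _ fun p _ => Subring.mul_mem _ (adj_mem_subring O' _ hb2 _ _) (hb1 _)
  have hDv : ∀ v, a v D = 1 := by
    intro v
    have e0 : 1 ≤ ∏ u, a u D := ha1 D (by
      rw [hD]
      exact det_mem_subring O _ hb2') hD0
    by_contra hne
    have hlt : a v D < 1 := lt_of_le_of_ne (ha3 D hDO v) hne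
    have e1 : ∏ u, a u D < 1 := by
      rw [← Finset.mul_prod_erase _ _ (Finset.mem_univ v)]
      have : ∏ u ∈ Finset.univ.erase v, a u D ≤ 1 :=
        Finset.prod_le_one (fun u _ => (a u).nonneg _) (fun u _ => ha3 D hDO u)
      have h0 : 0 ≤ ∏ u ∈ Finset.univ.erase v, a u D := Finset.prod_nonneg fun u _ => (a u).nonneg _
      nlinarith [(a v).nonneg D]
    linarith
  intro γ hγ
  rw [← hcl] at hγ
  obtain ⟨n, hn⟩ := mem_closure_pow hsym hγ
  rw [hcl] at hγ
  refine ha2 _ (htr γ hγ) fun v => ?_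
  have hc : D ^ (n + 1) * (toM γ).trace ∈ O' := by
    have e : D ^ (n + 1) • b.equivFun (toM γ) = (D ^ n • lrep b (toM γ)) *ᵥ (D • b.equivFun 1) := by
      rw [mulVec_smul, smul_mulVec, lrep_mulVec, mul_one, smul_smul, pow_succ']
    have e2 : (toM γ).trace = ∑ i, b.equivFun (toM γ) i * (b i).trace := by
      conv_lhs => rw [← b.sum_equivFun (toM γ), trace_sum]
      exact Finset.sum_congr rfl fun i _ => by rw [trace_smul, smul_eq_mul]
    rw [e2, Finset.mul_sum]
    refine Subring.sum_mem _ fun i _ => ?_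
    rw [← mul_assoc]
    refine Subring.mul_mem _ ?_ (hb1 i)
    have := congrFun e i
    rw [Pi.smul_apply, smul_eq_mul] at this
    rw [this, mulVec, dotProduct]
    exact Subring.sum_mem _ fun p _ => Subring.mul_mem _ (hsn n γ hn _ _) (hone p)
  have := ha3 _ hc v
  rw [map_mul, map_pow, hDv, one_pow, one_mul] at this
  linarith

lemma infinite_of_SI (hd : 2 ≤ d) (Γ : Subgroup (GL (Fin d) K)) (H2 : SI Γ) :
    ¬ (Γ : Set (GL (Fin d) K)).Finite := by
  intro hfin
  let P : GL (Fin d) K → Submodule K (Matrix (Fin d) (Fin d) K) := fun γ => Submodule.span K {toM γ}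
  have h := H2 (P '' Γ) (hfin.image _) (by
    rintro _ ⟨γ, hγ, rfl⟩ γ' hγ'
    refine ⟨γ'⁻¹ * γ, Γ.mul_mem (Γ.inv_mem hγ') hγ, ?_⟩
    ext x
    simp only [P, Submodule.mem_comap, Submodule.mem_span_singleton, LinearMap.mulLeft_apply]
    constructor
    · rintro ⟨c, rfl⟩
      refine ⟨c, ?_⟩
      rw [mul_smul_comm, toM, toM, toM, ← Units.val_mul, mul_inv_cancel_left]
    · rintro ⟨c, hc⟩
      refine ⟨c, ?_⟩
      have := congrArg (fun y => toM (γ'⁻¹) * y) hc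
      simp only [mul_smul_comm] at this
      rw [← mul_assoc] at this
      have e : toM γ'⁻¹ * toM γ' = 1 := by rw [toM, toM, ← Units.val_mul, inv_mul_cancel, Units.val_one]
      rw [e, one_mul] at this
      rw [← this]; rfl) (P 1) ⟨1, Γ.one_mem, rfl⟩
    (Matrix.single ⟨0, by lia⟩ ⟨0, by lia⟩ 1) 1 (by
      simp only [P, Submodule.mem_span_singleton]
      exact ⟨1, by simp [toM]⟩)
  simp only [P, Submodule.mem_span_singleton, mul_one] at h
  obtain ⟨c, hc⟩ := h
  have h0 := congrFun (congrFun hc ⟨0, by lia⟩) ⟨0, by lia⟩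
  have h1 := congrFun (congrFun hc ⟨1, by lia⟩) ⟨1, by lia⟩
  simp [toM, Matrix.single_apply] at h0 h1
  rw [h1] at h0
  exact zero_ne_one h0

theorem base_main [IsAlgClosed K] (hd : 2 ≤ d) (O : Subring K) (hsys : BaseSys O)
    (Γ : Subgroup (GL (Fin d) K)) (hdet : ∀ γ ∈ Γ, (toM γ).det = 1)
    (H1 : Submodule.span K (toM '' (Γ : Set (GL (Fin d) K))) = ⊤) (H2 : SI Γ)
    (htr : ∀ γ ∈ Γ, (toM γ).trace ∈ O) : UNA Γ := by
  classical
  have hd' : (1 : ℝ) ≤ d := by exact_mod_cast (show 1 ≤ d by lia)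
  obtain ⟨V, a, ha1, hafin⟩ := hsys
  set N := 3 * (d * d) + 1 with hN
  -- an element with a large eigenvalue
  obtain ⟨γ0, hγ0, v0, x0, hx0, hlarge⟩ : ∃ γ ∈ Γ, ∃ v x, (toM γ).charpoly.IsRoot x ∧ 1 < a v x := by
    by_contra hcon
    push Not at hcon
    apply infinite_of_SI hd Γ H2
    obtain ⟨b, hb⟩ := exists_basis_mem H1
    choose β hβ hβb using hb
    let X : Set K := {x | x ∈ O ∧ ∀ v, a v x ≤ d * 1}
    have hX : X.Finite := hafin _
    have hinj : Set.InjOn (fun γ : GL (Fin d) K => fun i => (toM (β i * γ)).trace) (Γ : Set (GL (Fin d) K)) := by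
      intro x _ y _ hxy
      apply Units.ext
      change toM x = toM y
      rw [Matrix.ext_iff_trace_mul_left]
      intro z
      rw [← b.sum_repr z, Finset.sum_mul, Finset.sum_mul, trace_sum, trace_sum]
      refine Finset.sum_congr rfl fun i _ => ?_
      rw [smul_mul_assoc, smul_mul_assoc, trace_smul, trace_smul]
      congr 1
      have := congrFun hxy i
      rw [← hβb]; exact this
    refine Set.Finite.of_finite_image ?_ hinj
    refine (Set.Finite.pi' fun _ : Fin d × Fin d => hX).subset ?_
    rintro _ ⟨γ, hγ, rfl⟩ i
    exact ⟨htr _ (Γ.mul_mem (hβ i) hγ), fun v => trace_le _ _ _ fun x hx => hcon _ (Γ.mul_mem (hβ i) hγ) v x hx⟩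
  let X : Set K := {x | x ∈ O ∧ ∀ v, a v x ≤ d * 2}
  have hX : X.Finite := hafin _
  let MX : Set (Matrix (Fin d × Fin d) (Fin d × Fin d) K) := {M | ∀ i j, M i j ∈ X}
  have hMX : MX.Finite := by
    have := Set.Finite.pi' fun _ : Fin d × Fin d => Set.Finite.pi' fun _ : Fin d × Fin d => hX
    exact this
  let 𝓜 : Set (Matrix (Fin d × Fin d) (Fin d × Fin d) K) := Set.image2 (fun G M => G⁻¹ * M) MX MX
  have h𝓜 : 𝓜.Finite := hMX.image2 _ hMX
  let P : Set (Matrix (Fin d × Fin d) (Fin d × Fin d) K) → ℕ → ℝ → Prop := fun Q ℓ δ =>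
    1 ≤ ℓ ∧ 0 < δ ∧ δ ≤ 1 ∧ ∃ w ∈ Q ^ ℓ, ∃ v, ∃ x ∈ spectrum K w, 1 + δ ≤ a v x
  have hc : ∀ Q : Set (Matrix (Fin d × Fin d) (Fin d × Fin d) K), ∃ ℓ δ, 1 ≤ ℓ ∧ 0 < δ ∧ δ ≤ 1 ∧
      ((∃ ℓ δ, P Q ℓ δ) → P Q ℓ δ) := by
    intro Q
    by_cases h : ∃ ℓ δ, P Q ℓ δ
    · obtain ⟨ℓ, δ, h⟩ := h
      exact ⟨ℓ, δ, h.1, h.2.1, h.2.2.1, fun _ => h⟩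
    · exact ⟨1, 1, le_rfl, one_pos, le_rfl, fun h' => absurd h' h⟩
  choose ℓ δ hℓ hδ hδ1 hP using hc
  let FQ := h𝓜.powerset.toFinset
  have hFQne : (insert ∅ FQ).Nonempty := ⟨∅, by simp⟩
  let L : ℕ := ∑ Q ∈ insert ∅ FQ, ℓ Q
  obtain ⟨Q0, hQ0, hmin⟩ := Finset.exists_min_image (insert ∅ FQ) δ hFQne
  have hL : ∀ Q ∈ FQ, ℓ Q ≤ L := fun Q hQ =>
    Finset.single_le_sum (f := ℓ) (fun _ _ => Nat.zero_le _) (Finset.mem_insert_of_mem hQ)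
  have hL1 : 1 ≤ L := le_trans (hℓ ∅) (Finset.single_le_sum (f := ℓ) (fun _ _ => Nat.zero_le _)
    (Finset.mem_insert_self _ _))
  obtain ⟨ε, hε, h⟩ := propA a O ha1 Γ hdet H1 H2 htr (δ Q0) (hδ Q0) (N * L) (by
    calc 3 * (d * d) + 1 = N * 1 := by rw [mul_one]
      _ ≤ N * L := Nat.mul_le_mul_left _ hL1)
  refine ⟨ε, hε, fun S e1 e2 e3 e4 => h S e1 e2 e3 e4 ?_⟩
  by_cases hbig : ∃ v, ∃ w ∈ S ^ N, ∃ x, (toM w).charpoly.IsRoot x ∧ 2 ≤ a v x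
  · obtain ⟨v, w, hw, x, hx, h2⟩ := hbig
    refine ⟨v, w, Set.pow_subset_pow_right e2 (Nat.le_mul_of_pos_right _ hL1) hw, x, hx, ?_⟩
    linarith [hδ1 Q0]
  push Not at hbig
  obtain ⟨b, hb1, hb2, hb3⟩ := words (show 1 ≤ d by lia) e2 e3 e4 H1 N le_rfl X (fun s hs =>
    ⟨htr _ (pow_subset_subgroup e4 _ hs), fun v => trace_le _ _ _ fun x hx => (hbig v s hs x hx).le⟩)
  let Lr : GL (Fin d) K →* Matrix (Fin d × Fin d) (Fin d × Fin d) K :=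
    (lrep b).toMonoidHom.comp (Units.coeHom _)
  have hLr : ∀ γ, Lr γ = lrep b (toM γ) := fun _ => rfl
  have hQ : Lr '' S ∈ FQ := by
    rw [Set.Finite.mem_toFinset]
    rintro _ ⟨s, hs, rfl⟩
    obtain ⟨M, hM, hM2⟩ := hb3 s hs
    exact ⟨tgram b, hb2, M, hM, hM2.symm⟩
  have hex : ∃ ℓ δ, P (Lr '' S) ℓ δ := by
    rw [← e4] at hγ0
    obtain ⟨n, hn⟩ := mem_closure_pow e3 hγ0
    refine ⟨n + 1, min 1 (a v0 x0 - 1), by lia, by simpa using hlarge, min_le_left _ _, Lr γ0, ?_, v0, x0, ?_, ?_⟩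
    · rw [← Set.image_pow]
      exact ⟨γ0, Set.pow_subset_pow_right e2 (Nat.le_succ n) hn, rfl⟩
    · rw [spectrum.mem_iff, Algebra.algebraMap_eq_smul_one, Matrix.isUnit_iff_isUnit_det, hLr, lrep_apply,
        eig_left_det b _ _ hx0]
      simp
    · have := min_le_right 1 (a v0 x0 - 1)
      linarith
  obtain ⟨-, -, -, w, hw, v, x, hx, hxa⟩ := hP _ hex
  rw [← Set.image_pow] at hw
  obtain ⟨γ, hγ, rfl⟩ := hw
  have hx' : x ∈ spectrum K (toM γ) := AlgHom.spectrum_apply_subset (lrep b) (toM γ) hx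
  rw [Matrix.mem_spectrum_iff_isRoot_charpoly] at hx'
  refine ⟨v, γ, Set.pow_subset_pow_right e2 ?_ hγ, x, hx', ?_⟩
  · exact le_trans (hL _ hQ) (Nat.le_mul_of_pos_left _ (by lia))
  · have := hmin _ (Finset.mem_insert_of_mem hQ)
    linarith

theorem main_una [IsAlgClosed K] (hd : 2 ≤ d) (O O' : Subring K) (hsys : StepSys O O') (hsys' : BaseSys O')
    (Γ : Subgroup (GL (Fin d) K)) (hdet : ∀ γ ∈ Γ, (toM γ).det = 1)
    (H1 : Submodule.span K (toM '' (Γ : Set (GL (Fin d) K))) = ⊤) (H2 : SI Γ)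
    (htr : ∀ γ ∈ Γ, (toM γ).trace ∈ O) : UNA Γ := by
  rcases step_main (by lia) O O' hsys Γ hdet H1 H2 htr with h | h
  · exact h
  · exact base_main hd O' hsys' Γ hdet H1 H2 h

end Main

end Part9

section Part10

section Main
variable {K : Type*} [Field K] {d : ℕ}

/-- the ring generated by the traces of a finitely generated group is contained in a finitely generated ring -/
theorem trace_fg {S : Set (GL (Fin d) K)} {Γ : Subgroup (GL (Fin d) K)} (hd : 1 ≤ d) (hfin : S.Finite)
    (h1 : 1 ∈ S) (hsym : ∀ s ∈ S, s⁻¹ ∈ S) (hcl : Subgroup.closure S = Γ)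
    (H1 : Submodule.span K (toM '' (Γ : Set (GL (Fin d) K))) = ⊤) :
    ∃ Y : Set K, Y.Finite ∧ (∀ F : Subfield K, (∀ γ ∈ Γ, (toM γ).trace ∈ F) → Y ⊆ F) ∧
      ∀ γ ∈ Γ, (toM γ).trace ∈ Subring.closure Y := by
  set T : Set K := (fun s => (toM s).trace) '' (S ^ (3 * (d * d) + 1)) with hT
  obtain ⟨b, hb1, hb2, hb3⟩ := words hd h1 hsym hcl H1 _ le_rfl T (fun s hs => ⟨s, hs, rfl⟩)
  set D := (tgram b).det with hD
  have hD0 : D ≠ 0 := tgram_det b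
  refine ⟨insert D⁻¹ T, ((finite_pow hfin _).image _).insert _, ?_, ?_⟩
  · intro F hF
    have hTF : ∀ x ∈ T, x ∈ F := by
      rintro _ ⟨s, hs, rfl⟩
      exact hF _ (pow_subset_subgroup hcl _ hs)
    rintro x (rfl | hx)
    · exact F.inv_mem (det_mem_subring F.toSubring _ fun i j => hTF _ (hb2 i j))
    · exact hTF x hx
  set O' := Subring.closure (insert D⁻¹ T) with hO'
  have hTO : ∀ x ∈ T, x ∈ O' := fun x hx => Subring.subset_closure (Set.mem_insert_of_mem _ hx)
  have hDO : D⁻¹ ∈ O' := Subring.subset_closure (Set.mem_insert _ _)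
  have hinv : ∀ i j, (tgram b)⁻¹ i j ∈ O' := by
    intro i j
    rw [Matrix.inv_def, Ring.inverse_eq_inv', Matrix.smul_apply, smul_eq_mul]
    exact O'.mul_mem hDO (adj_mem_subring O' _ (fun i j => hTO _ (hb2 i j)) _ _)
  have hs1 : ∀ s ∈ S, ∀ i j, (lrep b (toM s)) i j ∈ O' := by
    intro s hs
    obtain ⟨M, hM, hM2⟩ := hb3 s hs
    rw [hM2]
    exact mul_mem_subring O' _ _ hinv (fun i j => hTO _ (hM i j))
  have hsn : ∀ n, ∀ s ∈ S ^ n, ∀ i j, (lrep b (toM s)) i j ∈ O' := by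
    intro n
    induction n with
    | zero =>
      intro s hs
      have : s = 1 := by simpa using hs
      subst this
      intro i j
      simp only [toM, Units.val_one, map_one, Matrix.one_apply]
      split_ifs
      · exact Subring.one_mem _
      · exact Subring.zero_mem _
    | succ n ih =>
      intro s hs
      rw [pow_succ] at hs
      obtain ⟨x, hx, y, hy, rfl⟩ := Set.mem_mul.1 hs
      have e : lrep b (toM (x * y)) = (lrep b (toM x)) * (lrep b (toM y)) := by
        rw [← map_mul]; rfl
      rw [e]
      exact mul_mem_subring O' _ _ (ih x hx) (hs1 y hy)
  have hone : ∀ i, b.equivFun 1 i ∈ O' := by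
    have e : tgram b *ᵥ b.equivFun 1 = fun l => (b l).trace := by
      funext l
      rw [Matrix.mulVec, dotProduct]
      conv_rhs => rw [← mul_one (b l), ← b.sum_equivFun 1, Finset.mul_sum, trace_sum]
      refine Finset.sum_congr rfl fun i _ => ?_
      rw [mul_smul_comm, trace_smul, smul_eq_mul, mul_comm, tgram, Matrix.of_apply]
    have e2 : b.equivFun 1 = (tgram b)⁻¹ *ᵥ fun l => (b l).trace := by
      rw [← e, Matrix.mulVec_mulVec, Matrix.nonsing_inv_mul _ (isUnit_iff_ne_zero.2 hD0), one_mulVec]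
    intro i
    rw [e2, mulVec, dotProduct]
    exact Subring.sum_mem _ fun p _ => Subring.mul_mem _ (hinv _ _) (hTO _ (hb1 _))
  intro γ hγ
  rw [← hcl] at hγ
  obtain ⟨n, hn⟩ := mem_closure_pow hsym hγ
  have e : b.equivFun (toM γ) = (lrep b (toM γ)) *ᵥ (b.equivFun 1) := by
    rw [lrep_mulVec, mul_one]
  have e2 : (toM γ).trace = ∑ i, b.equivFun (toM γ) i * (b i).trace := by
    conv_lhs => rw [← b.sum_equivFun (toM γ), trace_sum]
    exact Finset.sum_congr rfl fun i _ => by rw [trace_smul, smul_eq_mul]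
  rw [e2]
  refine Subring.sum_mem _ fun i _ => ?_
  refine Subring.mul_mem _ ?_ (hTO _ (hb1 i))
  rw [e, mulVec, dotProduct]
  exact Subring.sum_mem _ fun p _ => Subring.mul_mem _ (hsn n γ hn _ _) (hone p)

end Main

end Part10

section Part11

/-- extension of nonarchimedean absolute values to algebraic extensions -/
theorem abs_extend {k K : Type*} [Field k] [Field K] [Algebra k K] [Algebra.IsAlgebraic k K]
    (v : AbsoluteValue k ℝ) (hv : ∀ x y, v (x + y) ≤ max (v x) (v y)) (hnt : ∃ x, 1 < v x) :
    ∃ a : AbsoluteValue K ℝ, (∀ x y, a (x + y) ≤ max (a x) (a y)) ∧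
      ∀ x, a (algebraMap k K x) = v x := by
  let C := UniformSpace.Completion (WithAbs v)
  have hult : ∀ x y : C, ‖x + y‖ ≤ max ‖x‖ ‖y‖ := by
    intro x y
    refine UniformSpace.Completion.induction_on₂ x y ?_ ?_
    · exact isClosed_le (by fun_prop) (by fun_prop)
    · intro a b
      rw [← UniformSpace.Completion.coe_add, UniformSpace.Completion.norm_coe, UniformSpace.Completion.norm_coe,
        UniformSpace.Completion.norm_coe]
      exact hv _ _
  haveI : IsUltrametricDist C := IsUltrametricDist.isUltrametricDist_of_forall_norm_add_le_max_norm hult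
  letI : NontriviallyNormedField C := { (inferInstance : NormedField C) with
    non_trivial := by
      obtain ⟨x, hx⟩ := hnt
      refine ⟨((WithAbs.toAbs v x : WithAbs v) : C), ?_⟩
      rw [UniformSpace.Completion.norm_coe]
      exact hx }
  let E := AlgebraicClosure C
  let φ : k →+* E := (algebraMap C E).comp ((UniformSpace.Completion.coeRingHom : WithAbs v →+* C).comp
    (WithAbs.equiv v).symm.toRingHom)
  letI : Algebra k E := φ.toAlgebra
  let σ : K →ₐ[k] E := IsAlgClosed.lift
  let N := spectralMulAlgNorm C E
  refine ⟨⟨⟨fun x => N (σ x), fun x y => by rw [map_mul, map_mul]⟩, fun x => apply_nonneg N _, fun x => ?_, fun x y => ?_⟩, ?_, ?_⟩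
  · rw [map_eq_zero_iff_eq_zero, map_eq_zero]
  · change N (σ (x + y)) ≤ N (σ x) + N (σ y)
    rw [map_add]; exact map_add_le_add N _ _
  · intro x y
    change N (σ (x + y)) ≤ max (N (σ x)) (N (σ y))
    rw [map_add]
    exact isNonarchimedean_spectralNorm _ _
  · intro x
    change N (σ (algebraMap k K x)) = v x
    rw [AlgHom.commutes]
    change spectralNorm C E (algebraMap C E _) = _
    rw [spectralNorm_extends]
    exact UniformSpace.Completion.norm_coe _

end Part11

section Part12

open Classical in
/-- degree valuation -/
noncomputable def degVal (s : ℕ) (k0 : Type*) [Field k0] (b : NNReal) (hb : 1 ≤ b) :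
    Valuation (MvPolynomial (Fin s) k0) NNReal where
  toFun f := if f = 0 then 0 else b ^ f.totalDegree
  map_zero' := by simp
  map_one' := by simp
  map_mul' f g := by
    by_cases hf : f = 0
    · simp [hf]
    by_cases hg : g = 0
    · simp [hg]
    simp only [hf, hg, mul_eq_zero, or_self, if_false]
    rw [MvPolynomial.totalDegree_mul_of_isDomain hf hg, pow_add]
  map_add_le_max' f g := by
    by_cases hf : f = 0
    · simp [hf]
    by_cases hg : g = 0
    · simp [hg]
    by_cases hfg : f + g = 0
    · simp [hfg]
    simp only [hf, hg, hfg, if_false]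
    rw [le_max_iff]
    have := MvPolynomial.totalDegree_add f g
    rcases le_max_iff.1 this with h | h
    · left; exact pow_le_pow_right₀ hb h
    · right; exact pow_le_pow_right₀ hb h

/-- the degree absolute value on the fraction field -/
theorem degAbs_exists (s : ℕ) (k0 : Type*) [Field k0] (b : NNReal) (hb : 1 ≤ b) :
    ∃ v : AbsoluteValue (FractionRing (MvPolynomial (Fin s) k0)) ℝ, (∀ x y, v (x + y) ≤ max (v x) (v y)) ∧
      ∀ f : MvPolynomial (Fin s) k0, f ≠ 0 → v (algebraMap _ _ f) = (b : ℝ) ^ f.totalDegree := by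
  let w := degVal s k0 b hb
  have hS : nonZeroDivisors (MvPolynomial (Fin s) k0) ≤ w.supp.primeCompl := by
    intro f hf
    have : f ≠ 0 := nonZeroDivisors.ne_zero hf
    change ¬ (w f = 0)
    simp only [w, degVal, Valuation.coe_mk, MonoidWithZeroHom.coe_mk, ZeroHom.coe_mk, this, if_false]
    positivity
  let u := w.extendToLocalization hS (FractionRing (MvPolynomial (Fin s) k0))
  refine ⟨⟨⟨fun x => (u x : ℝ), fun x y => by rw [map_mul]; rfl⟩, fun x => (u x).2, fun x => ?_, fun x y => ?_⟩, ?_, ?_⟩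
  · change (u x : ℝ) = 0 ↔ _
    rw [NNReal.coe_eq_zero, map_eq_zero]
  · change (u (x + y) : ℝ) ≤ u x + u y
    have h1 := u.map_add x y
    have : u (x + y) ≤ u x + u y := h1.trans (max_le (by simp) (by simp))
    exact_mod_cast this
  · intro x y
    change (u (x + y) : ℝ) ≤ max (u x : ℝ) (u y)
    exact_mod_cast u.map_add x y
  · intro f hf
    change ((u (algebraMap _ _ f) : NNReal) : ℝ) = _
    rw [Valuation.extendToLocalization_apply_map_apply]
    simp [w, degVal, hf]

end Part12

section Part13

/-- coefficients are bounded by roots -/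
lemma coeff_le_roots {K : Type*} [Field K] (a : AbsoluteValue K ℝ) (B : ℝ) (hB : 0 ≤ B) (s : Multiset K)
    (h : ∀ x ∈ s, a x ≤ B) (i : ℕ) :
    a ((s.map fun r => Polynomial.X - Polynomial.C r).prod.coeff i) ≤ (1 + B) ^ s.card := by
  induction s using Multiset.induction_on generalizing i with
  | empty =>
    simp only [Multiset.map_zero, Multiset.prod_zero, Multiset.card_zero, pow_zero, Polynomial.coeff_one]
    split_ifs <;> simp
  | cons r s ih =>
    have ih' := ih (fun x hx => h x (Multiset.mem_cons_of_mem hx))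
    have hr := h r (Multiset.mem_cons_self _ _)
    rw [Multiset.map_cons, Multiset.prod_cons, Multiset.card_cons, pow_succ, sub_mul, Polynomial.coeff_sub]
    set p := (s.map fun r => Polynomial.X - Polynomial.C r).prod
    have hM : 0 ≤ (1 + B) ^ s.card := by positivity
    have h1 : a ((Polynomial.X * p).coeff i) ≤ (1 + B) ^ s.card := by
      cases i with
      | zero => simpa using hM
      | succ i => rw [Polynomial.coeff_X_mul]; exact ih' i
    have h2 : a ((Polynomial.C r * p).coeff i) ≤ B * (1 + B) ^ s.card := by
      rw [Polynomial.coeff_C_mul, map_mul]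
      exact mul_le_mul hr (ih' i) (a.nonneg _) hB
    have := a.sub_le_add ((Polynomial.X * p).coeff i) ((Polynomial.C r * p).coeff i)
    linarith

/-- in an algebraically closed field, a minimal polynomial with bounded roots has bounded coefficients -/
lemma minpoly_coeff_le {k K : Type*} [Field k] [Field K] [Algebra k K] [IsAlgClosed K]
    (a : AbsoluteValue K ℝ) (B : ℝ) (hB : 0 ≤ B) (x : K) (hx : IsIntegral k x)
    (h : ∀ z, Polynomial.aeval z (minpoly k x) = 0 → a z ≤ B) (i : ℕ) :
    a (algebraMap k K ((minpoly k x).coeff i)) ≤ (1 + B) ^ (minpoly k x).natDegree := by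
  set P := (minpoly k x).map (algebraMap k K) with hP
  have hPm : P.Monic := (minpoly.monic hx).map _
  have hs : P.Splits := IsAlgClosed.splits P
  have e := hs.eq_prod_roots
  rw [hPm.leadingCoeff, Polynomial.C_1, one_mul] at e
  have hc : P.roots.card = (minpoly k x).natDegree := by
    rw [← hs.natDegree_eq_card_roots, hP, Polynomial.natDegree_map]
  have := coeff_le_roots a B hB P.roots (fun z hz => h z (by
    have := Polynomial.isRoot_of_mem_roots hz
    rwa [hP, Polynomial.IsRoot, Polynomial.eval_map_algebraMap] at this)) i
  rw [← e, hc, hP, Polynomial.coeff_map] at this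
  exact this

lemma ultra_sum {K ι : Type*} [Field K] (a : AbsoluteValue K ℝ) (hult : ∀ x y, a (x + y) ≤ max (a x) (a y))
    (s : Finset ι) (f : ι → K) (M : ℝ) (hM : 0 ≤ M) (h : ∀ i ∈ s, a (f i) ≤ M) : a (∑ i ∈ s, f i) ≤ M := by
  refine Finset.sum_induction f (fun x => a x ≤ M) (fun x y hx hy => ?_) (by simpa using hM) h
  exact (hult x y).trans (max_le hx hy)

lemma ultra_integral {k0 K : Type*} [Field k0] [Field K] [Algebra k0 K]
    (a : AbsoluteValue K ℝ) (hult : ∀ x y, a (x + y) ≤ max (a x) (a y))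
    (h0 : ∀ c : k0, a (algebraMap k0 K c) ≤ 1) (z : K) (hz : IsIntegral k0 z) : a z ≤ 1 := by
  by_contra hcon
  push Not at hcon
  obtain ⟨p, hp, hpz⟩ := hz
  rw [Polynomial.eval₂_eq_sum_range, Finset.sum_range_succ, hp.coeff_natDegree, map_one, one_mul] at hpz
  rcases Nat.eq_zero_or_pos p.natDegree with hn | hn
  · rw [hn] at hpz; simp at hpz
  have e : z ^ p.natDegree = - ∑ i ∈ Finset.range p.natDegree, algebraMap k0 K (p.coeff i) * z ^ i := by
    rw [eq_neg_iff_add_eq_zero, add_comm]; exact hpz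
  have h1 : a (z ^ p.natDegree) ≤ a z ^ (p.natDegree - 1) := by
    rw [e, a.map_neg]
    refine ultra_sum a hult _ _ _ (pow_nonneg (a.nonneg _) _) fun i hi => ?_
    rw [map_mul, map_pow]
    have : a z ^ i ≤ a z ^ (p.natDegree - 1) := pow_le_pow_right₀ hcon.le (by
      have := Finset.mem_range.1 hi; lia)
    calc _ ≤ 1 * a z ^ i := by gcongr; exact h0 _
      _ ≤ _ := by rw [one_mul]; exact this
  rw [map_pow] at h1
  have := pow_lt_pow_right₀ hcon (show p.natDegree - 1 < p.natDegree by lia)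
  linarith

section Geom
variable {k0 : Type*} [Field k0] {s : ℕ} {K : Type*} [Field K] [IsAlgClosed K]
  [Algebra k0 K] [Algebra (MvPolynomial (Fin s) k0) K] [IsScalarTower k0 (MvPolynomial (Fin s) k0) K]

lemma const_coeffs (x : K) (hx : IsIntegral (MvPolynomial (Fin s) k0) x)
    (h : ∀ i, ((minpoly (MvPolynomial (Fin s) k0) x).coeff i).totalDegree = 0) : IsIntegral k0 x := by
  have hm := minpoly.monic hx
  have hl : minpoly (MvPolynomial (Fin s) k0) x ∈ Polynomial.lifts (algebraMap k0 (MvPolynomial (Fin s) k0)) := by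
    rw [Polynomial.lifts_iff_coeff_lifts]
    intro n
    exact ⟨_, (MvPolynomial.totalDegree_eq_zero_iff_eq_C.1 (h n)).symm⟩
  obtain ⟨q, hq, -, hqm⟩ := Polynomial.lifts_and_natDegree_eq_and_monic hl hm
  refine ⟨q, hqm, ?_⟩
  have := minpoly.aeval (MvPolynomial (Fin s) k0) x
  rw [← hq, Polynomial.aeval_map_algebraMap] at this
  exact this

theorem geom_core [FaithfulSMul (MvPolynomial (Fin s) k0) K] [Algebra.IsAlgebraic (MvPolynomial (Fin s) k0) K]
    (Y : Set K) (hY : Y.Finite) (hYint : ∀ y ∈ Y, IsIntegral (MvPolynomial (Fin s) k0) y) :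
    ∃ O : Subring K, Y ⊆ O ∧ StepSys O (integralClosure k0 K).toSubring := by
  classical
  let A := MvPolynomial (Fin s) k0
  let k := FractionRing A
  letI : Algebra k K := FractionRing.liftAlgebra A K
  haveI : IsScalarTower A k K := FractionRing.isScalarTower_liftAlgebra A K
  haveI : Algebra.IsAlgebraic k K := Algebra.IsAlgebraic.extendScalars (IsFractionRing.injective A k)
  haveI : Normal k K := normal_iff.2 fun x => ⟨(Algebra.IsAlgebraic.isAlgebraic (R := k) x).isIntegral, IsAlgClosed.splits _⟩
  haveI : Finite Y := hY
  let L := IntermediateField.adjoin k Y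
  haveI : FiniteDimensional k L := IntermediateField.finiteDimensional_adjoin fun y _ =>
    (Algebra.IsAlgebraic.isAlgebraic (R := k) y).isIntegral
  refine ⟨(integralClosure A K).toSubring ⊓ L.toSubfield.toSubring, fun y hy =>
    ⟨hYint y hy, IntermediateField.subset_adjoin k Y hy⟩, ?_⟩
  intro B
  rcases Nat.eq_zero_or_pos s with rfl | hs
  · refine ⟨0, Fin.elim0, by simp, fun x hx _ => const_coeffs (s := 0) x hx.1 fun i => ?_, by simp⟩
    rw [MvPolynomial.eq_C_of_isEmpty (Polynomial.coeff _ i), MvPolynomial.totalDegree_C]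
  set B' := max B 1 with hB'
  have hB0 : 0 ≤ B' := le_trans zero_le_one (le_max_right _ _)
  let b : NNReal := ⟨(1 + B') ^ Module.finrank k L + 1, by positivity⟩
  have hb1 : 1 ≤ b := by
    rw [← NNReal.coe_le_coe]
    change (1 : ℝ) ≤ (1 + B') ^ Module.finrank k L + 1
    have : 0 ≤ (1 + B') ^ Module.finrank k L := by positivity
    linarith
  have hb1' : (1 : ℝ) < b := by
    change (1 : ℝ) < (1 + B') ^ Module.finrank k L + 1
    have : 0 < (1 + B') ^ Module.finrank k L := by positivity
    linarith
  obtain ⟨v, hv, hvd⟩ := degAbs_exists s k0 b hb1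
  obtain ⟨a, hult, hav⟩ := abs_extend (K := K) v hv ⟨algebraMap A k (MvPolynomial.X ⟨0, hs⟩), by
    rw [hvd _ (MvPolynomial.X_ne_zero _), MvPolynomial.totalDegree_X, pow_one]; exact hb1'⟩
  have haA : ∀ f : A, f ≠ 0 → a (algebraMap A K f) = (b : ℝ) ^ f.totalDegree := by
    intro f hf
    rw [IsScalarTower.algebraMap_apply A k K, hav, hvd f hf]
  have hext : ∀ τ : L →ₐ[k] K, ∃ σ : K →ₐ[k] K, ∀ x : L, σ x = τ x := by
    intro τ
    haveI : Algebra.IsAlgebraic L K := Algebra.IsAlgebraic.tower_top (K := k) L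
    obtain ⟨σ, hσ⟩ := IsAlgClosed.surjective_domRestrict_of_isAlgebraic (K := k) (L := L) (E := K) (M := K) τ
    exact ⟨σ, fun x => by rw [← hσ]; rfl⟩
  choose σ hσ using hext
  let e := Fintype.equivFin (L →ₐ[k] K)
  have hminA : ∀ x : K, IsIntegral A x → minpoly k x = (minpoly A x).map (algebraMap A k) := fun x hx =>
    minpoly.isIntegrallyClosed_eq_field_fractions' k hx
  refine ⟨_, fun i => a.comp (f := ((σ (e.symm i)).toRingHom : K →+* K)) (RingHom.injective _), ?_, ?_, ?_⟩
  · intro x hx hx0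
    let xL : L := ⟨x, hx.2⟩
    have e1 : ∏ i, a.comp (f := ((σ (e.symm i)).toRingHom : K →+* K)) (RingHom.injective _) x
        = a (∏ τ : L →ₐ[k] K, τ xL) := by
      rw [map_prod, ← e.symm.prod_comp]
      refine Finset.prod_congr rfl fun i _ => ?_
      rw [← hσ]; rfl
    rw [e1]
    set y := ∏ τ : L →ₐ[k] K, τ xL with hy
    have hxL0 : xL ≠ 0 := fun h => hx0 (congrArg Subtype.val h)
    have hy0 : y ≠ 0 := Finset.prod_ne_zero_iff.2 fun τ _ => by
      rw [Ne, map_eq_zero]; exact hxL0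
    have hyint : IsIntegral A y := IsIntegral.prod _ fun τ _ => by
      rw [← hσ]
      exact IsIntegral.map (R := A) (A := k) (σ τ) (show IsIntegral A x from hx.1)
    have hfix : ∀ g : K ≃ₐ[k] K, g y = y := by
      intro g
      rw [hy, map_prod]
      refine Fintype.prod_bijective (fun τ => g.toAlgHom.comp τ) ?_ _ _ fun τ => rfl
      rw [← Finite.injective_iff_bijective]
      intro τ τ' h
      ext z
      have := DFunLike.congr_fun h z
      exact g.injective this
    have hroots : ∀ z, Polynomial.aeval z (minpoly k y) = 0 → z = y := by
      intro z hz
      obtain ⟨g, hg⟩ := minpoly.exists_algEquiv_of_root' (Algebra.IsAlgebraic.isAlgebraic (R := k) y) hz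
      rw [← hg, hfix]
    have hyk : IsIntegral k y := hyint.tower_top
    set P := (minpoly k y).map (algebraMap k K) with hP
    have hPm : P.Monic := (minpoly.monic hyk).map _
    have hs' : P.Splits := IsAlgClosed.splits P
    have e2 : P.roots = Multiset.replicate P.natDegree y := by
      rw [hs'.natDegree_eq_card_roots, Multiset.eq_replicate_card]
      intro z hz
      refine hroots z ?_
      have := Polynomial.isRoot_of_mem_roots hz
      rwa [hP, Polynomial.IsRoot, Polynomial.eval_map_algebraMap] at this
    have e3 := hs'.eq_prod_roots
    rw [hPm.leadingCoeff, Polynomial.C_1, one_mul, e2, Multiset.map_replicate, Multiset.prod_replicate] at e3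
    have e4 : algebraMap A K ((minpoly A y).coeff 0) = (-y) ^ P.natDegree := by
      have := congrArg (Polynomial.coeff · 0) e3
      simp only [Polynomial.coeff_zero_eq_eval_zero, Polynomial.eval_pow, Polynomial.eval_sub, Polynomial.eval_X,
        Polynomial.eval_C, zero_sub] at this
      rw [← this, hP, ← Polynomial.coeff_zero_eq_eval_zero, Polynomial.coeff_map, hminA y hyint,
        Polynomial.coeff_map, IsScalarTower.algebraMap_apply A k K]
    have hn0 : P.natDegree ≠ 0 := by
      rw [hP, Polynomial.natDegree_map]
      exact (minpoly.natDegree_pos hyk).ne'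
    have hc0 : (minpoly A y).coeff 0 ≠ 0 := by
      intro h
      rw [h, map_zero] at e4
      exact pow_ne_zero _ (neg_ne_zero.2 hy0) e4.symm
    have e5 : a y ^ P.natDegree = (b : ℝ) ^ ((minpoly A y).coeff 0).totalDegree := by
      rw [← haA _ hc0, e4, map_pow, a.map_neg]
    have e6 : 1 ≤ a y ^ P.natDegree := by
      rw [e5]; exact one_le_pow₀ hb1'.le
    by_contra hlt
    push Not at hlt
    have := pow_lt_one₀ (a.nonneg y) hlt hn0
    linarith
  · intro x hx hxB
    refine const_coeffs x hx.1 fun i => ?_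
    by_cases hc0 : (minpoly A x).coeff i = 0
    · rw [hc0]; simp
    have hxk : IsIntegral k x := IsIntegral.tower_top (R := A) hx.1
    have h1 := minpoly_coeff_le (k := k) a B' hB0 x hxk (fun z hz => by
      obtain ⟨g, hg⟩ := minpoly.exists_algEquiv_of_root' (Algebra.IsAlgebraic.isAlgebraic (R := k) x) hz
      have := hxB (e (g.toAlgHom.comp L.val))
      change a (σ (e.symm (e (g.toAlgHom.comp L.val))) x) ≤ B at this
      rw [e.symm_apply_apply] at this
      refine le_trans (le_of_eq ?_) (this.trans (le_max_left _ _))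
      change a z = a (σ _ x)
      rw [show x = ((⟨x, hx.2⟩ : L) : K) from rfl, hσ, ← hg]
      rfl) i
    have e1 : algebraMap k K ((minpoly k x).coeff i) = algebraMap A K ((minpoly A x).coeff i) := by
      rw [hminA x hx.1, Polynomial.coeff_map, IsScalarTower.algebraMap_apply A k K]
    rw [e1, haA _ hc0] at h1
    have hdeg : (minpoly k x).natDegree ≤ Module.finrank k L := by
      have : minpoly k x = minpoly k (⟨x, hx.2⟩ : L) :=
        minpoly.algebraMap_eq (algebraMap L K).injective (⟨x, hx.2⟩ : L)
      rw [this]; exact minpoly.natDegree_le _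
    have h2 : (1 + B') ^ (minpoly k x).natDegree ≤ (1 + B') ^ Module.finrank k L :=
      pow_le_pow_right₀ (by linarith) hdeg
    have h3 : (b : ℝ) = (1 + B') ^ Module.finrank k L + 1 := rfl
    by_contra hne
    have h4 : (b : ℝ) ≤ (b : ℝ) ^ ((minpoly A x).coeff i).totalDegree := le_self_pow₀ hb1'.le hne
    linarith
  · intro x hx i
    refine ultra_integral (k0 := k0) _ ?_ ?_ x hx
    · intro x y
      change a (σ _ (x + y)) ≤ max (a (σ _ x)) (a (σ _ y))
      rw [map_add]; exact hult _ _
    · intro c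
      change a (σ _ (algebraMap k0 K c)) ≤ 1
      rw [IsScalarTower.algebraMap_apply k0 A K, IsScalarTower.algebraMap_apply A k K, AlgHom.commutes,
        ← IsScalarTower.algebraMap_apply A k K]
      by_cases hc : c = 0
      · simp [hc]
      · have hc' : (MvPolynomial.C c : A) ≠ 0 := by simpa using hc
        have := haA (MvPolynomial.C c) hc'
        rw [MvPolynomial.totalDegree_C, pow_zero] at this
        exact this.le
end Geom

end Part13

section Part14

/-- every finite set lies in a ring which reduces to the constants -/
theorem geom_step {k0 K : Type*} [Field k0] [Field K] [Algebra k0 K] [IsAlgClosed K]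
    (X : Set K) (hX : X.Finite) (hXK : ∀ z : K, IsAlgebraic (Algebra.adjoin k0 X) z)
    (Y : Set K) (hY : Y.Finite) :
    ∃ O : Subring K, Y ⊆ O ∧ StepSys O (integralClosure k0 K).toSubring := by
  let R := Algebra.adjoin k0 (X ∪ Y)
  haveI : Algebra.FiniteType k0 R := (Subalgebra.fg_iff_finiteType _).1 (Subalgebra.fg_def.2 ⟨_, hX.union hY, rfl⟩)
  obtain ⟨s, g, hginj, hgint⟩ := exists_integral_inj_algHom_of_fg k0 R
  let A := MvPolynomial (Fin s) k0
  letI : Algebra A R := g.toRingHom.toAlgebra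
  letI : Algebra A K := (R.val.comp g).toRingHom.toAlgebra
  haveI : IsScalarTower A R K := IsScalarTower.of_algebraMap_eq fun _ => rfl
  haveI : IsScalarTower k0 A K := IsScalarTower.of_algebraMap_eq fun c => by
    change _ = ((g (algebraMap k0 A c) : R) : K)
    rw [AlgHom.commutes]; rfl
  haveI : FaithfulSMul A K := by
    rw [faithfulSMul_iff_algebraMap_injective]
    exact Subtype.val_injective.comp hginj
  haveI : FaithfulSMul A R := by
    rw [faithfulSMul_iff_algebraMap_injective]
    exact hginj
  haveI : Algebra.IsIntegral A R := ⟨hgint⟩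
  haveI : Algebra.IsAlgebraic R K := by
    refine ⟨fun z => ?_⟩
    have h1 := hXK z
    have hle : Algebra.adjoin k0 X ≤ R := Algebra.adjoin_mono Set.subset_union_left
    obtain ⟨p, hp0, hp⟩ := h1
    refine ⟨p.map (Subalgebra.inclusion hle).toRingHom, ?_, ?_⟩
    · rw [Ne, Polynomial.map_eq_zero_iff]
      · exact hp0
      · exact Subalgebra.inclusion_injective hle
    · rw [Polynomial.aeval_def, Polynomial.eval₂_map]
      exact hp
  haveI : Algebra.IsAlgebraic A K := Algebra.IsAlgebraic.trans A R K
  refine geom_core (s := s) Y hY fun y hy => ?_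
  have : IsIntegral A (⟨y, Algebra.subset_adjoin (Set.mem_union_right _ hy)⟩ : R) := Algebra.IsIntegral.isIntegral _
  exact IsIntegral.map (IsScalarTower.toAlgHom A R K) this

end Part14

section Part15

/-- countable fields embed into uncountable algebraically closed fields -/
theorem exists_embedding {L K F : Type*} [Field L] [Field K] [Field F] [Algebra L K] [Algebra L F]
    [Countable L] [Countable K] [IsAlgClosed F] [Uncountable F] : Nonempty (K →ₐ[L] F) := by
  obtain ⟨s, hs⟩ := exists_isTranscendenceBasis L K
  obtain ⟨t, ht⟩ := exists_isTranscendenceBasis L F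
  haveI : Infinite t := by
    by_contra hfin
    have h1 := IsAlgClosed.cardinal_le_max_transcendence_basis _ ht
    have h2 : Cardinal.mk F ≤ Cardinal.aleph0 := by
      have hL : Cardinal.mk L ≤ Cardinal.aleph0 := Cardinal.mk_le_aleph0
      have hT : Cardinal.mk t ≤ Cardinal.aleph0 := by
        rw [not_infinite_iff_finite] at hfin
        exact Cardinal.mk_le_aleph0
      rw [← Cardinal.lift_le_aleph0] at hL hT ⊢
      exact h1.trans (max_le (max_le hL hT) le_rfl)
    rw [Cardinal.mk_le_aleph0_iff] at h2
    exact not_countable (α := F) h2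
  obtain ⟨f, hf⟩ : ∃ f : s → t, Function.Injective f := by
    obtain ⟨g, hg⟩ := exists_injective_nat s
    exact ⟨Infinite.natEmbedding t ∘ g, (Infinite.natEmbedding t).injective.comp hg⟩
  let R := MvPolynomial s L
  let φ : R →ₐ[L] K := MvPolynomial.aeval (fun i : s => (i : K))
  let ψ : R →ₐ[L] F := MvPolynomial.aeval (fun i : s => (f i : F))
  have hφ : Function.Injective φ := hs.1
  have hψ : Function.Injective ψ := ht.1.comp f hf
  letI : Algebra R K := φ.toRingHom.toAlgebra
  letI : Algebra R F := ψ.toRingHom.toAlgebra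
  haveI : FaithfulSMul R K := by rw [faithfulSMul_iff_algebraMap_injective]; exact hφ
  haveI : FaithfulSMul R F := by rw [faithfulSMul_iff_algebraMap_injective]; exact hψ
  haveI : IsScalarTower L R K := IsScalarTower.of_algebraMap_eq fun c => (φ.commutes c).symm
  haveI : IsScalarTower L R F := IsScalarTower.of_algebraMap_eq fun c => (ψ.commutes c).symm
  haveI : Algebra.IsAlgebraic R K := by
    have h := hs.isAlgebraic
    rw [Subtype.range_coe] at h
    refine ⟨fun z => ?_⟩
    obtain ⟨p, hp0, hp⟩ := h.isAlgebraic z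
    have hmem : ∀ c : Algebra.adjoin L s, ∃ r : R, φ r = c := by
      rintro ⟨c, this⟩
      rw [Algebra.adjoin_eq_range] at this
      exact this
    have hl : p.map (algebraMap (Algebra.adjoin L s) K) ∈ Polynomial.lifts φ.toRingHom := by
      rw [Polynomial.lifts_iff_coeff_lifts]
      intro n
      obtain ⟨r, hr⟩ := hmem (p.coeff n)
      exact ⟨r, by rw [Polynomial.coeff_map]; exact hr⟩
    obtain ⟨q, hq⟩ := (Polynomial.mem_lifts _).1 hl
    refine ⟨q, ?_, ?_⟩
    · rintro rfl
      rw [Polynomial.map_zero] at hq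
      exact hp0 ((Polynomial.map_eq_zero_iff Subtype.val_injective).1 hq.symm)
    · rw [Polynomial.aeval_def, ← Polynomial.eval_map]
      change Polynomial.eval z (q.map φ.toRingHom) = 0
      rw [hq, Polynomial.eval_map]; exact hp
  exact ⟨(IsAlgClosed.lift (M := F) (R := R) (S := K)).restrictScalars L⟩

/-- the places of a number field inside `K` over a given place -/
theorem place_family {K : Type*} [Field K] [Countable K] (L : Type*) [Field L] [Algebra ℚ L] [Algebra L K]
    [FiniteDimensional ℚ L] [Countable L] (F : Type*) [NormedField F] [Uncountable F] [IsAlgClosed F] [Algebra ℚ F] :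
    ∃ (n : ℕ) (a : Fin n → AbsoluteValue K ℝ),
      (∀ x : L, ∏ i, a i (algebraMap L K x) = ‖algebraMap ℚ F (Algebra.norm ℚ x)‖) ∧
      ∀ x : L, ∀ B : ℝ, 0 ≤ B → (∀ i, a i (algebraMap L K x) ≤ B) → ∀ j,
        ‖algebraMap ℚ F ((minpoly ℚ x).coeff j)‖ ≤ (1 + B) ^ (minpoly ℚ x).natDegree := by
  classical
  have hext : ∀ τ : L →ₐ[ℚ] F, ∃ σ : K →+* F, ∀ x : L, σ (algebraMap L K x) = τ x := by
    intro τ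
    letI : Algebra L F := τ.toRingHom.toAlgebra
    obtain ⟨σ⟩ := exists_embedding (L := L) (K := K) (F := F)
    exact ⟨σ.toRingHom, fun x => σ.commutes x⟩
  choose σ hσ using hext
  let N : AbsoluteValue F ℝ := NormedField.toAbsoluteValue F
  have hN : ∀ x, N x = ‖x‖ := fun _ => rfl
  let e := Fintype.equivFin (L →ₐ[ℚ] F)
  refine ⟨_, fun i => N.comp (f := σ (e.symm i)) (RingHom.injective _), fun x => ?_, fun x B hB hx j => ?_⟩
  · rw [Algebra.norm_eq_prod_embeddings, norm_prod, ← e.symm.prod_comp]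
    refine Finset.prod_congr rfl fun i _ => ?_
    rw [← hσ]; rfl
  · obtain ⟨τ0⟩ : Nonempty (L →ₐ[ℚ] F) := ⟨IsAlgClosed.lift⟩
    have hm : minpoly ℚ (τ0 x) = minpoly ℚ x := minpoly.algHom_eq τ0 τ0.injective x
    have := minpoly_coeff_le (k := ℚ) N B hB (τ0 x) ((Algebra.IsIntegral.isIntegral x).map τ0) (fun z hz => by
      rw [hm] at hz
      have hz' : z ∈ (minpoly ℚ x).rootSet F := by
        rw [Polynomial.mem_rootSet]
        exact ⟨minpoly.ne_zero (Algebra.IsIntegral.isIntegral x), hz⟩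
      rw [← Algebra.IsAlgebraic.range_eval_eq_rootSet_minpoly] at hz'
      obtain ⟨τ, rfl⟩ := hz'
      have h := hx (e τ)
      change ‖σ (e.symm (e τ)) (algebraMap L K x)‖ ≤ B at h
      rw [e.symm_apply_apply, hσ] at h
      exact h) j
    rw [hm] at this
    exact this

end Part15

section Part16

lemma padicNorm_nat_fact {p n : ℕ} (hp : p.Prime) (hn : n ≠ 0) :
    padicNorm p (n : ℚ) = ((p : ℚ) ^ n.factorization p)⁻¹ := by
  haveI := Fact.mk hp
  rw [padicNorm.eq_zpow_of_nonzero (by exact_mod_cast hn), padicValRat.of_nat, _root_.zpow_neg, zpow_natCast,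
    Nat.factorization_def n hp]

lemma prod_formula_eq (P : Finset ℕ) (hP : ∀ p ∈ P, p.Prime) (n : ℕ) (hn : n ≠ 0) (h : n.primeFactors ⊆ P) :
    (n : ℚ) * ∏ p ∈ P, padicNorm p (n : ℚ) = 1 := by
  have e : ∏ p ∈ P, padicNorm p (n : ℚ) = ((n : ℕ) : ℚ)⁻¹ := by
    rw [Finset.prod_congr rfl (fun p hp => padicNorm_nat_fact (hP p hp) hn), Finset.prod_inv_distrib]
    congr 1
    conv_rhs => rw [← Nat.factorization_prod_pow_eq_self hn]
    rw [Finsupp.prod_of_support_subset _ (s := P) (by rwa [Nat.support_factorization]) _ (by simp)]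
    push_cast
    rfl
  rw [e]
  exact mul_inv_cancel₀ (by exact_mod_cast hn)

lemma padicNorm_int_le (p : ℕ) (hp : p.Prime) (c : ℤ) : padicNorm p (c : ℚ) ≤ 1 := by
  haveI := Fact.mk hp
  exact padicNorm.of_int c

lemma prod_formula_ge_nat (P : Finset ℕ) (hP : ∀ p ∈ P, p.Prime) (n : ℕ) (hn : n ≠ 0) :
    1 ≤ (n : ℚ) * ∏ p ∈ P, padicNorm p (n : ℚ) := by
  have h1 := prod_formula_eq (P ∪ n.primeFactors) (fun p hp => by
    rcases Finset.mem_union.1 hp with h | h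
    · exact hP p h
    · exact Nat.prime_of_mem_primeFactors h) n hn Finset.subset_union_right
  rw [← h1]
  refine mul_le_mul_of_nonneg_left ?_ (by positivity)
  rw [← Finset.prod_sdiff (Finset.subset_union_left (s₁ := P) (s₂ := n.primeFactors))]
  refine mul_le_of_le_one_left (Finset.prod_nonneg fun p _ => padicNorm.nonneg _) ?_
  refine Finset.prod_le_one (fun p _ => padicNorm.nonneg _) fun p hp => ?_
  have hp' : p.Prime := by
    rcases Finset.mem_union.1 (Finset.mem_sdiff.1 hp).1 with h | h
    · exact hP p h
    · exact Nat.prime_of_mem_primeFactors h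
  exact_mod_cast padicNorm_int_le p hp' n

lemma padicNorm_abs (p : ℕ) (hp : p.Prime) (q : ℚ) : padicNorm p |q| = padicNorm p q := by
  haveI := Fact.mk hp
  rcases abs_choice q with h | h <;> rw [h]
  exact padicNorm.neg q

/-- product formula for `S`-integers -/
lemma prod_formula (m : ℕ) (hm : m ≠ 0) (q : ℚ) (hq : q ≠ 0) (r : ℕ) (c : ℤ) (h : (m : ℚ) ^ r * q = c) :
    1 ≤ |q| * ∏ p ∈ m.primeFactors, padicNorm p q := by
  have hP : ∀ p ∈ m.primeFactors, p.Prime := fun p hp => Nat.prime_of_mem_primeFactors hp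
  have hm' : (m : ℚ) ≠ 0 := by exact_mod_cast hm
  have hc : c ≠ 0 := by
    rintro rfl
    simp [hm, hq] at h
  have h1 := prod_formula_ge_nat m.primeFactors hP c.natAbs (Int.natAbs_ne_zero.2 hc)
  have h2 := prod_formula_eq m.primeFactors hP m hm subset_rfl
  have e1 : ((c.natAbs : ℕ) : ℚ) = |(c : ℚ)| := by rw [Nat.cast_natAbs, Int.cast_abs]
  rw [e1, Finset.prod_congr rfl (fun p hp => padicNorm_abs p (hP p hp) _), ← h] at h1
  have e2 : ∏ p ∈ m.primeFactors, padicNorm p ((m : ℚ) ^ r * q) =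
      (∏ p ∈ m.primeFactors, padicNorm p (m : ℚ)) ^ r * ∏ p ∈ m.primeFactors, padicNorm p q := by
    rw [← Finset.prod_pow, ← Finset.prod_mul_distrib]
    refine Finset.prod_congr rfl fun p hp => ?_
    haveI := Fact.mk (hP p hp)
    rw [padicNorm.mul]
    congr 1
    clear h h1
    induction r with
    | zero => simp
    | succ r ih => rw [pow_succ, pow_succ, padicNorm.mul, ih]
  rw [e2, abs_mul, abs_pow, Nat.abs_cast] at h1
  calc 1 ≤ _ := h1
    _ = ((m : ℚ) * ∏ p ∈ m.primeFactors, padicNorm p (m : ℚ)) ^ r * (|q| * ∏ p ∈ m.primeFactors, padicNorm p q) := by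
        rw [mul_pow]; ring
    _ = _ := by rw [h2, one_pow, one_mul]

lemma den_dvd_of (m : ℕ) (q : ℚ) (r : ℕ) (c : ℤ) (hm : m ≠ 0) (h : (m : ℚ) ^ r * q = c) : q.den ∣ m ^ r := by
  have hm' : (m : ℚ) ≠ 0 := by exact_mod_cast hm
  have : q = Rat.divInt c ((m ^ r : ℕ) : ℤ) := by
    rw [Rat.divInt_eq_div, ← h]
    push_cast
    field_simp
  rw [this]
  exact_mod_cast Rat.den_dvd c ((m ^ r : ℕ) : ℤ)

/-- finiteness of `S`-integers of bounded height -/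
lemma finite_bounded (m : ℕ) (hm : m ≠ 0) (M : ℚ) (hM : 1 ≤ M) :
    {q : ℚ | (∃ (r : ℕ) (c : ℤ), (m : ℚ) ^ r * q = c) ∧ |q| ≤ M ∧ ∀ p ∈ m.primeFactors, padicNorm p q ≤ M}.Finite := by
  have hP : ∀ p ∈ m.primeFactors, p.Prime := fun p hp => Nat.prime_of_mem_primeFactors hp
  set C := M ^ m.primeFactors.card with hC
  obtain ⟨N, hN⟩ := exists_nat_ge (M * C)
  have hfin : ((fun z : ℤ × ℤ => (z.1 / z.2 : ℚ)) '' (Set.Icc (-(N : ℤ)) N ×ˢ Set.Icc (-(N : ℤ)) N)).Finite :=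
    ((Set.finite_Icc _ _).prod (Set.finite_Icc _ _)).image _
  refine hfin.subset ?_
  rintro q ⟨⟨r, c, hrc⟩, hq, hqp⟩
  have hd := den_dvd_of m q r c hm hrc
  have hden : q.den.primeFactors ⊆ m.primeFactors := by
    intro p hp
    have hpp := Nat.prime_of_mem_primeFactors hp
    exact Nat.mem_primeFactors.2 ⟨hpp, hpp.dvd_of_dvd_pow ((Nat.dvd_of_mem_primeFactors hp).trans hd), hm⟩
  have h1 := prod_formula_eq m.primeFactors hP q.den q.den_nz hden
  have h2 : ∀ p ∈ m.primeFactors, M⁻¹ ≤ padicNorm p (q.den : ℚ) := by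
    intro p hp
    haveI := Fact.mk (hP p hp)
    by_cases hpd : p ∣ q.den
    · have hnum : padicNorm p (q.num : ℚ) = 1 := by
        rw [padicNorm.int_eq_one_iff]
        intro hpn
        have := Nat.dvd_gcd (Int.natCast_dvd.1 hpn) hpd
        rw [q.reduced.gcd_eq_one] at this
        exact (hP p hp).one_lt.ne' (Nat.dvd_one.1 this)
      have e : padicNorm p q * padicNorm p (q.den : ℚ) = 1 := by
        rw [← padicNorm.mul, Rat.mul_den_eq_num, hnum]
      have h3 := hqp p hp
      have hpos : 0 < padicNorm p (q.den : ℚ) :=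
        lt_of_le_of_ne (padicNorm.nonneg _) (fun h => by rw [← h, mul_zero] at e; exact zero_ne_one e)
      rw [inv_le_iff_one_le_mul₀ (by linarith)]
      nlinarith
    · have : padicNorm p (q.den : ℚ) = 1 := (padicNorm.nat_eq_one_iff _).2 hpd
      rw [this]
      exact inv_le_one_of_one_le₀ hM
  have h3 : M⁻¹ ^ m.primeFactors.card ≤ ∏ p ∈ m.primeFactors, padicNorm p (q.den : ℚ) := by
    rw [← Finset.prod_const]
    exact Finset.prod_le_prod (fun _ _ => by positivity) h2
  have hC0 : 0 < C := by positivity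
  have h4 : (q.den : ℚ) ≤ C := by
    have hd0 : (0 : ℚ) ≤ q.den := by positivity
    have : (q.den : ℚ) * C⁻¹ ≤ 1 := by
      rw [← h1, hC, ← inv_pow]
      gcongr
    rwa [mul_inv_le_iff₀ hC0, one_mul] at this
  have h5 : |(q.num : ℚ)| ≤ M * C := by
    rw [← Rat.mul_den_eq_num, abs_mul, Nat.abs_cast]
    gcongr
  have hC1 : C ≤ M * C := le_mul_of_one_le_left hC0.le hM
  refine ⟨(q.num, q.den), ⟨?_, ?_⟩, Rat.num_div_den q⟩
  · have : |(q.num : ℚ)| ≤ N := h5.trans hN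
    have h6 : |q.num| ≤ (N : ℤ) := by exact_mod_cast this
    exact abs_le.1 h6
  · have : (q.den : ℚ) ≤ N := (h4.trans hC1).trans hN
    have h6 : (q.den : ℤ) ≤ (N : ℤ) := by exact_mod_cast this
    exact ⟨by have : (0:ℤ) ≤ q.den := by positivity
              have : (0:ℤ) ≤ N := by positivity
              lia, h6⟩

end Part16

section Part17

/-- `S`-integers -/
def sInt (m : ℕ) (A : Type*) [CommRing A] : Subring A where
  carrier := {x | ∃ j : ℕ, IsIntegral ℤ ((m : A) ^ j * x)}
  zero_mem' := ⟨0, by simpa using isIntegral_zero⟩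
  one_mem' := ⟨0, by simpa using isIntegral_one⟩
  neg_mem' := by
    rintro x ⟨j, hj⟩
    exact ⟨j, by rw [mul_neg]; exact hj.neg⟩
  mul_mem' := by
    rintro x y ⟨j, hj⟩ ⟨k, hk⟩
    refine ⟨j + k, ?_⟩
    have e : (m : A) ^ (j + k) * (x * y) = ((m : A) ^ j * x) * ((m : A) ^ k * y) := by ring
    rw [e]; exact hj.mul hk
  add_mem' := by
    rintro x y ⟨j, hj⟩ ⟨k, hk⟩
    refine ⟨j + k, ?_⟩
    have hm : ∀ r : ℕ, IsIntegral ℤ ((m : A) ^ r) := fun r => by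
      have : ((m : A) ^ r) = algebraMap ℤ A ((m : ℤ) ^ r) := by simp
      rw [this]; exact isIntegral_algebraMap
    have e : (m : A) ^ (j + k) * (x + y) =
      (m : A) ^ k * ((m : A) ^ j * x) + (m : A) ^ j * ((m : A) ^ k * y) := by ring
    rw [e]; exact ((hm k).mul hj).add ((hm j).mul hk)

lemma sInt_rat {m : ℕ} {q : ℚ} (h : q ∈ sInt m ℚ) : ∃ (r : ℕ) (c : ℤ), (m : ℚ) ^ r * q = c := by
  obtain ⟨j, hj⟩ := h
  obtain ⟨c, hc⟩ := IsIntegrallyClosed.isIntegral_iff.1 hj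
  exact ⟨j, c, by rw [← hc]; simp⟩

lemma sInt_inv {m : ℕ} (hm : m ≠ 0) (A : Type*) [Field A] [CharZero A] : ((m : A))⁻¹ ∈ sInt m A := by
  refine ⟨1, ?_⟩
  rw [pow_one, mul_inv_cancel₀ (by exact_mod_cast hm)]
  exact isIntegral_one

section
variable {L : Type*} [Field L] [Algebra ℚ L] [FiniteDimensional ℚ L]

lemma isScalarTower_int_rat : IsScalarTower ℤ ℚ L := by
  refine IsScalarTower.of_algebraMap_eq fun x => ?_
  simp

lemma sInt_norm {m : ℕ} (hm : m ≠ 0) {x : L} (h : x ∈ sInt m L) : Algebra.norm ℚ x ∈ sInt m ℚ := by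
  obtain ⟨j, hj⟩ := h
  haveI : IsScalarTower ℤ ℚ L := isScalarTower_int_rat
  have := Algebra.isIntegral_norm (R := ℤ) ℚ hj
  refine ⟨j * Module.finrank ℚ L, ?_⟩
  have e : (m : L) ^ j = algebraMap ℚ L ((m : ℚ) ^ j) := by simp
  rwa [map_mul, e, Algebra.norm_algebraMap, ← pow_mul] at this

lemma sInt_minpoly {m : ℕ} (hm : m ≠ 0) {x : L} (h : x ∈ sInt m L) (i : ℕ) :
    (minpoly ℚ x).coeff i ∈ sInt m ℚ := by
  obtain ⟨j, hj⟩ := h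
  haveI : IsScalarTower ℤ ℚ L := isScalarTower_int_rat
  set u : ℚ := (m : ℚ) ^ j with hu
  have hu0 : u ≠ 0 := pow_ne_zero _ (by exact_mod_cast hm)
  have e : (m : L) ^ j = algebraMap ℚ L u := by simp [hu]
  rw [e] at hj
  set y := algebraMap ℚ L u * x with hy
  have hq := minpoly.isIntegrallyClosed_eq_field_fractions' ℚ hj
  have hix : IsIntegral ℚ x := Algebra.IsIntegral.isIntegral x
  have hiy : IsIntegral ℚ y := Algebra.IsIntegral.isIntegral y
  have hxy : x = algebraMap ℚ L u⁻¹ * y := by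
    rw [hy, ← mul_assoc, ← map_mul, inv_mul_cancel₀ hu0, map_one, one_mul]
  have d1 : minpoly ℚ x ∣ (minpoly ℚ y).scaleRoots u⁻¹ := by
    refine minpoly.dvd _ _ ?_
    conv_lhs => rw [hxy]
    exact Polynomial.scaleRoots_aeval_eq_zero (minpoly.aeval _ _)
  have d2 : minpoly ℚ y ∣ (minpoly ℚ x).scaleRoots u := by
    refine minpoly.dvd _ _ ?_
    exact Polynomial.scaleRoots_aeval_eq_zero (minpoly.aeval _ _)
  have hd : (minpoly ℚ y).natDegree ≤ (minpoly ℚ x).natDegree := by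
    have := Polynomial.natDegree_le_of_dvd d2 ((Polynomial.monic_scaleRoots_iff u).2 (minpoly.monic hix)).ne_zero
    rwa [Polynomial.natDegree_scaleRoots] at this
  have e2 := Polynomial.eq_of_monic_of_dvd_of_natDegree_le (minpoly.monic hix)
    ((Polynomial.monic_scaleRoots_iff u⁻¹).2 (minpoly.monic hiy)) d1
    (by rwa [Polynomial.natDegree_scaleRoots])
  rw [← e2, Polynomial.coeff_scaleRoots, hq, Polynomial.coeff_map]
  refine Subring.mul_mem _ ?_ (Subring.pow_mem _ ?_ _)
  · simp
  · rw [hu, ← inv_pow]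
    exact Subring.pow_mem _ (sInt_inv hm ℚ) _
end

instance padicAlgCl_uncountable (p : ℕ) [Fact p.Prime] : Uncountable (PadicAlgCl p) := by
  have h := continuum_le_cardinal_of_nontriviallyNormedField ℚ_[p]
  have h2 : Uncountable ℚ_[p] := by
    rw [← Cardinal.aleph0_lt_mk_iff]
    exact Cardinal.aleph0_lt_continuum.trans_le h
  exact (algebraMap ℚ_[p] (PadicAlgCl p)).injective.uncountable

lemma places_inf {K : Type*} [Field K] [Countable K] (L : Type*) [Field L] [Algebra ℚ L] [Algebra L K]
    [FiniteDimensional ℚ L] [Countable L] :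
    ∃ (n : ℕ) (a : Fin n → AbsoluteValue K ℝ),
      (∀ x : L, ∏ i, a i (algebraMap L K x) = ((|Algebra.norm ℚ x| : ℚ) : ℝ)) ∧
      ∀ x : L, ∀ B : ℝ, 0 ≤ B → (∀ i, a i (algebraMap L K x) ≤ B) → ∀ j,
        ((|(minpoly ℚ x).coeff j| : ℚ) : ℝ) ≤ (1 + B) ^ (minpoly ℚ x).natDegree := by
  haveI : Uncountable ℂ := by
    rw [← Cardinal.aleph0_lt_mk_iff, Cardinal.mk_complex]
    exact Cardinal.aleph0_lt_continuum
  obtain ⟨n, a, h1, h2⟩ := place_family (K := K) L ℂ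
  have e : ∀ q : ℚ, ‖algebraMap ℚ ℂ q‖ = ((|q| : ℚ) : ℝ) := fun q => by
    rw [eq_ratCast, Complex.norm_ratCast]; simp
  simp only [e] at h1 h2
  exact ⟨n, a, h1, h2⟩

lemma places_fin (p : ℕ) (hp : p.Prime) {K : Type*} [Field K] [Countable K] (L : Type*) [Field L] [Algebra ℚ L]
    [Algebra L K] [FiniteDimensional ℚ L] [Countable L] :
    ∃ (n : ℕ) (a : Fin n → AbsoluteValue K ℝ),
      (∀ x : L, ∏ i, a i (algebraMap L K x) = ((padicNorm p (Algebra.norm ℚ x) : ℚ) : ℝ)) ∧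
      ∀ x : L, ∀ B : ℝ, 0 ≤ B → (∀ i, a i (algebraMap L K x) ≤ B) → ∀ j,
        ((padicNorm p ((minpoly ℚ x).coeff j) : ℚ) : ℝ) ≤ (1 + B) ^ (minpoly ℚ x).natDegree := by
  haveI := Fact.mk hp
  obtain ⟨n, a, h1, h2⟩ := place_family (K := K) L (PadicAlgCl p)
  have e : ∀ q : ℚ, ‖algebraMap ℚ (PadicAlgCl p) q‖ = ((padicNorm p q : ℚ) : ℝ) := fun q => by
    rw [← Padic.eq_padicNorm, ← PadicAlgCl.norm_extends]; simp
  simp only [e] at h1 h2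
  exact ⟨n, a, h1, h2⟩

theorem arith_core {K : Type*} [Field K] [Countable K] (L : Type*) [Field L] [Algebra ℚ L]
    [Algebra L K] [FiniteDimensional ℚ L] [Countable L] (m : ℕ) (hm : m ≠ 0) :
    BaseSys ((sInt m L).map (algebraMap L K)) := by
  classical
  obtain ⟨n0, a0, h01, h02⟩ := places_inf (K := K) L
  have hfin := fun p : {p // p ∈ m.primeFactors} =>
    places_fin p.1 (Nat.prime_of_mem_primeFactors p.2) (K := K) L
  choose n a h1 h2 using hfin
  let I := Fin n0 ⊕ (Σ p, Fin (n p))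
  let b : I → AbsoluteValue K ℝ := Sum.elim a0 (fun z => a z.1 z.2)
  let e := Fintype.equivFin I
  refine ⟨_, fun i => b (e.symm i), ?_, ?_⟩
  · rintro _ ⟨x, hx, rfl⟩ hx0
    have hx0' : x ≠ 0 := by rintro rfl; simp at hx0
    rw [e.symm.prod_comp (fun i => b i (algebraMap L K x)), Fintype.prod_sum_type, Fintype.prod_sigma]
    have e1 : ∏ i, b (Sum.inl i) (algebraMap L K x) = ((|Algebra.norm ℚ x| : ℚ) : ℝ) := h01 x
    have e2 : ∀ p, ∏ i, b (Sum.inr ⟨p, i⟩) (algebraMap L K x) =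
      ((padicNorm p (Algebra.norm ℚ x) : ℚ) : ℝ) := fun p => h1 p x
    rw [e1, Finset.prod_congr rfl (fun p _ => e2 p)]
    obtain ⟨r, c, hrc⟩ := sInt_rat (sInt_norm hm hx)
    have := prod_formula m hm _ (Algebra.norm_ne_zero_iff.2 hx0') r c hrc
    rw [← Finset.prod_coe_sort] at this
    exact_mod_cast this
  · intro B0
    set B := max B0 0
    set D := Module.finrank ℚ L
    obtain ⟨M, hM⟩ := exists_nat_ge ((1 + B) ^ D)
    have hU := finite_bounded m hm (max 1 M) (le_max_left _ _)
    refine ((Polynomial.bUnion_roots_finite (algebraMap ℚ L) D hU).image (algebraMap L K)).subset ?_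
    rintro _ ⟨⟨x, hx, rfl⟩, hB⟩
    refine ⟨x, ?_, rfl⟩
    have hB0 : 0 ≤ B := le_max_right _ _
    have hB' : ∀ i : I, b i (algebraMap L K x) ≤ B := fun i => by
      have := hB (e i)
      simp only [e.symm_apply_apply] at this
      exact this.trans (le_max_left _ _)
    have hdeg : (minpoly ℚ x).natDegree ≤ D := minpoly.natDegree_le x
    have hpow : (1 + B) ^ (minpoly ℚ x).natDegree ≤ ((max 1 (M : ℚ) : ℚ) : ℝ) := by
      refine (pow_le_pow_right₀ (by linarith) hdeg).trans (hM.trans ?_)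
      have : (M : ℚ) ≤ max 1 (M : ℚ) := le_max_right _ _
      exact_mod_cast this
    simp only [Set.mem_iUnion]
    refine ⟨minpoly ℚ x, ⟨hdeg, fun j => ⟨sInt_rat (sInt_minpoly hm hx j), ?_, fun p hp => ?_⟩⟩, ?_⟩
    · exact_mod_cast (h02 x B hB0 (fun i => hB' (Sum.inl i)) j).trans hpow
    · exact_mod_cast (h2 ⟨p, hp⟩ x B hB0 (fun i => hB' (Sum.inr ⟨_, i⟩)) j).trans hpow
    · simp only [Finset.mem_coe, Multiset.mem_toFinset]
      rw [Polynomial.mem_roots', Polynomial.IsRoot.def, Polynomial.eval_map_algebraMap]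
      exact ⟨((minpoly.monic (Algebra.IsIntegral.isIntegral x)).map _).ne_zero, minpoly.aeval _ _⟩

theorem arith_base1 {K : Type*} [Field K] [Countable K] (L : Type*) [Field L] [Algebra ℚ L]
    [Algebra L K] [FiniteDimensional ℚ L] [Countable L] (Y : Set K) (hY : Y.Finite)
    (hsub : ∀ y ∈ Y, ∃ z : L, algebraMap L K z = y) : ∃ O : Subring K, Y ⊆ O ∧ BaseSys O := by
  classical
  have hden : ∀ y : L, ∃ m : ℕ, m ≠ 0 ∧ IsIntegral ℤ ((m : L) * y) := by
    intro y
    haveI : IsScalarTower ℤ ℚ L := isScalarTower_int_rat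
    have h1 : IsAlgebraic ℤ y := (IsFractionRing.isAlgebraic_iff ℤ ℚ L).2 (Algebra.IsAlgebraic.isAlgebraic y)
    obtain ⟨c, hc, hci⟩ := h1.exists_integral_multiple
    refine ⟨c.natAbs, Int.natAbs_ne_zero.2 hc, ?_⟩
    rw [Nat.cast_natAbs]
    rw [zsmul_eq_mul] at hci
    rcases abs_choice c with h | h <;> rw [h]
    · exact hci
    · push_cast; rw [neg_mul]; exact hci.neg
  choose den hden0 hden1 using hden
  let YL : Set L := {z | algebraMap L K z ∈ Y}
  have hYL : YL.Finite := Set.Finite.preimage ((algebraMap L K).injective.injOn) hY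
  set m := ∏ z ∈ hYL.toFinset, den z
  have hm : m ≠ 0 := Finset.prod_ne_zero_iff.2 fun z _ => hden0 z
  refine ⟨_, ?_, arith_core (K := K) L m hm⟩
  intro y hy
  obtain ⟨z, rfl⟩ := hsub y hy
  refine ⟨z, ⟨1, ?_⟩, rfl⟩
  obtain ⟨c, hc⟩ : den z ∣ m := Finset.dvd_prod_of_mem _ (hYL.mem_toFinset.2 hy)
  rw [pow_one, hc]
  push_cast
  rw [mul_comm (den z : L), mul_assoc]
  refine IsIntegral.mul ?_ (hden1 z)
  have : ((c : ℕ) : L) = algebraMap ℤ L c := by simp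
  rw [this]; exact isIntegral_algebraMap

theorem arith_base0 {K : Type*} [Field K] [Countable K] [Algebra ℚ K] (Y : Set K) (hY : Y.Finite)
    (hYa : ∀ y ∈ Y, IsAlgebraic ℚ y) : ∃ O : Subring K, Y ⊆ O ∧ BaseSys O := by
  classical
  set L := IntermediateField.adjoin ℚ Y with hL
  letI i1 : Algebra ℚ L := L.algebra'
  have hfd : @FiniteDimensional ℚ L _ _ i1.toModule := by
    haveI := hY.to_subtype
    exact IntermediateField.finiteDimensional_adjoin fun y hy => (hYa y hy).isIntegral
  have hcount : Countable L := Subtype.countable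
  exact @arith_base1 K _ _ L _ i1 _ hfd hcount Y hY
    (fun y hy => ⟨⟨y, IntermediateField.subset_adjoin _ _ hy⟩, rfl⟩)

theorem arith_basep (p : ℕ) [Fact p.Prime] {K : Type*} [Field K] [Algebra (ZMod p) K] (Y : Set K) (hY : Y.Finite)
    (hYa : ∀ y ∈ Y, IsAlgebraic (ZMod p) y) : ∃ O : Subring K, Y ⊆ O ∧ BaseSys O := by
  set L := IntermediateField.adjoin (ZMod p) Y
  haveI : FiniteDimensional (ZMod p) L := by
    haveI := hY.to_subtype
    exact IntermediateField.finiteDimensional_adjoin fun y hy => (hYa y hy).isIntegral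
  haveI : Finite L := Module.finite_of_finite (ZMod p)
  refine ⟨L.toSubalgebra.toSubring, IntermediateField.subset_adjoin _ _, 0, Fin.elim0, fun x _ _ => by simp, fun B => ?_⟩
  have : (L : Set K).Finite := Set.toFinite _
  exact this.subset fun x hx => hx.1

end Part17

section Part18

universe u

/-- the uniform statement holds over `K` -/
def GoodF (K : Type*) [Field K] : Prop :=
  ∀ (d : ℕ), 2 ≤ d → ∀ Γ : Subgroup (GL (Fin d) K), (∃ S : Set (GL (Fin d) K), S.Finite ∧ Subgroup.closure S = Γ) →
    (∀ γ ∈ Γ, (toM γ).det = 1) → Submodule.span K (toM '' (Γ : Set (GL (Fin d) K))) = ⊤ → SI Γ → UNA Γ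

/-- arithmetic bases exist over `k0` -/
def ArithB (k0 : Type*) [Field k0] : Prop :=
  ∀ (K : Type u) [Field K] [Countable K] [Algebra k0 K] (Y : Set K), Y.Finite → (∀ y ∈ Y, IsAlgebraic k0 y) →
    ∃ O : Subring K, Y ⊆ O ∧ BaseSys O

lemma sym_gen {G : Type*} [Group G] {S : Set G} (hS : S.Finite) :
    ∃ T : Set G, T.Finite ∧ 1 ∈ T ∧ (∀ s ∈ T, s⁻¹ ∈ T) ∧ Subgroup.closure T = Subgroup.closure S := by
  refine ⟨insert 1 (S ∪ S⁻¹), (hS.union hS.inv).insert _, Set.mem_insert _ _, ?_, ?_⟩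
  · intro s hs
    rcases hs with rfl | hs | hs
    · simp
    · right; right; simpa using hs
    · right; left; exact hs
  · rw [Subgroup.closure_insert_one, Subgroup.closure_union, Subgroup.closure_inv, sup_idem]

theorem goodF_of {k0 : Type*} [Field k0] (hk : ArithB.{u} k0) (K : Type u) [Field K] [Countable K]
    [Algebra k0 K] [IsAlgClosed K] (X : Set K) (hX : X.Finite)
    (hXK : ∀ z : K, IsAlgebraic (Algebra.adjoin k0 X) z) : GoodF K := by
  rintro d hd Γ ⟨S0, hS0, hcl0⟩ hdet H1 H2
  obtain ⟨S, hfin, h1, hsym, hcl⟩ := sym_gen hS0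
  rw [hcl0] at hcl
  obtain ⟨Y, hY, hYF, hYtr⟩ := trace_fg (by lia) hfin h1 hsym hcl H1
  obtain ⟨O, hYO, hO⟩ := geom_step X hX hXK Y hY
  have hle : Subring.closure Y ≤ O := Subring.closure_le.2 hYO
  rcases step_main (by lia) O _ hO Γ hdet H1 H2 (fun γ hγ => hle (hYtr γ hγ)) with h | h
  · exact h
  have hYa : ∀ y ∈ Y, IsAlgebraic k0 y := by
    intro y hy
    have := hYF (algebraicClosure k0 K).toSubfield (fun γ hγ => by
      have h' := h γ hγ
      have : (toM γ).trace ∈ algebraicClosure k0 K := mem_algebraicClosure_iff.2 (IsIntegral.isAlgebraic h')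
      exact this) hy
    exact mem_algebraicClosure_iff.1 this
  obtain ⟨O2, hYO2, hO2⟩ := hk K Y hY hYa
  have hle2 : Subring.closure Y ≤ O2 := Subring.closure_le.2 hYO2
  exact base_main hd O2 hO2 Γ hdet H1 H2 (fun γ hγ => hle2 (hYtr γ hγ))

open scoped IntermediateField.algebraAdjoinAdjoin in
theorem descend {k0 : Type*} [Field k0] [Countable k0] (hk : ArithB.{u} k0) {K : Type u} [Field K] [Algebra k0 K]
    (X : Set K) (hX : X.Finite) :
    ∃ (K1 : Type u) (_ : Field K1) (_ : IsAlgClosed K1), GoodF K1 ∧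
      Nonempty (IntermediateField.adjoin k0 X →+* K1) := by
  set L := IntermediateField.adjoin k0 X with hL
  let K1 := AlgebraicClosure L
  let XL : Set L := {l | (l : K) ∈ X}
  have hXL : XL.Finite := hX.preimage Subtype.val_injective.injOn
  let X' : Set K1 := algebraMap L K1 '' XL
  have hX' : X'.Finite := hXL.image _
  have hmem : ∀ a : Algebra.adjoin k0 X, algebraMap L K1 (algebraMap (Algebra.adjoin k0 X) L a) ∈ Algebra.adjoin k0 X' := by
    rintro ⟨a, ha⟩
    induction ha using Algebra.adjoin_induction with
    | mem x hx => exact Algebra.subset_adjoin ⟨_, hx, rfl⟩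
    | algebraMap r => exact Subalgebra.algebraMap_mem _ r
    | add x y hx hy h1 h2 =>
      have := Subalgebra.add_mem _ h1 h2
      rwa [← map_add, ← map_add] at this
    | mul x y hx hy h1 h2 =>
      have := Subalgebra.mul_mem _ h1 h2
      rwa [← map_mul, ← map_mul] at this
  let φ0 : Algebra.adjoin k0 X →+* K1 := (algebraMap L K1).comp (algebraMap (Algebra.adjoin k0 X) L)
  let ψ : Algebra.adjoin k0 X →+* Algebra.adjoin k0 X' := φ0.codRestrict _ hmem
  have hψ : Function.Injective ψ := by
    have h0 : Function.Injective φ0 := (algebraMap L K1).injective.comp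
      (Subalgebra.inclusion_injective (IntermediateField.algebra_adjoin_le_adjoin k0 X))
    intro x y h
    exact h0 (congrArg Subtype.val h)
  have hXK : ∀ z : K1, IsAlgebraic (Algebra.adjoin k0 X') z := by
    intro z
    have h1 : IsAlgebraic L z := Algebra.IsAlgebraic.isAlgebraic z
    rw [← IsFractionRing.isAlgebraic_iff (Algebra.adjoin k0 X) L K1] at h1
    obtain ⟨p, hp0, hp⟩ := h1
    refine ⟨p.map ψ, (Polynomial.map_ne_zero_iff hψ).2 hp0, ?_⟩
    rw [Polynomial.aeval_def, Polynomial.eval₂_map]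
    exact hp
  haveI : Countable (Algebra.adjoin k0 X') := by
    have hr := Algebra.adjoin_eq_range k0 X'
    haveI := hX'.to_subtype
    have hc : Countable (MvPolynomial X' k0) := by
      rw [← Cardinal.mk_le_aleph0_iff]
      refine (MvPolynomial.cardinalMk_le_max_lift).trans ?_
      simp [Cardinal.mk_le_aleph0]
    rw [hr]
    exact (Set.countable_range (MvPolynomial.aeval (fun x : X' => (x : K1)) : MvPolynomial X' k0 → K1)).to_subtype
  haveI : Countable K1 := by
    have := Algebraic.countable (Algebra.adjoin k0 X') K1
    rw [← Set.countable_univ_iff]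
    exact this.mono fun z _ => hXK z
  exact ⟨K1, inferInstance, inferInstance, goodF_of hk K1 X' hX' hXK, ⟨algebraMap L K1⟩⟩

lemma arithB_rat : ArithB.{u} ℚ := fun K _ _ _ Y hY h => arith_base0 Y hY h

lemma arithB_zmod (p : ℕ) [Fact p.Prime] : ArithB.{u} (ZMod p) := fun K _ _ _ Y hY h => arith_basep p Y hY h

theorem descend' {K : Type u} [Field K] (X : Set K) (hX : X.Finite) :
    ∃ (K1 : Type u) (_ : Field K1) (_ : IsAlgClosed K1) (L : Subfield K), GoodF K1 ∧ X ⊆ L ∧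
      Nonempty (L →+* K1) := by
  obtain ⟨p, hp⟩ := CharP.exists K
  rcases CharP.char_is_prime_or_zero K p with h | h
  · haveI := Fact.mk h
    letI := ZMod.algebra K p
    obtain ⟨K1, i1, i2, hg, hf⟩ := descend (arithB_zmod p) X hX
    exact ⟨K1, i1, i2, (IntermediateField.adjoin (ZMod p) X).toSubfield, hg, IntermediateField.subset_adjoin _ _, hf⟩
  · subst h
    haveI : CharZero K := CharP.charP_to_charZero K
    obtain ⟨K1, i1, i2, hg, hf⟩ := descend arithB_rat X hX
    exact ⟨K1, i1, i2, (IntermediateField.adjoin ℚ X).toSubfield, hg, IntermediateField.subset_adjoin _ _, hf⟩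

theorem descend_gp {K : Type u} [Field K] {n : ℕ} (Γ : Subgroup (GL (Fin n) K)) (hfg : Group.FG Γ) :
    ∃ (K1 : Type u) (_ : Field K1) (_ : IsAlgClosed K1) (ρ : Γ →* GL (Fin n) K1), GoodF K1 ∧ Function.Injective ρ := by
  rw [Group.fg_iff_subgroup_fg] at hfg
  obtain ⟨S, hS⟩ := hfg
  let X : Set K := ⋃ g ∈ S, ⋃ i, ⋃ j, {(g : GL (Fin n) K).1 i j, (g : GL (Fin n) K)⁻¹.1 i j}
  have hX : X.Finite := by
    refine S.finite_toSet.biUnion fun g _ => Set.finite_iUnion fun i => Set.finite_iUnion fun j => ?_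
    exact Set.toFinite _
  obtain ⟨K1, i1, i2, L, hg, hXL, ⟨f⟩⟩ := descend' X hX
  let φ : GL (Fin n) L →* GL (Fin n) K := Matrix.GeneralLinearGroup.map L.subtype
  have hmapinj : ∀ {A B : Type u} [Field A] [Field B] (f : A →+* B), Function.Injective (Matrix.GeneralLinearGroup.map (n := Fin n) f) := by
    intro A B _ _ f g h e
    apply Units.ext
    ext i j
    apply f.injective
    rw [← Matrix.GeneralLinearGroup.map_apply, ← Matrix.GeneralLinearGroup.map_apply, e]
  have hφ : Function.Injective φ := hmapinj _
  have hle : Γ ≤ φ.range := by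
    rw [← hS, Subgroup.closure_le]
    intro g hg
    have hm1 : ∀ i j, g.1 i j ∈ L := fun i j => hXL (by
      simp only [X, Set.mem_iUnion]; exact ⟨g, hg, i, j, Or.inl rfl⟩)
    have hm2 : ∀ i j, g⁻¹.1 i j ∈ L := fun i j => hXL (by
      simp only [X, Set.mem_iUnion]; exact ⟨g, hg, i, j, Or.inr rfl⟩)
    have hsub : Function.Injective (L.subtype.mapMatrix : Matrix (Fin n) (Fin n) L →+* _) :=
      Matrix.map_injective L.subtype.injective
    let A : Matrix (Fin n) (Fin n) L := fun i j => ⟨g.1 i j, hm1 i j⟩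
    let B : Matrix (Fin n) (Fin n) L := fun i j => ⟨g⁻¹.1 i j, hm2 i j⟩
    have hA : L.subtype.mapMatrix A = g.1 := by ext i j; rfl
    have hB : L.subtype.mapMatrix B = g⁻¹.1 := by ext i j; rfl
    refine ⟨⟨A, B, hsub ?_, hsub ?_⟩, ?_⟩
    · rw [map_mul, hA, hB, map_one]; exact g.mul_inv
    · rw [map_mul, hA, hB, map_one]; exact g.inv_mul
    · exact Units.ext hA
  let e := MonoidHom.ofInjective hφ
  refine ⟨K1, i1, i2, (Matrix.GeneralLinearGroup.map f).comp (e.symm.toMonoidHom.comp (Subgroup.inclusion hle)), hg, ?_⟩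
  exact (hmapinj f).comp (e.symm.injective.comp (Subgroup.inclusion_injective hle))

end Part18

section Part19

section Unip
open scoped commutatorElement
variable {H A : Type*} [Group H] [Ring A]

/-- congruence subgroup of an ideal -/
def congSub (f : H →* A) (I : Ideal A) [I.IsTwoSided] : Subgroup H :=
  ((Ideal.Quotient.mk I).toMonoidHom.comp f).ker

lemma mem_congSub {f : H →* A} {I : Ideal A} [I.IsTwoSided] {h : H} : h ∈ congSub f I ↔ f h - 1 ∈ I := by
  rw [congSub, MonoidHom.mem_ker, ← Ideal.Quotient.eq, map_one]
  rfl

lemma comm_congSub {f : H →* A} {I : Ideal A} [I.IsTwoSided] {x y : H} (h : f x * f y - f y * f x ∈ I) :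
    ⁅x, y⁆ ∈ congSub f I := by
  rw [mem_congSub]
  have e : f ⁅x, y⁆ - 1 = (f x * f y - f y * f x) * f (x⁻¹ * y⁻¹) := by
    rw [sub_mul, ← map_mul, ← map_mul, ← map_mul, ← map_mul, commutatorElement_def]
    congr 1
    · congr 1; group
    · rw [show y * x * (x⁻¹ * y⁻¹) = 1 by group, map_one]
  rw [e]
  exact I.mul_mem_right _ h

lemma solvable_of (f : H →* A) (hf : Function.Injective f) (J : Ideal A) [J.IsTwoSided] (N : ℕ)
    (hN : J ^ N = 0) (hcomm : ∀ x y : H, f x * f y - f y * f x ∈ J) : IsSolvable H := by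
  have key : ∀ k, derivedSeries H (k + 1) ≤ congSub f J ⊓ congSub f (J ^ k) := by
    intro k
    induction k with
    | zero =>
      rw [derivedSeries_succ, Subgroup.commutator_le]
      intro x _ y _
      refine ⟨comm_congSub (hcomm x y), comm_congSub ?_⟩
      rw [Submodule.pow_zero, Ideal.one_eq_top]; trivial
    | succ k ih =>
      rw [derivedSeries_succ, Subgroup.commutator_le]
      intro x hx y hy
      have hx' := ih hx
      have hy' := ih hy
      have x1 := mem_congSub.1 hx'.1
      have x2 := mem_congSub.1 hx'.2
      have y1 := mem_congSub.1 hy'.1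
      have y2 := mem_congSub.1 hy'.2
      refine ⟨comm_congSub (hcomm x y), comm_congSub ?_⟩
      have e : f x * f y - f y * f x = (f x - 1) * (f y - 1) - (f y - 1) * (f x - 1) := by noncomm_ring
      rw [e, Submodule.pow_succ]
      exact Ideal.sub_mem _ (Ideal.mul_mem_mul x2 y1) (Ideal.mul_mem_mul y2 x1)
  refine ⟨N + 1, ?_⟩
  rw [eq_bot_iff]
  intro h hh
  have := mem_congSub.1 (key N hh).2
  rw [hN] at this
  have h0 : f h - 1 = 0 := by simpa using this
  rw [sub_eq_zero, ← map_one f] at h0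
  exact hf h0
end Unip

/-- representation all of whose restrictions to finite index subgroups are irreducible -/
theorem exists_rep {G : Type*} [Group G] {K : Type*} [Field K] [IsAlgClosed K] {n : ℕ} (ρ : G →* GL (Fin n) K)
    (hρ : Function.Injective ρ) (hns : ¬ ∃ H : Subgroup G, H.FiniteIndex ∧ IsSolvable H) :
    ∃ H0 : Subgroup G, H0.FiniteIndex ∧ ∃ d : ℕ, 2 ≤ d ∧ ∃ φ : H0 →* GL (Fin d) K,
      ∀ H : Subgroup H0, H.FiniteIndex → Submodule.span K (toM '' (φ '' (H : Set H0))) = ⊤ := by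
  classical
  let M := Matrix (Fin n) (Fin n) K
  let sp : Subgroup G → Submodule K M := fun H => Submodule.span K ((fun g => toM (ρ g)) '' (H : Set G))
  have hex : ∃ k, ∃ H : Subgroup G, H.FiniteIndex ∧ Module.finrank K (sp H) = k := ⟨_, ⊤, inferInstance, rfl⟩
  obtain ⟨H0, hH0, hk⟩ := Nat.find_spec hex
  have hmin : ∀ H : Subgroup G, H.FiniteIndex → H ≤ H0 → sp H = sp H0 := by
    intro H hH hle
    refine Submodule.eq_of_le_of_finrank_le (Submodule.span_mono (Set.image_mono hle)) ?_
    rw [hk]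
    exact Nat.find_min' hex ⟨H, hH, rfl⟩
  refine ⟨H0, hH0, ?_⟩
  let A : Subalgebra K M := Algebra.adjoin K ((fun g => toM (ρ g)) '' (H0 : Set G))
  have hmem : ∀ h : H0, toM (ρ h) ∈ A := fun h => Algebra.subset_adjoin ⟨h, h.2, rfl⟩
  have hAsp : Subalgebra.toSubmodule A = sp H0 := by
    rw [Algebra.adjoin_eq_span]
    congr 1
    apply le_antisymm
    · rintro x hx
      induction hx using Submonoid.closure_induction with
      | mem x hx => exact hx
      | one => exact ⟨1, H0.one_mem, by simp [toM]⟩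
      | mul x y _ _ h1 h2 =>
        obtain ⟨a, ha, rfl⟩ := h1
        obtain ⟨b, hb, rfl⟩ := h2
        exact ⟨a * b, H0.mul_mem ha hb, by simp [toM]⟩
    · exact Submonoid.subset_closure
  let f : H0 →* A :=
    { toFun := fun h => ⟨toM (ρ h), hmem h⟩
      map_one' := Subtype.ext (by simp [toM])
      map_mul' := fun a b => Subtype.ext (by simp [toM]) }
  have hf : Function.Injective f := fun a b h => Subtype.ext (hρ (Units.ext (congrArg Subtype.val h)))
  haveI : IsArtinianRing A := IsArtinianRing.of_finite K A
  obtain ⟨N, hN⟩ := IsSemiprimaryRing.isNilpotent (R := A)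
  obtain ⟨r, d, hd, ⟨e⟩⟩ := IsSemisimpleRing.exists_algEquiv_pi_matrix_of_isAlgClosed K (A ⧸ Ring.jacobson A)
  by_cases hall : ∀ i, d i ≤ 1
  · exfalso
    refine hns ⟨H0, hH0, solvable_of f hf (Ring.jacobson A) N hN fun x y => ?_⟩
    rw [← Ideal.Quotient.eq]
    apply e.injective
    rw [map_mul, map_mul, map_mul, map_mul]
    funext i
    have : Subsingleton (Fin (d i)) := Fin.subsingleton_iff_le_one.2 (hall i)
    ext a b
    simp only [Pi.mul_apply, Matrix.mul_apply]
    refine Finset.sum_congr rfl fun c _ => ?_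
    rw [Subsingleton.elim c a, Subsingleton.elim b a, mul_comm]
  push Not at hall
  obtain ⟨i, hi⟩ := hall
  let π : A →ₐ[K] Matrix (Fin (d i)) (Fin (d i)) K :=
    (Pi.evalAlgHom K (fun i => Matrix (Fin (d i)) (Fin (d i)) K) i).comp
      (e.toAlgHom.comp (Ideal.Quotient.mkₐ K (Ring.jacobson A)))
  have hπ : Function.Surjective π := by
    intro x
    obtain ⟨a, ha⟩ := Ideal.Quotient.mkₐ_surjective K (Ring.jacobson A) (e.symm (Pi.single i x))
    refine ⟨a, ?_⟩
    change e (Ideal.Quotient.mkₐ K (Ring.jacobson A) a) i = x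
    rw [ha, e.apply_symm_apply, Pi.single_eq_same]
  let φ : H0 →* GL (Fin (d i)) K := (Units.map π.toRingHom.toMonoidHom).comp f.toHomUnits
  have hφ : ∀ h, toM (φ h) = π (f h) := fun h => rfl
  refine ⟨d i, hi, φ, fun H hH => ?_⟩
  have hH' : (H.map H0.subtype).FiniteIndex := by
    refine ⟨?_⟩
    rw [Subgroup.index_map_subtype]
    exact mul_ne_zero hH.index_ne_zero hH0.index_ne_zero
  have hs := hmin (H.map H0.subtype) hH' (Subgroup.map_subtype_le _)
  have htop : Submodule.span K (f '' (H : Set H0)) = ⊤ := by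
    apply Submodule.map_injective_of_injective (f := A.val.toLinearMap) Subtype.val_injective
    rw [Submodule.map_span, Submodule.map_top]
    have e1 : A.val.toLinearMap '' (f '' (H : Set H0)) = (fun g => toM (ρ g)) '' (H.map H0.subtype : Set G) := by
      ext x
      constructor
      · rintro ⟨_, ⟨h, hh, rfl⟩, rfl⟩
        exact ⟨h, ⟨h, hh, rfl⟩, rfl⟩
      · rintro ⟨_, ⟨h, hh, rfl⟩, rfl⟩
        exact ⟨_, ⟨h, hh, rfl⟩, rfl⟩
    rw [e1]
    refine hs.trans (hAsp.symm.trans ?_)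
    ext x
    exact ⟨fun hx => ⟨⟨x, hx⟩, rfl⟩, fun ⟨y, hy⟩ => hy ▸ y.2⟩
  have e2 : toM '' (φ '' (H : Set H0)) = π.toLinearMap '' (f '' (H : Set H0)) := by
    rw [Set.image_image, Set.image_image]
    rfl
  rw [e2, ← Submodule.map_span, htop, Submodule.map_top, LinearMap.range_eq_top]
  exact hπ

end Part19

section Part20

section Proj
variable {K : Type*} [Field K] {d : ℕ} {H : Type*} [Group H]

/-- normalised determinant one multiples of the image of a set -/
def slSet (φ : H →* GL (Fin d) K) (T : Set H) : Set (GL (Fin d) K) :=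
  {g | (toM g).det = 1 ∧ ∃ h ∈ T, ∃ c : K, c ≠ 0 ∧ toM g = c • toM (φ h)}

lemma toM_mul (g h : GL (Fin d) K) : toM (g * h) = toM g * toM h := rfl
lemma toM_one : toM (1 : GL (Fin d) K) = 1 := rfl
lemma toM_inj {g h : GL (Fin d) K} (e : toM g = toM h) : g = h := Units.ext e
lemma toM_inv_mul (g : GL (Fin d) K) : toM g⁻¹ * toM g = 1 := by
  rw [← toM_mul, inv_mul_cancel]; rfl
lemma toM_mul_inv (g : GL (Fin d) K) : toM g * toM g⁻¹ = 1 := by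
  rw [← toM_mul, mul_inv_cancel]; rfl
lemma toM_det_ne (g : GL (Fin d) K) : (toM g).det ≠ 0 := by
  have : (toM g).det * (toM g⁻¹).det = 1 := by rw [← det_mul, toM_mul_inv, det_one]
  exact left_ne_zero_of_mul_eq_one this

lemma slSet_one (φ : H →* GL (Fin d) K) {T : Set H} (h : 1 ∈ T) : 1 ∈ slSet φ T :=
  ⟨by rw [toM_one, det_one], 1, h, 1, one_ne_zero, by rw [map_one, one_smul]⟩

lemma slSet_mul (φ : H →* GL (Fin d) K) {T U V : Set H} (hTU : ∀ x ∈ T, ∀ y ∈ U, x * y ∈ V) {a b : GL (Fin d) K}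
    (ha : a ∈ slSet φ T) (hb : b ∈ slSet φ U) : a * b ∈ slSet φ V := by
  obtain ⟨ha1, x, hx, c, hc, e⟩ := ha
  obtain ⟨hb1, y, hy, c', hc', e'⟩ := hb
  refine ⟨by rw [toM_mul, det_mul, ha1, hb1, one_mul], x * y, hTU x hx y hy, c * c', mul_ne_zero hc hc', ?_⟩
  rw [toM_mul, e, e', map_mul, toM_mul, smul_mul_smul_comm]

lemma slSet_inv (φ : H →* GL (Fin d) K) {T : Set H} (hT : ∀ x ∈ T, x⁻¹ ∈ T) {a : GL (Fin d) K}
    (ha : a ∈ slSet φ T) : a⁻¹ ∈ slSet φ T := by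
  obtain ⟨ha1, x, hx, c, hc, e⟩ := ha
  refine ⟨?_, x⁻¹, hT x hx, c⁻¹, inv_ne_zero hc, ?_⟩
  · have : (toM a⁻¹).det * (toM a).det = 1 := by rw [← det_mul, toM_inv_mul, det_one]
    rwa [ha1, mul_one] at this
  · have h1 : toM a * (c⁻¹ • toM (φ x⁻¹)) = 1 := by
      rw [e, smul_mul_smul_comm, mul_inv_cancel₀ hc, one_smul, map_inv, toM_mul_inv]
    calc toM a⁻¹ = toM a⁻¹ * (toM a * (c⁻¹ • toM (φ x⁻¹))) := by rw [h1, mul_one]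
      _ = _ := by rw [← mul_assoc, toM_inv_mul, one_mul]

lemma slSet_exists [IsAlgClosed K] (hd : 1 ≤ d) (φ : H →* GL (Fin d) K) (h : H) :
    ∃ g ∈ slSet φ {h}, ∃ c : K, c ≠ 0 ∧ toM g = c • toM (φ h) := by
  obtain ⟨c, hc⟩ := IsAlgClosed.exists_pow_nat_eq ((toM (φ h)).det)⁻¹ (show 0 < d by lia)
  have hc0 : c ≠ 0 := by
    rintro rfl
    rw [zero_pow (by lia)] at hc
    exact inv_ne_zero (toM_det_ne _) hc.symm
  have hdet : (c • toM (φ h)).det = 1 := by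
    rw [det_smul, Fintype.card_fin, hc, inv_mul_cancel₀ (toM_det_ne _)]
  let g : GL (Fin d) K := Matrix.GeneralLinearGroup.mkOfDetNeZero (c • toM (φ h)) (by rw [hdet]; exact one_ne_zero)
  have hg : toM g = c • toM (φ h) := rfl
  exact ⟨g, ⟨by rw [hg, hdet], h, rfl, c, hc0, hg⟩, c, hc0, hg⟩

lemma slSet_mono (φ : H →* GL (Fin d) K) {T U : Set H} (h : T ⊆ U) : slSet φ T ⊆ slSet φ U := by
  rintro g ⟨h1, x, hx, r⟩
  exact ⟨h1, x, h hx, r⟩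

lemma slSet_finite (hd : 1 ≤ d) (φ : H →* GL (Fin d) K) {T : Set H} (hT : T.Finite) : (slSet φ T).Finite := by
  have hfin : (⋃ h ∈ T, (fun c : K => c • toM (φ h)) '' {c : K | c ^ d = ((toM (φ h)).det)⁻¹}).Finite := by
    refine hT.biUnion fun h _ => Set.Finite.image _ ?_
    have := Polynomial.finite_setOf_isRoot (p := (Polynomial.X ^ d - Polynomial.C ((toM (φ h)).det)⁻¹ : Polynomial K))
      (Polynomial.X_pow_sub_C_ne_zero (by lia) _)
    refine this.subset fun c hc => ?_
    simp only [Set.mem_setOf_eq] at hc ⊢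
    simp [Polynomial.IsRoot, hc]
  refine (hfin.preimage (f := toM) (fun a _ b _ e => toM_inj e)).subset ?_
  rintro g ⟨h1, x, hx, c, hc, e⟩
  simp only [Set.mem_preimage, Set.mem_iUnion]
  refine ⟨x, hx, c, ?_, e.symm⟩
  rw [e, det_smul, Fintype.card_fin] at h1
  exact eq_inv_of_mul_eq_one_left h1

/-- the normalised group -/
def slGrp (φ : H →* GL (Fin d) K) : Subgroup (GL (Fin d) K) where
  carrier := slSet φ Set.univ
  one_mem' := slSet_one φ (Set.mem_univ _)
  mul_mem' := fun ha hb => slSet_mul φ (fun _ _ _ _ => Set.mem_univ _) ha hb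
  inv_mem' := fun ha => slSet_inv φ (fun _ _ => Set.mem_univ _) ha

lemma slGrp_closure [IsAlgClosed K] (hd : 1 ≤ d) (φ : H →* GL (Fin d) K) {T : Set H} (h1 : 1 ∈ T)
    (hcl : Subgroup.closure T = ⊤) (hsym : ∀ s ∈ T, s⁻¹ ∈ T) : Subgroup.closure (slSet φ T) = slGrp φ := by
  apply le_antisymm
  · rw [Subgroup.closure_le]
    exact slSet_mono φ (Set.subset_univ _)
  · have key : ∀ n, ∀ h ∈ T ^ n, ∃ g ∈ Subgroup.closure (slSet φ T), (toM g).det = 1 ∧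
        ∃ c : K, c ≠ 0 ∧ toM g = c • toM (φ h) := by
      intro n
      induction n with
      | zero =>
        intro h hh
        have : h = 1 := by simpa using hh
        subst this
        exact ⟨1, Subgroup.one_mem _, by rw [toM_one, det_one], 1, one_ne_zero, by rw [map_one, one_smul]⟩
      | succ n ih =>
        intro h hh
        rw [pow_succ] at hh
        obtain ⟨x, hx, y, hy, rfl⟩ := hh
        obtain ⟨g, hg, hdet, c, hc, e⟩ := ih x hx
        obtain ⟨g', hg', c', hc', e'⟩ := slSet_exists hd φ y
        refine ⟨g * g', Subgroup.mul_mem _ hg (Subgroup.subset_closure (slSet_mono φ (by simpa using hy) hg')), ?_,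
          c * c', mul_ne_zero hc hc', ?_⟩
        · rw [toM_mul, det_mul, hdet, hg'.1, one_mul]
        · change toM (g * g') = (c * c') • toM (φ (x * y))
          rw [toM_mul, e, e', map_mul, toM_mul, smul_mul_smul_comm]
    rintro g ⟨hdet, h, -, c, hc, e⟩
    obtain ⟨n, hn⟩ := mem_closure_pow hsym (hcl ▸ Subgroup.mem_top h : h ∈ Subgroup.closure T)
    obtain ⟨g', hg', hdet', c', hc', e'⟩ := key n h hn
    have hz : g * g'⁻¹ ∈ slSet φ T := by
      refine ⟨?_, 1, h1, c * c'⁻¹, mul_ne_zero hc (inv_ne_zero hc'), ?_⟩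
      · have : (toM g'⁻¹).det * (toM g').det = 1 := by rw [← det_mul, toM_inv_mul, det_one]
        rw [hdet', mul_one] at this
        rw [toM_mul, det_mul, hdet, this, one_mul]
      · have e3 : toM (φ h) = c'⁻¹ • toM g' := by rw [e', smul_smul, inv_mul_cancel₀ hc', one_smul]
        rw [toM_mul, e, e3, smul_smul, smul_mul_assoc, toM_mul_inv, map_one, toM_one]
    have : g = (g * g'⁻¹) * g' := by group
    rw [this]
    exact Subgroup.mul_mem _ (Subgroup.subset_closure hz) hg'

lemma slGrp_span [IsAlgClosed K] (hd : 1 ≤ d) (φ : H →* GL (Fin d) K)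
    (h : Submodule.span K (toM '' (φ '' ((⊤ : Subgroup H) : Set H))) = ⊤) :
    Submodule.span K (toM '' (slGrp φ : Set (GL (Fin d) K))) = ⊤ := by
  rw [eq_top_iff, ← h, Submodule.span_le]
  rintro _ ⟨_, ⟨x, -, rfl⟩, rfl⟩
  obtain ⟨g, hg, c, hc, e⟩ := slSet_exists hd φ x
  have e3 : toM (φ x) = c⁻¹ • toM g := by rw [e, smul_smul, inv_mul_cancel₀ hc, one_smul]
  rw [e3]
  exact Submodule.smul_mem _ _ (Submodule.subset_span ⟨g, slSet_mono φ (Set.subset_univ _) hg, rfl⟩)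

lemma slGrp_SI [IsAlgClosed K] (hd : 1 ≤ d) (φ : H →* GL (Fin d) K)
    (hφ : ∀ U : Subgroup H, U.FiniteIndex → Submodule.span K (toM '' (φ '' (U : Set H))) = ⊤) : SI (slGrp φ) := by
  intro F hF hFs W hW y x hx
  let act : H → Submodule K (Matrix (Fin d) (Fin d) K) → Submodule K (Matrix (Fin d) (Fin d) K) :=
    fun h W => W.comap (LinearMap.mulLeft K (toM (φ h)))
  have hact : ∀ h W z, z ∈ act h W ↔ toM (φ h) * z ∈ W := fun h W z => Iff.rfl
  have hFact : ∀ h, ∀ W ∈ F, act h W ∈ F := by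
    intro h W hW
    obtain ⟨g, hg, c, hc, e⟩ := slSet_exists hd φ h
    have := hFs W hW g (slSet_mono φ (Set.subset_univ _) hg)
    convert this using 1
    ext z
    rw [hact, Submodule.mem_comap, LinearMap.mulLeft_apply, e, smul_mul_assoc, Submodule.smul_mem_iff _ hc]
  letI inst : MulAction H (Submodule K (Matrix (Fin d) (Fin d) K)) :=
    { smul := fun h W => act h⁻¹ W
      one_smul := fun W => by
        change act 1⁻¹ W = W
        ext z; rw [hact, inv_one, map_one, toM_one, one_mul]
      mul_smul := fun a b W => by
        change act (a * b)⁻¹ W = act a⁻¹ (act b⁻¹ W)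
        ext z; rw [hact, hact, hact, _root_.mul_inv_rev, map_mul, toM_mul, mul_assoc] }
  let U := MulAction.stabilizer H W
  have hU : U.FiniteIndex := by
    refine ⟨?_⟩
    rw [MulAction.index_stabilizer]
    have hsub : MulAction.orbit H W ⊆ F := by
      rintro _ ⟨h, rfl⟩
      exact hFact h⁻¹ W hW
    exact Set.ncard_ne_zero_of_mem (MulAction.mem_orbit_self W) (hF.subset hsub)
  have hy : y ∈ Submodule.span K (toM '' (φ '' (U : Set H))) := by rw [hφ U hU]; trivial
  induction hy using Submodule.span_induction with
  | mem y hy =>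
    obtain ⟨_, ⟨u, hu, rfl⟩, rfl⟩ := hy
    have hu' : u⁻¹ ∈ U := U.inv_mem hu
    have h2 : act u⁻¹⁻¹ W = W := hu'
    rw [inv_inv] at h2
    rw [← hact, h2]; exact hx
  | zero => rw [zero_mul]; exact W.zero_mem
  | add a b _ _ ha hb => rw [add_mul]; exact W.add_mem ha hb
  | smul c a _ ha => rw [smul_mul_assoc]; exact W.smul_mem c ha
end Proj

end Part20

section Schreier
variable {G : Type*} [Group G]

/-- balls saturate the coset space -/
lemma coset_saturate (H : Subgroup G) [H.FiniteIndex] {S : Set G} (h1 : 1 ∈ S) (hsym : ∀ s ∈ S, s⁻¹ ∈ S)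
    (hcl : Subgroup.closure S = ⊤) (c : G ⧸ H) : ∃ s ∈ S ^ H.index, (QuotientGroup.mk s : G ⧸ H) = c := by
  haveI : Finite (G ⧸ H) := inferInstance
  let X : ℕ → Set (G ⧸ H) := fun k => QuotientGroup.mk '' (S ^ k)
  have hmono : Monotone X := fun a b hab => Set.image_mono (Set.pow_subset_pow_right h1 hab)
  have hstep : ∀ k l, X k ⊆ X l → X (k + 1) ⊆ X (l + 1) := by
    rintro k l h _ ⟨x, hx, rfl⟩
    rw [pow_succ'] at hx
    obtain ⟨s, hs, y, hy, rfl⟩ := hx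
    obtain ⟨z, hz, e⟩ := h ⟨y, hy, rfl⟩
    refine ⟨s * z, ?_, ?_⟩
    · rw [pow_succ']; exact ⟨s, hs, z, hz, rfl⟩
    · rw [QuotientGroup.eq] at e ⊢
      have : (s * z)⁻¹ * (s * y) = z⁻¹ * y := by group
      rw [this]; exact e
  have hstall : ∃ k ≤ H.index, X (k + 1) ⊆ X k := by
    by_contra hcon
    push Not at hcon
    have hcard : ∀ k ≤ H.index + 1, k ≤ (X k).ncard := by
      intro k
      induction k with
      | zero => intro _; exact Nat.zero_le _
      | succ k ih =>
        intro hk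
        have := ih (by lia)
        have hlt : X k ⊂ X (k + 1) := ⟨hmono (Nat.le_succ k), hcon k (by lia)⟩
        have := Set.ncard_lt_ncard hlt (Set.toFinite _)
        lia
    have h2 := hcard _ le_rfl
    have h3 : (X (H.index + 1)).ncard ≤ H.index := by
      rw [Subgroup.index, ← Set.ncard_univ]
      exact Set.ncard_le_ncard (Set.subset_univ _) (Set.toFinite _)
    lia
  obtain ⟨k, hk, hst⟩ := hstall
  have hall : ∀ j, X (k + j) ⊆ X k := by
    intro j
    induction j with
    | zero => exact subset_rfl
    | succ j ih => exact (hstep _ _ ih).trans hst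
  obtain ⟨g, rfl⟩ := QuotientGroup.mk_surjective c
  obtain ⟨l, hl⟩ := mem_closure_pow hsym (hcl ▸ Subgroup.mem_top g : g ∈ Subgroup.closure S)
  have : (QuotientGroup.mk g : G ⧸ H) ∈ X k := hall l (hmono (Nat.le_add_left l k) ⟨g, hl, rfl⟩)
  obtain ⟨s, hs, e⟩ := hmono hk this
  exact ⟨s, hs, e⟩

lemma exists_retract (H : Subgroup G) [H.FiniteIndex] {S : Set G} (h1 : 1 ∈ S) (hsym : ∀ s ∈ S, s⁻¹ ∈ S)
    (hcl : Subgroup.closure S = ⊤) :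
    ∃ r : G → G, (∀ g, r g ∈ S ^ H.index) ∧ (∀ g, g * (r g)⁻¹ ∈ H) ∧ ∀ h ∈ H, ∀ g, r (h * g) = r g := by
  choose rep hrep1 hrep2 using coset_saturate H h1 hsym hcl
  refine ⟨fun g => (rep (QuotientGroup.mk g⁻¹))⁻¹, fun g => inv_mem_pow hsym (hrep1 _), fun g => ?_, fun h hh g => ?_⟩
  · have := hrep2 (QuotientGroup.mk g⁻¹)
    rw [eq_comm, QuotientGroup.eq, inv_inv] at this
    rwa [inv_inv]
  · have : (QuotientGroup.mk (h * g)⁻¹ : G ⧸ H) = QuotientGroup.mk g⁻¹ := by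
      rw [QuotientGroup.eq, inv_inv]
      have e : h * g * g⁻¹ = h := by group
      rw [e]; exact hh
    simp only [this]

lemma schreier (H : Subgroup G) [H.FiniteIndex] {S : Set G} (h1 : 1 ∈ S) (hsym : ∀ s ∈ S, s⁻¹ ∈ S)
    (hcl : Subgroup.closure S = ⊤) :
    Subgroup.closure {h : H | (h : G) ∈ S ^ (2 * H.index + 1)} = ⊤ := by
  obtain ⟨r, hr1, hr2, hr3⟩ := exists_retract H h1 hsym hcl
  set q := H.index
  set T : Set H := {h : H | (h : G) ∈ S ^ (2 * q + 1)} with hT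
  let τ : G → H := fun g => ⟨g * (r g)⁻¹, hr2 g⟩
  have hone : τ 1 ∈ T := by
    change (1 : G) * (r 1)⁻¹ ∈ S ^ (2 * q + 1)
    rw [one_mul]
    exact Set.pow_subset_pow_right h1 (by lia) (inv_mem_pow hsym (hr1 1))
  have hmem : ∀ k, ∀ g ∈ S ^ k, τ g ∈ Subgroup.closure T := by
    intro k
    induction k with
    | zero =>
      intro g hg
      have : g = 1 := by simpa using hg
      rw [this]; exact Subgroup.subset_closure hone
    | succ k ih =>
      intro g hg
      rw [pow_succ] at hg
      obtain ⟨x, hx, s, hs, rfl⟩ := hg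
      have e : τ (x * s) = τ x * ((τ x)⁻¹ * τ (x * s)) := by group
      change τ (x * s) ∈ _
      rw [e]
      refine Subgroup.mul_mem _ (ih x hx) (Subgroup.subset_closure ?_)
      change (x * (r x)⁻¹)⁻¹ * (x * s * (r (x * s))⁻¹) ∈ S ^ (2 * q + 1)
      have e2 : (x * (r x)⁻¹)⁻¹ * (x * s * (r (x * s))⁻¹) = r x * s * (r (x * s))⁻¹ := by group
      have e3 : S ^ (2 * q + 1) = S ^ q * S * S ^ q := by
        rw [← pow_succ, ← pow_add]; congr 1; lia
      rw [e2, e3]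
      exact Set.mul_mem_mul (Set.mul_mem_mul (hr1 x) hs) (inv_mem_pow hsym (hr1 _))
  rw [eq_top_iff]
  intro h _
  obtain ⟨k, hk⟩ := mem_closure_pow hsym (hcl ▸ Subgroup.mem_top (h : G) : (h : G) ∈ Subgroup.closure S)
  have h2 : τ (h : G) = h * τ 1 := by
    apply Subtype.ext
    change (h : G) * (r h)⁻¹ = h * (1 * (r 1)⁻¹)
    have := hr3 h h.2 1
    rw [mul_one] at this
    rw [this, one_mul]
  have h3 : h = τ (h : G) * (τ 1)⁻¹ := by rw [h2]; group
  rw [h3]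
  exact Subgroup.mul_mem _ (hmem k _ hk) (Subgroup.inv_mem _ (Subgroup.subset_closure hone))
end Schreier

section Count
variable {G : Type*} [Group G]

/-- normalised counting measure -/
noncomputable def countFAM {X : Type*} (A : Set X) (hA : A.Finite) (hne : A.Nonempty) : FAM X where
  m Y := ((A ∩ Y).ncard : ℝ) / A.ncard
  nonneg Y := by positivity
  univ := by
    rw [Set.inter_univ]
    have := (Set.ncard_pos hA).2 hne
    exact div_self (by exact_mod_cast this.ne')
  add s t h := by
    rw [Set.inter_union_distrib_left, Set.ncard_union_eq (h.mono Set.inter_subset_right Set.inter_subset_right)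
      (hA.subset Set.inter_subset_left) (hA.subset Set.inter_subset_left)]
    push_cast
    rw [add_div]

lemma count_diff (A : Set G) (hA : A.Finite) (S : Finset G) {s : G} (hs : s ∈ S) (Z : Set G) :
    |((A ∩ {a | s * a ∈ Z}).ncard : ℝ) - ((A ∩ Z).ncard : ℝ)| ≤
      ((A \ ⋂ s ∈ S, (fun x : G => s * x) '' A).ncard : ℝ) := by
  set sA := (fun x : G => s * x) '' A with hsA
  have hinj : Function.Injective (fun x : G => s * x) := mul_right_injective s
  have hsAf : sA.Finite := hA.image _
  have hcard : sA.ncard = A.ncard := Set.ncard_image_of_injective _ hinj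
  have e1 : (A ∩ {a | s * a ∈ Z}).ncard = (sA ∩ Z).ncard := by
    rw [← Set.ncard_image_of_injective _ hinj]
    congr 1
    ext x
    constructor
    · rintro ⟨a, ⟨ha, haZ⟩, rfl⟩
      exact ⟨⟨a, ha, rfl⟩, haZ⟩
    · rintro ⟨⟨a, ha, rfl⟩, hZ⟩
      exact ⟨a, ⟨ha, hZ⟩, rfl⟩
  have hd1 : (A \ sA).ncard ≤ (A \ ⋂ s ∈ S, (fun x : G => s * x) '' A).ncard := by
    refine Set.ncard_le_ncard (fun x hx => ⟨hx.1, fun h => hx.2 ?_⟩) (hA.subset Set.diff_subset)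
    exact Set.mem_iInter₂.1 h s hs
  have hd2 : (sA \ A).ncard = (A \ sA).ncard := by
    have a1 := Set.ncard_inter_add_ncard_diff_eq_ncard sA A hsAf
    have a2 := Set.ncard_inter_add_ncard_diff_eq_ncard A sA hA
    rw [Set.inter_comm] at a2
    lia
  have b1 : (sA ∩ Z).ncard ≤ (A ∩ Z).ncard + (sA \ A).ncard := by
    refine (Set.ncard_le_ncard (t := (A ∩ Z) ∪ (sA \ A)) ?_ ?_).trans (Set.ncard_union_le _ _)
    · rintro x ⟨hx, hz⟩
      by_cases h : x ∈ A
      · exact Or.inl ⟨h, hz⟩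
      · exact Or.inr ⟨hx, h⟩
    · exact (hA.subset Set.inter_subset_left).union (hsAf.subset Set.diff_subset)
  have b2 : (A ∩ Z).ncard ≤ (sA ∩ Z).ncard + (A \ sA).ncard := by
    refine (Set.ncard_le_ncard (t := (sA ∩ Z) ∪ (A \ sA)) ?_ ?_).trans (Set.ncard_union_le _ _)
    · rintro x ⟨hx, hz⟩
      by_cases h : x ∈ sA
      · exact Or.inl ⟨h, hz⟩
      · exact Or.inr ⟨hx, h⟩
    · exact (hsAf.subset Set.inter_subset_left).union (hA.subset Set.diff_subset)
  rw [e1, abs_le]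
  have c1 : ((sA ∩ Z).ncard : ℝ) ≤ (A ∩ Z).ncard + (A \ ⋂ s ∈ S, (fun x : G => s * x) '' A).ncard := by
    exact_mod_cast (by lia : (sA ∩ Z).ncard ≤ (A ∩ Z).ncard + (A \ ⋂ s ∈ S, (fun x : G => s * x) '' A).ncard)
  have c2 : ((A ∩ Z).ncard : ℝ) ≤ (sA ∩ Z).ncard + (A \ ⋂ s ∈ S, (fun x : G => s * x) '' A).ncard := by
    exact_mod_cast (by lia : (A ∩ Z).ncard ≤ (sA ∩ Z).ncard + (A \ ⋂ s ∈ S, (fun x : G => s * x) '' A).ncard)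
  constructor <;> linarith

lemma fam_pow (m : FAM G) (S : Set G) (η : ℝ) (h : ∀ s ∈ S, ∀ Z, |m.m {a | s * a ∈ Z} - m.m Z| ≤ η) (n : ℕ) :
    ∀ s ∈ S ^ n, ∀ Z, |m.m {a | s * a ∈ Z} - m.m Z| ≤ n * η := by
  induction n with
  | zero =>
    intro s hs Z
    have : s = 1 := by simpa using hs
    subst this
    simp
  | succ n ih =>
    intro s hs Z
    rw [pow_succ] at hs
    obtain ⟨x, hx, y, hy, rfl⟩ := hs
    have a1 := ih x hx Z
    have a2 := h y hy {a | x * a ∈ Z}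
    have e : {a | x * y * a ∈ Z} = {a | y * a ∈ {a | x * a ∈ Z}} := by
      ext a; simp [mul_assoc]
    change |m.m {a | x * y * a ∈ Z} - m.m Z| ≤ _
    rw [e]
    push_cast
    rw [abs_le] at *
    constructor <;> linarith
end Count

theorem main_group {G : Type*} [Group G] (hfg : Group.FG G) {K : Type*} [Field K] [IsAlgClosed K] (hK : GoodF K)
    {n : ℕ} (ρ : G →* GL (Fin n) K) (hρ : Function.Injective ρ)
    (hns : ¬ ∃ H : Subgroup G, H.FiniteIndex ∧ IsSolvable H) :
    ∃ h : ℝ, 0 < h ∧ ∀ S : Finset G, (1 : G) ∈ S → (∀ s ∈ S, s⁻¹ ∈ S) →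
        Subgroup.closure (S : Set G) = ⊤ → ∀ A : Set G, A.Finite → A.Nonempty →
          h * A.ncard ≤ (A \ ⋂ s ∈ S, (fun x : G => s * x) '' A).ncard := by
  obtain ⟨H0, hH0, d, hd, φ, hφ⟩ := exists_rep ρ hρ hns
  have hd1 : 1 ≤ d := by lia
  have hgen : ∀ S : Set G, S.Finite → 1 ∈ S → (∀ s ∈ S, s⁻¹ ∈ S) → Subgroup.closure S = ⊤ →
      ∃ T : Set H0, T = {h : H0 | (h : G) ∈ S ^ (2 * H0.index + 1)} ∧ (slSet φ T).Finite ∧ 1 ∈ slSet φ T ∧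
        (∀ s ∈ slSet φ T, s⁻¹ ∈ slSet φ T) ∧ Subgroup.closure (slSet φ T) = slGrp φ := by
    intro S hS h1 hsym hcl
    have t1 : (1 : H0) ∈ {h : H0 | (h : G) ∈ S ^ (2 * H0.index + 1)} := Set.one_mem_pow h1
    have t2 : ∀ s ∈ {h : H0 | (h : G) ∈ S ^ (2 * H0.index + 1)}, s⁻¹ ∈ {h : H0 | (h : G) ∈ S ^ (2 * H0.index + 1)} :=
      fun s hs => inv_mem_pow hsym hs
    refine ⟨_, rfl, slSet_finite hd1 φ ((finite_pow hS _).preimage Subtype.val_injective.injOn),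
      slSet_one φ t1, fun s hs => slSet_inv φ t2 hs, slGrp_closure hd1 φ t1 (schreier H0 h1 hsym hcl) t2⟩
  have huna : UNA (slGrp φ) := by
    refine hK d hd (slGrp φ) ?_ (fun γ hγ => hγ.1) (slGrp_span hd1 φ (hφ ⊤ inferInstance)) (slGrp_SI hd1 φ hφ)
    obtain ⟨S0, hS0⟩ := hfg.out
    obtain ⟨S, hS, h1, hsym, hcl⟩ := sym_gen S0.finite_toSet
    obtain ⟨T, -, hT1, -, -, hT2⟩ := hgen S hS h1 hsym (hcl.trans hS0)
    exact ⟨_, hT1, hT2⟩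
  obtain ⟨ε, hε, hU⟩ := huna
  set q := H0.index with hq
  set N : ℕ := 2 * q + 1 with hN
  have hN0 : (0 : ℝ) < N := by positivity
  refine ⟨ε / N, by positivity, fun S h1 hsym hcl A hA hne => ?_⟩
  obtain ⟨T, rfl, hT1, hT2, hT3, hT4⟩ := hgen S S.finite_toSet h1 hsym hcl
  obtain ⟨r, hr1, hr2, hr3⟩ := exists_retract H0 (S := (S : Set G)) h1 hsym hcl
  let τ : G → H0 := fun g => ⟨g * (r g)⁻¹, hr2 g⟩
  have hτ : ∀ (h : H0) (g : G), τ (h * g) = h * τ g := by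
    intro h g
    apply Subtype.ext
    change (h : G) * g * (r (h * g))⁻¹ = h * (g * (r g)⁻¹)
    rw [hr3 h h.2 g, mul_assoc]
  by_contra hcon
  push Not at hcon
  set D : ℝ := ((A \ ⋂ s ∈ S, (fun x : G => s * x) '' A).ncard : ℝ) with hD
  have hApos : (0 : ℝ) < A.ncard := by exact_mod_cast (Set.ncard_pos hA).2 hne
  let μ := countFAM A hA hne
  have hμ : ∀ s ∈ (S : Set G), ∀ Z, |μ.m {a | s * a ∈ Z} - μ.m Z| ≤ D / A.ncard := by
    intro s hs Z
    have := count_diff A hA S hs Z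
    change |((A ∩ {a | s * a ∈ Z}).ncard : ℝ) / A.ncard - ((A ∩ Z).ncard : ℝ) / A.ncard| ≤ _
    rw [← sub_div, abs_div, Nat.abs_cast]
    gcongr
  have hμN := fam_pow μ S _ hμ N
  have hle : N * (D / A.ncard) ≤ ε := by
    have h2 : D / A.ncard < ε / N := by rwa [div_lt_iff₀ hApos]
    rw [lt_div_iff₀ hN0] at h2
    linarith
  refine hU _ hT1 hT2 hT3 hT4 (μ.map (fun g => toM (φ (τ g)))) ?_ ?_
  · change μ.m ((fun g => toM (φ (τ g))) ⁻¹' {0}) = 0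
    have : (fun g => toM (φ (τ g))) ⁻¹' {0} = ∅ := by
      rw [Set.eq_empty_iff_forall_notMem]
      intro g hg
      have h0 : toM (φ (τ g)) = 0 := hg
      apply toM_det_ne (φ (τ g))
      haveI : Nonempty (Fin d) := ⟨⟨0, by lia⟩⟩
      rw [h0, det_zero]
    rw [this, FAM.empty]
  · rintro g ⟨-, s, hs, c, hc, e⟩ Y hY
    have e1 : (fun g => toM (φ (τ g))) ⁻¹' {x | toM g * x ∈ Y} =
        {a | (s : G) * a ∈ (fun g => toM (φ (τ g))) ⁻¹' Y} := by
      ext a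
      simp only [Set.mem_preimage, Set.mem_setOf_eq]
      rw [hτ, map_mul, toM_mul, e, smul_mul_assoc]
      constructor
      · intro h
        have := hY c⁻¹ (inv_ne_zero hc) _ h
        rwa [smul_smul, inv_mul_cancel₀ hc, one_smul] at this
      · exact hY c hc _
    change |μ.m ((fun g => toM (φ (τ g))) ⁻¹' {x | toM g * x ∈ Y}) - μ.m ((fun g => toM (φ (τ g))) ⁻¹' Y)| ≤ ε
    rw [e1]
    exact (hμN s hs _).trans hle

theorem uniform_cheeger_constant {K : Type*} [Field K] {n : ℕ}
    (Γ : Subgroup (GL (Fin n) K)) (hfg : Group.FG Γ)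
    (hns : ¬ ∃ H : Subgroup Γ, H.FiniteIndex ∧ IsSolvable ↥H) :
    ∃ h : ℝ, 0 < h ∧ ∀ S : Finset Γ, (1 : Γ) ∈ S → (∀ s ∈ S, s⁻¹ ∈ S) →
        Subgroup.closure (S : Set Γ) = ⊤ → ∀ A : Set Γ, A.Finite → A.Nonempty →
          h * A.ncard ≤ (A \ ⋂ s ∈ S, (fun x : Γ => s * x) '' A).ncard := by
  obtain ⟨K1, i1, i2, ρ, hK, hρ⟩ := descend_gp Γ hfg
  exact main_group hfg hK ρ hρ hns
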